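/- Let n ≥ 3 and Φ map P_o^n to C_p(ℝ^n). Assume that for every y ∈ ℝ^n the function s ↦ Φ(sT^n)(y) is bounded from below on some non-empty open interval I_y ⊂ (0, ∞). Then Φ is an SL(n) covariant valuation if and only if there exist constants a₁, a₂, b₁, b₂, c₁, c₂ ∈ ℝ such that Φ(P) = c₁·h_{M_p⁺P}^p + c₂·h_{M_p⁻P}^p + Φ_{p;a₁,a₂}(P) + Φ_{p;b₁,b₂}(−P) for every P ∈ P_o^n. -/

import Mathlib

open scoped RealInnerProductSpace BigOperators Pointwise ENNReal
open MeasureTheory Filter Matrix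

noncomputable section

/-- `Euc n` is Euclidean space `ℝ^n`. -/
abbrev Euc (n : ℕ) := EuclideanSpace ℝ (Fin n)

/-- A convex body in `ℝ^n` containing the origin: a nonempty compact convex set with `0 ∈ K`. -/
def IsConvexBody0 {n : ℕ} (K : Set (Euc n)) : Prop :=
  IsCompact K ∧ Convex ℝ K ∧ (0 : Euc n) ∈ K

/-- A convex polytope in `ℝ^n` containing the origin. -/
def IsPolytope0 {n : ℕ} (P : Set (Euc n)) : Prop :=
  (∃ S : Finset (Euc n), P = convexHull ℝ (S : Set (Euc n))) ∧ (0 : Euc n) ∈ P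

/-- The support function `h_K(x) = sup { ⟪x, y⟫ : y ∈ K }`. -/
def supp {n : ℕ} (K : Set (Euc n)) (x : Euc n) : ℝ :=
  sSup ((fun y => ⟪x, y⟫) '' K)

/-- The image of a set under the linear map induced by a matrix. -/
def matAct {n : ℕ} (A : Matrix (Fin n) (Fin n) ℝ) (K : Set (Euc n)) : Set (Euc n) :=
  (Matrix.toEuclideanLin A) '' K

/-- The vector `A x`. -/
def matVec {n : ℕ} (A : Matrix (Fin n) (Fin n) ℝ) (x : Euc n) : Euc n :=
  Matrix.toEuclideanLin A x

/-- The dimension of a set: the dimension of (the direction of) its affine hull. -/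
def sdim {n : ℕ} (P : Set (Euc n)) : ℕ :=
  Module.finrank ℝ (affineSpan ℝ P).direction

/-- Support function of the asymmetric `L_p` moment body:
`h_{M_p⁺K}(x) = (∫_K max(⟪x,y⟫,0)^p dy)^(1/p)`. -/
def mPlus {n : ℕ} (p : ℝ) (K : Set (Euc n)) (x : Euc n) : ℝ :=
  (∫ y in K, max ⟪x, y⟫ 0 ^ p) ^ (1 / p)

/-- Support function of the asymmetric `L_p` moment body `M_p⁻`. -/
def mMinus {n : ℕ} (p : ℝ) (K : Set (Euc n)) (x : Euc n) : ℝ :=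
  (∫ y in K, max (-⟪x, y⟫) 0 ^ p) ^ (1 / p)

/-- The set of `j`-dimensional faces of `P` containing the origin (faces of a polytope
being exactly its exposed faces). -/
def facesO {n : ℕ} (j : ℕ) (P : Set (Euc n)) : Set (Set (Euc n)) :=
  {F | IsExposed ℝ P F ∧ sdim F = j ∧ (0 : Euc n) ∈ F}

/-- The function-valued valuation `Φ_{p;a₁,a₂}`:
`Φ_{p;a₁,a₂}(P) = a₁ h_P^p + (a₂-a₁) Σ_{1≤j≤dim P-1} (-1)^j Σ_{F ∈ F_{j,o}(P)} h_F^p` if `dim P` is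
odd, and with leading coefficient `2a₂ - a₁` instead of `a₁` if `dim P` is even. -/
def PhiP {n : ℕ} (p a₁ a₂ : ℝ) (P : Set (Euc n)) : Euc n → ℝ := fun x =>
  (if Odd (sdim P) then a₁ else 2 * a₂ - a₁) * supp P x ^ p
    + (a₂ - a₁) * ∑ j ∈ Finset.Icc 1 (sdim P - 1),
        (-1 : ℝ) ^ j * ∑ᶠ F ∈ facesO j P, supp F x ^ p

/-- The `i`-th standard basis vector. -/
def bvec {n : ℕ} (i : Fin n) : Euc n := EuclideanSpace.single i (1 : ℝ)

/-- The simplex `T^d = [o, e₁, …, e_d]` inside `ℝ^n`. -/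
def Td (n d : ℕ) : Set (Euc n) :=
  convexHull ℝ (insert 0 (bvec '' {i : Fin n | (i : ℕ) < d}))

section HPolyhedra

/-- The polyhedron cut out by finitely many affine inequalities. -/
def hSet {E : Type*} [AddCommGroup E] [Module ℝ E] (M : Finset ((E →ₗ[ℝ] ℝ) × ℝ)) : Set E :=
  {y | ∀ m ∈ M, m.1 y ≤ m.2}

variable {E : Type*} [NormedAddCommGroup E] [NormedSpace ℝ E] [FiniteDimensional ℝ E]

theorem hSet_union {E : Type*} [AddCommGroup E] [Module ℝ E] [DecidableEq ((E →ₗ[ℝ] ℝ) × ℝ)]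
    (M N : Finset ((E →ₗ[ℝ] ℝ) × ℝ)) : hSet (M ∪ N) = hSet M ∩ hSet N := by
  ext y
  simp only [hSet, Finset.mem_union, Set.mem_ofPred_eq, Set.mem_inter_iff]
  exact ⟨fun h => ⟨fun m hm => h m (Or.inl hm), fun m hm => h m (Or.inr hm)⟩,
    fun h m hm => hm.elim (h.1 m) (h.2 m)⟩

theorem isClosed_hSet (M : Finset ((E →ₗ[ℝ] ℝ) × ℝ)) : IsClosed (hSet M) := by
  have : hSet M = ⋂ m ∈ M, {y | m.1 y ≤ m.2} := by ext; simp [hSet]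
  rw [this]
  exact isClosed_biInter fun m _ =>
    isClosed_le (LinearMap.continuous_of_finiteDimensional m.1) continuous_const

theorem convex_hSet {E : Type*} [AddCommGroup E] [Module ℝ E]
    (M : Finset ((E →ₗ[ℝ] ℝ) × ℝ)) : Convex ℝ (hSet M) := by
  have : hSet M = ⋂ m ∈ M, {y | m.1 y ≤ m.2} := by ext; simp [hSet]
  rw [this]
  exact convex_iInter₂ fun m _ => convex_halfSpace_le m.1.isLinear _

theorem finite_extremePoints_hSet {E : Type*} [AddCommGroup E] [Module ℝ E] (M : Finset ((E →ₗ[ℝ] ℝ) × ℝ)) :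
    ((hSet M).extremePoints ℝ).Finite := by
  classical
  refine Set.Finite.of_finite_image (f := fun x => M.filter (fun m => m.1 x = m.2))
    ((M.powerset.finite_toSet).subset ?_) ?_
  · rintro _ ⟨x, -, rfl⟩
    simp only [Finset.coe_powerset, Set.mem_preimage, Set.mem_powerset_iff, Finset.coe_subset]
    exact Finset.filter_subset _ _
  · intro x hx x' hx' hxx
    by_contra hne
    have hact : ∀ m ∈ M, m.1 x = m.2 → m.1 x' = m.2 := by
      intro m hm h
      have : m ∈ M.filter (fun m => m.1 x = m.2) := by simp [hm, h]
      rw [show (M.filter fun m => m.1 x = m.2) = M.filter fun m => m.1 x' = m.2 from hxx] at this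
      simpa [hm] using this
    have hev : ∀ᶠ ε : ℝ in nhds 0, ∀ m ∈ M,
        m.1 (x + ε • (x' - x)) ≤ m.2 ∧ m.1 (x - ε • (x' - x)) ≤ m.2 := by
      refine (Filter.eventually_all_finset M).2 fun m hm => ?_
      rcases (hx.1 m hm).lt_or_eq with h | h
      · have h1 : ∀ᶠ ε : ℝ in nhds 0, m.1 x + ε * (m.1 x' - m.1 x) < m.2 := by
          refine ContinuousAt.eventually_lt (f := fun ε : ℝ => m.1 x + ε * (m.1 x' - m.1 x))
            (g := fun _ => m.2) (by fun_prop) (by fun_prop) (by simpa using h)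
        have h2 : ∀ᶠ ε : ℝ in nhds 0, m.1 x - ε * (m.1 x' - m.1 x) < m.2 := by
          refine ContinuousAt.eventually_lt (f := fun ε : ℝ => m.1 x - ε * (m.1 x' - m.1 x))
            (g := fun _ => m.2) (by fun_prop) (by fun_prop) (by simpa using h)
        filter_upwards [h1, h2] with ε h1 h2
        simp only [map_add, map_sub, map_smul, smul_eq_mul]
        exact ⟨h1.le, h2.le⟩
      · refine Filter.Eventually.of_forall fun ε => ?_
        simp [hact m hm h, h]
    obtain ⟨ε, hε, hε0⟩ := ((hev.filter_mono nhdsWithin_le_nhds).and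
      (self_mem_nhdsWithin (s := Set.Ioi (0 : ℝ)))).exists
    have hseg : x ∈ openSegment ℝ (x - ε • (x' - x)) (x + ε • (x' - x)) := by
      refine ⟨1 / 2, 1 / 2, by norm_num, by norm_num, by norm_num, ?_⟩
      module
    have := hx.2 (fun m hm => (hε m hm).2) (fun m hm => (hε m hm).1) hseg
    have h0 : ε • (x' - x) = 0 := by simpa using this
    rcases smul_eq_zero.1 h0 with h | h
    · exact (ne_of_gt hε0) h
    · exact hne (sub_eq_zero.1 h).symm

theorem exists_finset_eq_convexHull_of_hSet (M : Finset ((E →ₗ[ℝ] ℝ) × ℝ))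
    (hb : Bornology.IsBounded (hSet M)) : ∃ S : Finset E, hSet M = convexHull ℝ (S : Set E) := by
  refine ⟨(finite_extremePoints_hSet M).toFinset, ?_⟩
  have hc : IsCompact (hSet M) := Metric.isCompact_of_isClosed_isBounded (isClosed_hSet M) hb
  rw [Set.Finite.coe_toFinset]
  have := closure_convexHull_extremePoints hc (convex_hSet M)
  rw [IsClosed.closure_eq] at this
  · exact this.symm
  · exact ((finite_extremePoints_hSet M).isCompact_convexHull (𝕜 := ℝ)).isClosed

end HPolyhedra

theorem exists_hSet_eq_convexHull {n : ℕ} (S : Finset (Euc n)) :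
    ∃ M : Finset ((Euc n →ₗ[ℝ] ℝ) × ℝ), convexHull ℝ (S : Set (Euc n)) = hSet M := by
  classical
  let ev : Euc n → (Euc n × ℝ →ₗ[ℝ] ℝ) := fun v =>
    (innerₛₗ ℝ v).comp (LinearMap.fst ℝ _ _) - LinearMap.snd ℝ _ _
  let co : Fin n → (Euc n × ℝ →ₗ[ℝ] ℝ) := fun i =>
    (innerₛₗ ℝ (bvec i)).comp (LinearMap.fst ℝ _ _)
  let N : Finset ((Euc n × ℝ →ₗ[ℝ] ℝ) × ℝ) :=
    S.image (fun v => (ev v, 0)) ∪ Finset.univ.image (fun i => (co i, 1)) ∪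
      Finset.univ.image (fun i => (- co i, 1)) ∪
      {(LinearMap.snd ℝ _ _, 1), (- LinearMap.snd ℝ _ _, 1)}
  have hN : ∀ q : Euc n × ℝ, q ∈ hSet N ↔
      ((∀ v ∈ S, ⟪v, q.1⟫ ≤ q.2) ∧ ∀ i, |q.1 i| ≤ 1) ∧ |q.2| ≤ 1 := by
    intro q
    simp only [hSet, N, Set.mem_ofPred_eq, Finset.mem_union, Finset.mem_image, Finset.mem_insert,
      Finset.mem_singleton, Finset.mem_univ, true_and]
    constructor
    · intro h
      refine ⟨⟨fun v hv => ?_, fun i => ?_⟩, ?_⟩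
      · have := h (ev v, 0) (Or.inl (Or.inl (Or.inl ⟨v, hv, rfl⟩)))
        simpa [ev] using this
      · have h1 := h (co i, 1) (Or.inl (Or.inl (Or.inr ⟨i, rfl⟩)))
        have h2 := h (-co i, 1) (Or.inl (Or.inr ⟨i, rfl⟩))
        simp [co, bvec, EuclideanSpace.inner_single_left] at h1 h2
        exact abs_le.2 ⟨by linarith, h1⟩
      · have h1 := h (LinearMap.snd ℝ _ _, 1) (Or.inr (Or.inl rfl))
        have h2 := h (-LinearMap.snd ℝ _ _, 1) (Or.inr (Or.inr rfl))
        simp at h1 h2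
        exact abs_le.2 ⟨by linarith, h1⟩
    · rintro ⟨⟨h1, h2⟩, h3⟩ m hm
      rcases hm with ((⟨v, hv, rfl⟩ | ⟨i, rfl⟩) | ⟨i, rfl⟩) | rfl | rfl
      · simpa [ev] using h1 v hv
      · simpa [co, bvec, EuclideanSpace.inner_single_left] using (abs_le.1 (h2 i)).2
      · have := (abs_le.1 (h2 i)).1
        simp [co, bvec, EuclideanSpace.inner_single_left]
        linarith
      · exact (abs_le.1 h3).2
      · have := (abs_le.1 h3).1
        simp
        linarith
  have hnorm : ∀ a : Euc n, (∀ i, |a i| ≤ 1) → ‖a‖ ≤ n := by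
    intro a ha
    have h1 : a = ∑ i, a i • bvec i := by
      ext j
      simp [bvec, Pi.single_apply]
    rw [h1]
    refine (norm_sum_le _ _).trans ?_
    calc ∑ i, ‖a i • bvec i‖ ≤ ∑ _i : Fin n, (1 : ℝ) := by
          refine Finset.sum_le_sum fun i _ => ?_
          simpa [norm_smul, bvec] using ha i
      _ = n := by simp
  have hbd : Bornology.IsBounded (hSet N) := by
    refine (Metric.isBounded_iff_subset_closedBall (0 : Euc n × ℝ)).2 ⟨n + 1, fun q hq => ?_⟩
    rw [hN] at hq
    rw [mem_closedBall_zero_iff, Prod.norm_def]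
    refine max_le ?_ ?_
    · linarith [hnorm q.1 hq.1.2]
    · rw [Real.norm_eq_abs]
      have : (0 : ℝ) ≤ n := Nat.cast_nonneg n
      linarith [hq.2]
  obtain ⟨A, hA⟩ := exists_finset_eq_convexHull_of_hSet N hbd
  refine ⟨A.image fun q => (innerₛₗ ℝ q.1, q.2), ?_⟩
  apply Set.Subset.antisymm
  · refine convexHull_min (fun v hv => ?_) (convex_hSet _)
    intro m hm
    obtain ⟨q, hq, rfl⟩ := Finset.mem_image.1 hm
    have : q ∈ hSet N := hA ▸ subset_convexHull ℝ _ hq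
    have := ((hN q).1 this).1.1 v hv
    simpa [real_inner_comm] using this
  · intro y hy
    by_contra hyS
    obtain ⟨f, u, hu1, hu2⟩ := geometric_hahn_banach_closed_point (convex_convexHull ℝ (S : Set (Euc n)))
      ((S.finite_toSet.isCompact_convexHull (𝕜 := ℝ)).isClosed) hyS
    let a : Euc n := (InnerProductSpace.toDual ℝ (Euc n)).symm f
    have ha : ∀ z, ⟪a, z⟫ = f z := fun z => InnerProductSpace.toDual_symm_apply
    set c : ℝ := 1 / (‖a‖ + |u| + 1) with hc
    have hcpos : 0 < c := by positivity
    have hmem : (c • a, c * u) ∈ hSet N := by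
      rw [hN]
      refine ⟨⟨fun v hv => ?_, fun i => ?_⟩, ?_⟩
      · have := hu1 v (subset_convexHull ℝ _ hv)
        rw [← ha] at this
        simp only [inner_smul_right]
        rw [real_inner_comm]
        exact mul_le_mul_of_nonneg_left this.le hcpos.le
      · have h1 : |a i| ≤ ‖a‖ := by
          simpa using PiLp.norm_apply_le a i
        have h2 : |a i| ≤ ‖a‖ + |u| + 1 := by linarith [abs_nonneg u]
        simp only [PiLp.smul_apply, smul_eq_mul, abs_mul, abs_of_pos hcpos]
        rw [hc, one_div, inv_mul_le_iff₀ (by positivity)]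
        linarith
      · simp only [abs_mul, abs_of_pos hcpos]
        rw [hc, one_div, inv_mul_le_iff₀ (by positivity)]
        linarith [norm_nonneg a]
    rw [hA] at hmem
    have hconv : Convex ℝ {q : Euc n × ℝ | ⟪y, q.1⟫ - q.2 ≤ 0} := by
      have := convex_halfSpace_le (𝕜 := ℝ) (f := ev y) (ev y).isLinear (r := 0)
      simpa [ev] using this
    have hsub : convexHull ℝ (A : Set (Euc n × ℝ)) ⊆ {q : Euc n × ℝ | ⟪y, q.1⟫ - q.2 ≤ 0} := by
      refine convexHull_min (fun q hq => ?_) hconv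
      have := hy (innerₛₗ ℝ q.1, q.2) (Finset.mem_image_of_mem _ hq)
      simp only [innerₛₗ_apply_apply] at this
      rw [real_inner_comm] at this
      simpa using this
    have := hsub hmem
    simp only [Set.mem_ofPred_eq, inner_smul_right] at this
    rw [real_inner_comm, ha] at this
    nlinarith

theorem isPolytope0_iff {n : ℕ} {P : Set (Euc n)} : IsPolytope0 P ↔
    (∃ M : Finset ((Euc n →ₗ[ℝ] ℝ) × ℝ), P = hSet M) ∧ Bornology.IsBounded P ∧ (0 : Euc n) ∈ P := by
  constructor
  · rintro ⟨⟨S, rfl⟩, h0⟩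
    exact ⟨exists_hSet_eq_convexHull S, (S.finite_toSet.isCompact_convexHull (𝕜 := ℝ)).isBounded, h0⟩
  · rintro ⟨⟨M, rfl⟩, hb, h0⟩
    exact ⟨exists_finset_eq_convexHull_of_hSet M hb, h0⟩

section Simplices

/-- The simplex with one vertex at the origin and the other vertices given by `v`. -/
def oSimplex {n : ℕ} {ι : Type*} (v : ι → Euc n) : Set (Euc n) :=
  convexHull ℝ (insert 0 (Set.range v))

theorem mem_oSimplex {n : ℕ} {ι : Type*} [Fintype ι] (v : ι → Euc n) (y : Euc n) :
    y ∈ oSimplex v ↔ ∃ b : ι → ℝ, (∀ i, 0 ≤ b i) ∧ ∑ i, b i ≤ 1 ∧ ∑ i, b i • v i = y := by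
  classical
  constructor
  · intro hy
    have hconv : Convex ℝ {y : Euc n | ∃ b : ι → ℝ, (∀ i, 0 ≤ b i) ∧ ∑ i, b i ≤ 1 ∧
        ∑ i, b i • v i = y} := by
      rintro _ ⟨b, hb0, hb1, rfl⟩ _ ⟨c, hc0, hc1, rfl⟩ s t hs ht hst
      refine ⟨fun i => s * b i + t * c i, fun i => ?_, ?_, ?_⟩
      · have := hb0 i
        have := hc0 i
        positivity
      · rw [Finset.sum_add_distrib, ← Finset.mul_sum, ← Finset.mul_sum]
        nlinarith
      · simp only [add_smul, Finset.sum_add_distrib, Finset.smul_sum, mul_smul]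
    refine convexHull_min ?_ hconv hy
    rintro z (rfl | ⟨i, rfl⟩)
    · exact ⟨0, by simp, by simp, by simp⟩
    · refine ⟨Pi.single i 1, fun j => ?_, by simp, ?_⟩
      · by_cases h : j = i
        · subst h; simp
        · simp [h]
      · simp [Pi.single_apply]
  · rintro ⟨b, hb0, hb1, rfl⟩
    have := (convex_convexHull ℝ (insert 0 (Set.range v))).sum_mem (t := Finset.univ)
      (w := fun o : Option ι => o.elim (1 - ∑ i, b i) b) (z := fun o => o.elim 0 v)
      (by rintro (_ | i) - <;> simp [hb0]; exact hb1) (by simp [Fintype.sum_option])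
      (by rintro (_ | i) -
          · exact subset_convexHull ℝ _ (Set.mem_insert _ _)
          · exact subset_convexHull ℝ _ (Set.mem_insert_of_mem _ ⟨i, rfl⟩))
    simpa [Fintype.sum_option, oSimplex] using this

theorem isPolytope0_oSimplex {n : ℕ} {ι : Type*} [Fintype ι] (v : ι → Euc n) :
    IsPolytope0 (oSimplex v) := by
  classical
  refine ⟨⟨insert 0 (Finset.univ.image v), by simp [oSimplex]⟩, ?_⟩
  exact subset_convexHull ℝ _ (Set.mem_insert _ _)

theorem IsPolytope0.inter_halfSpace {n : ℕ} {P : Set (Euc n)} (hP : IsPolytope0 P)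
    (u : Euc n →ₗ[ℝ] ℝ) : IsPolytope0 (P ∩ {y | u y ≤ 0}) := by
  classical
  rw [isPolytope0_iff] at hP ⊢
  obtain ⟨⟨M, rfl⟩, hb, h0⟩ := hP
  refine ⟨⟨M ∪ {(u, 0)}, ?_⟩, hb.subset Set.inter_subset_left, h0, by simp⟩
  rw [hSet_union]
  simp [hSet]

end Simplices

section Dissection

variable {n : ℕ}

/-- The section at height one of a subset of `ℝ^n × ℝ`. -/
def slice (D : Set (Euc n × ℝ)) : Set (Euc n) := {y | (y, (1 : ℝ)) ∈ D}

/-- The sum of the cone generated by `W` and of the polyhedral cone `{y ∈ E : m y ≤ 0, m ∈ M}`. -/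
def joinCone {j : ℕ} (W : Fin j → Euc n × ℝ) (E : Submodule ℝ (Euc n × ℝ))
    (M : Finset (Euc n × ℝ →ₗ[ℝ] ℝ)) : Set (Euc n × ℝ) :=
  {q | ∃ c : Fin j → ℝ, (∀ i, 0 ≤ c i) ∧ ∃ y ∈ E, (∀ m ∈ M, m y ≤ 0) ∧ q = ∑ i, c i • W i + y}

theorem mem_joinCone_of_mem {j : ℕ} (W : Fin j → Euc n × ℝ) {E : Submodule ℝ (Euc n × ℝ)}
    {M : Finset (Euc n × ℝ →ₗ[ℝ] ℝ)} {y : Euc n × ℝ} (hy : y ∈ E) (hM : ∀ m ∈ M, m y ≤ 0) :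
    y ∈ joinCone W E M :=
  ⟨0, by simp, y, hy, hM, by simp⟩

theorem joinCone_insert {j : ℕ} (W : Fin j → Euc n × ℝ) (E : Submodule ℝ (Euc n × ℝ))
    [DecidableEq (Euc n × ℝ →ₗ[ℝ] ℝ)]
    (M : Finset (Euc n × ℝ →ₗ[ℝ] ℝ)) (u : Euc n × ℝ →ₗ[ℝ] ℝ) (hu : ∀ i, u (W i) = 0) :
    joinCone W E (insert u M) = joinCone W E M ∩ {q | u q ≤ 0} := by
  have key : ∀ (c : Fin j → ℝ) y, u (∑ i, c i • W i + y) = u y := by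
    intro c y
    simp [hu]
  ext q
  constructor
  · rintro ⟨c, hc, y, hy, hM, rfl⟩
    refine ⟨⟨c, hc, y, hy, fun m hm => hM m (Finset.mem_insert_of_mem hm), rfl⟩, ?_⟩
    rw [Set.mem_ofPred_eq, key]
    exact hM u (Finset.mem_insert_self _ _)
  · rintro ⟨⟨c, hc, y, hy, hM, rfl⟩, h⟩
    rw [Set.mem_ofPred_eq, key] at h
    refine ⟨c, hc, y, hy, fun m hm => ?_, rfl⟩
    rcases Finset.mem_insert.1 hm with rfl | hm
    · exact h
    · exact hM m hm

theorem slice_inter_le (D : Set (Euc n × ℝ)) (u : Euc n × ℝ →ₗ[ℝ] ℝ) (hu : u (0, 1) = 0) :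
    slice (D ∩ {q | u q ≤ 0}) = slice D ∩ {y | u.comp (LinearMap.inl ℝ _ _) y ≤ 0} := by
  ext y
  have : u (y, 1) = u (y, 0) := by
    rw [show (y, (1 : ℝ)) = (y, 0) + (0, 1) by simp, map_add, hu, add_zero]
  simp [slice, this]

theorem slice_joinCone_of_trivial {j : ℕ} (W : Fin j → Euc n × ℝ) (hW : LinearIndependent ℝ W)
    (E : Submodule ℝ (Euc n × ℝ)) (M : Finset (Euc n × ℝ →ₗ[ℝ] ℝ))
    (htriv : ∀ y ∈ E, (∀ m ∈ M, m y ≤ 0) → y = 0) (i₀ : Fin j) (hi₀ : W i₀ = (0, 1))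
    (hpos : ∀ q ∈ joinCone W E M, q ≠ 0 → 0 < q.2) :
    ∃ v : {i : Fin j // i ≠ i₀} → Euc n, LinearIndependent ℝ v ∧
      slice (joinCone W E M) = oSimplex v := by
  have hmem : ∀ q, q ∈ joinCone W E M ↔ ∃ c : Fin j → ℝ, (∀ i, 0 ≤ c i) ∧ q = ∑ i, c i • W i := by
    intro q
    constructor
    · rintro ⟨c, hc, y, hy, hM, rfl⟩
      exact ⟨c, hc, by rw [htriv y hy hM, add_zero]⟩
    · rintro ⟨c, hc, rfl⟩
      exact ⟨c, hc, 0, E.zero_mem, by simp, by simp⟩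
  have hτ : ∀ i, 0 < (W i).2 := by
    intro i
    refine hpos _ ((hmem _).2 ⟨Pi.single i 1, fun k => ?_, ?_⟩) (hW.ne_zero i)
    · by_cases h : k = i
      · subst h; simp
      · simp [h]
    · simp [Pi.single_apply]
  refine ⟨fun i => (W i).2⁻¹ • (W i).1, ?_, ?_⟩
  · rw [Fintype.linearIndependent_iff]
    intro a ha
    rw [Fintype.linearIndependent_iff] at hW
    have := hW (fun i => if h : i = i₀ then -∑ k, a k else a ⟨i, h⟩ * (W i).2⁻¹) ?_
    · intro i
      have h := this i
      simp only [i.2, dite_false] at h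
      exact (mul_eq_zero.1 h).resolve_right (inv_ne_zero (hτ i).ne')
    · rw [Fintype.sum_eq_add_sum_subtype_ne _ i₀, hi₀]
      ext1
      · simp only [Prod.fst_add, Prod.fst_sum, Prod.smul_fst, smul_zero, zero_add]
        simp only [Prod.fst_zero, ← ha, smul_smul]
        exact Finset.sum_congr rfl fun i _ => by rw [dif_neg i.2]
      · simp only [Prod.snd_add, Prod.snd_sum, Prod.smul_snd, smul_eq_mul, dite_true, mul_one,
          Prod.snd_zero]
        rw [neg_add_eq_zero]
        refine Finset.sum_congr rfl fun i _ => ?_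
        rw [dif_neg i.2, mul_assoc, inv_mul_cancel₀ (hτ i).ne', mul_one]
  · ext y
    rw [mem_oSimplex]
    change (y, (1 : ℝ)) ∈ joinCone W E M ↔ _
    rw [hmem]
    constructor
    · rintro ⟨c, hc, h⟩
      rw [Fintype.sum_eq_add_sum_subtype_ne _ i₀, hi₀] at h
      have h1 := congrArg Prod.fst h
      have h2 := congrArg Prod.snd h
      simp only [Prod.fst_add, Prod.fst_sum, Prod.smul_fst, smul_zero, zero_add] at h1
      simp only [Prod.snd_add, Prod.snd_sum, Prod.smul_snd, smul_eq_mul, mul_one] at h2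
      refine ⟨fun i => c i * (W i).2, fun i => mul_nonneg (hc _) (hτ _).le, ?_, ?_⟩
      · have := hc i₀
        linarith
      · rw [h1]
        refine Finset.sum_congr rfl fun i _ => ?_
        rw [smul_smul, mul_assoc, mul_inv_cancel₀ (hτ i).ne', mul_one]
    · rintro ⟨b, hb0, hb1, rfl⟩
      refine ⟨fun i => if h : i = i₀ then 1 - ∑ k, b k else b ⟨i, h⟩ * (W i).2⁻¹, fun i => ?_, ?_⟩
      · dsimp only
        split_ifs with h
        · linarith
        · exact mul_nonneg (hb0 _) (inv_nonneg.2 (hτ i).le)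
      · rw [Fintype.sum_eq_add_sum_subtype_ne _ i₀, hi₀]
        ext1
        · simp only [Prod.fst_add, Prod.fst_sum, Prod.smul_fst, smul_zero, zero_add]
          refine Finset.sum_congr rfl fun i _ => ?_
          rw [dif_neg i.2, smul_smul]
        · simp only [Prod.snd_add, Prod.snd_sum, Prod.smul_snd, smul_eq_mul, dite_true, mul_one]
          rw [eq_comm, sub_add_eq_add_sub, sub_eq_iff_eq_add, add_right_inj]
          refine Finset.sum_congr rfl fun i _ => ?_
          rw [dif_neg i.2, mul_assoc, inv_mul_cancel₀ (hτ i).ne', mul_one]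

theorem joinCone_cons {j : ℕ} (W : Fin j → Euc n × ℝ) (E : Submodule ℝ (Euc n × ℝ))
    [DecidableEq (Euc n × ℝ →ₗ[ℝ] ℝ)]
    (M : Finset (Euc n × ℝ →ₗ[ℝ] ℝ)) (w : Euc n × ℝ) (hwE : w ∈ E) (hwM : ∀ m ∈ M, m w ≤ 0)
    (m₀ : Euc n × ℝ →ₗ[ℝ] ℝ) (hm₀ : m₀ ∈ M) (hm₀w : m₀ w < 0)
    (hmin : ∀ m ∈ M, m w < 0 → ∀ y ∈ E, (∀ m ∈ M, m y ≤ 0) → m₀ y / m₀ w ≤ m y / m w) :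
    joinCone (Fin.cons w W : Fin (j + 1) → Euc n × ℝ) (E ⊓ LinearMap.ker m₀)
      (M.image fun m => m - (m w / m₀ w) • m₀) = joinCone W E M := by
  ext q
  constructor
  · rintro ⟨c, hc, y, hy, hM, rfl⟩
    obtain ⟨hyE, hy0⟩ := hy
    have hy0' : m₀ y = 0 := hy0
    refine ⟨fun i => c i.succ, fun i => hc _, c 0 • w + y,
      E.add_mem (E.smul_mem _ hwE) hyE, fun m hm => ?_, ?_⟩
    · have h1 := hM _ (Finset.mem_image_of_mem _ hm)
      simp [hy0'] at h1
      have h2 := mul_nonpos_of_nonneg_of_nonpos (hc 0) (hwM m hm)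
      simp
      linarith
    · rw [Fin.sum_univ_succ]
      simp only [Fin.cons_zero, Fin.cons_succ]
      abel
  · rintro ⟨c, hc, y, hy, hM, rfl⟩
    set t := m₀ y / m₀ w with ht
    have ht0 : 0 ≤ t := div_nonneg_of_nonpos (hM _ hm₀) hm₀w.le
    have hk : m₀ (y - t • w) = 0 := by
      simp [ht, div_mul_cancel₀ _ hm₀w.ne]
    refine ⟨Fin.cons t c, fun i => ?_, y - t • w,
      ⟨E.sub_mem hy (E.smul_mem _ hwE), hk⟩, fun m' hm' => ?_, ?_⟩
    · refine Fin.cases ?_ (fun i => ?_) i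
      · simpa using ht0
      · simpa using hc i
    · obtain ⟨m, hm, rfl⟩ := Finset.mem_image.1 hm'
      rw [LinearMap.sub_apply, LinearMap.smul_apply, hk, smul_zero, sub_zero, map_sub, map_smul,
        smul_eq_mul]
      rcases (hwM m hm).lt_or_eq with h | h
      · have h3 := hmin m hm h y hy hM
        rw [← ht, le_div_iff_of_neg h] at h3
        linarith
      · rw [h, mul_zero, sub_zero]
        exact hM m hm
    · rw [Fin.sum_univ_succ]
      simp only [Fin.cons_zero, Fin.cons_succ]
      abel

/-- `ψ` is additive with respect to cuts by hyperplanes through the origin. -/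
def CutAdditive (ψ : Set (Euc n) → ℝ) : Prop :=
  ∀ P, IsPolytope0 P → ∀ u : Euc n →ₗ[ℝ] ℝ,
    ψ P + ψ (P ∩ {y | u y ≤ 0} ∩ {y | (-u) y ≤ 0}) =
      ψ (P ∩ {y | u y ≤ 0}) + ψ (P ∩ {y | (-u) y ≤ 0})

theorem CutAdditive.slice_joinCone_eq_zero {ψ : Set (Euc n) → ℝ} (hψ : CutAdditive ψ)
    (hs : ∀ (ι : Type) [Fintype ι] (v : ι → Euc n), LinearIndependent ℝ v → ψ (oSimplex v) = 0)
    (k : ℕ) : ∀ (E : Submodule ℝ (Euc n × ℝ)), Module.finrank ℝ E = k →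
      ∀ (M : Finset (Euc n × ℝ →ₗ[ℝ] ℝ)) (j : ℕ) (W : Fin j → Euc n × ℝ),
      LinearIndependent ℝ W → Disjoint (Submodule.span ℝ (Set.range W)) E →
      (∀ m ∈ M, ∀ i, m (W i) = 0) →
      ((∃ i, W i = (0, 1)) ∨ (j = 0 ∧ ((0, 1) : Euc n × ℝ) ∈ E ∧ ∀ m ∈ M, m (0, 1) ≤ 0)) →
      IsPolytope0 (slice (joinCone W E M)) → (∀ q ∈ joinCone W E M, q ≠ 0 → 0 < q.2) →
      ψ (slice (joinCone W E M)) = 0 := by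
  classical
  induction k using Nat.strong_induction_on with
  | _ k ih =>
  intro E hE M j W hW hWE hMW hw0 hpol hpos
  by_cases htriv : ∀ y ∈ E, (∀ m ∈ M, m y ≤ 0) → y = 0
  · rcases hw0 with ⟨i₀, hi₀⟩ | ⟨-, h1, h2⟩
    · obtain ⟨v, hv, heq⟩ := slice_joinCone_of_trivial W hW E M htriv i₀ hi₀ hpos
      rw [heq]
      exact hs _ v hv
    · have := htriv _ h1 h2
      simp at this
  · obtain ⟨w, hwE, hwM, hw, hww0⟩ : ∃ w ∈ E, (∀ m ∈ M, m w ≤ 0) ∧ w ≠ 0 ∧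
        ((∃ i, W i = (0, 1)) ∨ (j = 0 ∧ w = (0, 1))) := by
      rcases hw0 with h | ⟨hj, h1, h2⟩
      · push Not at htriv
        obtain ⟨y, h1, h2, h3⟩ := htriv
        exact ⟨y, h1, h2, h3, Or.inl h⟩
      · exact ⟨(0, 1), h1, h2, by simp, Or.inr ⟨hj, rfl⟩⟩
    have hwpos : 0 < w.2 := hpos w (mem_joinCone_of_mem W hwE hwM) hw
    obtain ⟨m₁, hm₁, hm₁w⟩ : ∃ m ∈ M, m w < 0 := by
      by_contra! hcon
      have : -w ∈ joinCone W E M := mem_joinCone_of_mem W (E.neg_mem hwE) fun m hm => by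
        have := hcon m hm
        simpa using this
      have := hpos _ this (neg_ne_zero.2 hw)
      simp at this
      linarith
    suffices H : ∀ (r : ℕ) (M : Finset (Euc n × ℝ →ₗ[ℝ] ℝ)), (∀ m ∈ M, ∀ i, m (W i) = 0) →
        (∀ m ∈ M, m w ≤ 0) →
        IsPolytope0 (slice (joinCone W E M)) → (∀ q ∈ joinCone W E M, q ≠ 0 → 0 < q.2) →
        ∀ J ⊆ M, J.card = r + 1 → (∀ m ∈ J, m w < 0) →
        (∀ m ∈ M, m w < 0 → ∀ y ∈ E, (∀ m ∈ M, m y ≤ 0) → ∃ m' ∈ J, m' y / m' w ≤ m y / m w) →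
        ψ (slice (joinCone W E M)) = 0 by
      have hmem : m₁ ∈ M.filter (fun m => m w < 0) := by simp [hm₁, hm₁w]
      refine H ((M.filter (fun m => m w < 0)).card - 1) M hMW hwM hpol hpos
        (M.filter (fun m => m w < 0)) (Finset.filter_subset _ _) ?_ ?_ ?_
      · have := Finset.card_pos.2 ⟨_, hmem⟩
        omega
      · intro m hm
        exact (Finset.mem_filter.1 hm).2
      · intro m hm hmw y _ _
        exact ⟨m, Finset.mem_filter.2 ⟨hm, hmw⟩, le_rfl⟩
    clear hpol hpos hm₁w hm₁ hwM hMW hw0 htriv m₁ M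
    intro r
    induction r with
    | zero =>
      intro M hMW hwM hpol hpos J hJM hJ hJw hmin
      obtain ⟨m₀, rfl⟩ := Finset.card_eq_one.1 hJ
      have hm₀ : m₀ ∈ M := hJM (Finset.mem_singleton_self _)
      have hm₀w : m₀ w < 0 := hJw _ (Finset.mem_singleton_self _)
      have hD := joinCone_cons W E M w hwE hwM m₀ hm₀ hm₀w (by
        intro m hm hmw y hy hyM
        obtain ⟨m', hm', h⟩ := hmin m hm hmw y hy hyM
        rw [Finset.mem_singleton] at hm'
        exact hm' ▸ h)
      rw [← hD] at hpol hpos ⊢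
      have hwspan : w ∉ Submodule.span ℝ (Set.range W) := fun h =>
        hw (Submodule.disjoint_def.1 hWE w h hwE)
      refine ih _ ?_ (E ⊓ LinearMap.ker m₀) rfl _ (j + 1) _ ?_ ?_ ?_ ?_ hpol hpos
      · rw [← hE]
        refine Submodule.finrank_lt_finrank_of_lt (lt_of_le_of_ne inf_le_left fun h => ?_)
        have : w ∈ E ⊓ LinearMap.ker m₀ := by rwa [h]
        exact hm₀w.ne this.2
      · exact linearIndependent_finCons.2 ⟨hW, hwspan⟩
      · rw [Submodule.disjoint_def, Fin.range_cons]
        intro a ha ha'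
        obtain ⟨t, s, hs, rfl⟩ := Submodule.mem_span_insert.1 ha
        have hsE : s ∈ E := by
          have := E.sub_mem ha'.1 (E.smul_mem t hwE)
          simpa using this
        have hs0 : s = 0 := Submodule.disjoint_def.1 hWE s hs hsE
        have : m₀ (t • w + s) = 0 := ha'.2
        simp [hs0, hm₀w.ne] at this
        simp [this, hs0]
      · intro m' hm' i
        obtain ⟨m, hm, rfl⟩ := Finset.mem_image.1 hm'
        refine Fin.cases ?_ (fun i => ?_) i
        · simp [hm₀w.ne]
        · simp [hMW m hm, hMW m₀ hm₀]
      · left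
        rcases hww0 with ⟨i, hi⟩ | ⟨-, h⟩
        · exact ⟨i.succ, by simpa using hi⟩
        · exact ⟨0, by simpa using h⟩
    | succ r ihr =>
      intro M hMW hwM hpol hpos J hJM hJ hJw hmin
      obtain ⟨a, ha, b, hb, hab⟩ := Finset.one_lt_card.1 (by omega : 1 < J.card)
      have haw := hJw a ha
      have hbw := hJw b hb
      set u : Euc n × ℝ →ₗ[ℝ] ℝ := (a w)⁻¹ • a - (b w)⁻¹ • b with hu
      have huW : ∀ i, u (W i) = 0 := fun i => by simp [hu, hMW a (hJM ha), hMW b (hJM hb)]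
      have huw : u w = 0 := by simp [hu, haw.ne, hbw.ne]
      have hu0 : u (0, 1) = 0 := by
        rcases hww0 with ⟨i, hi⟩ | ⟨-, h⟩
        · rw [← hi, huW]
        · rw [← h, huw]
      have huy : ∀ y, u y = a y / a w - b y / b w := fun y => by
        simp [hu, div_eq_inv_mul]
      have step : ∀ u' : Euc n × ℝ →ₗ[ℝ] ℝ, (∀ i, u' (W i) = 0) → u' w = 0 → u' (0, 1) = 0 →
          ∀ M : Finset (Euc n × ℝ →ₗ[ℝ] ℝ), (∀ m ∈ M, ∀ i, m (W i) = 0) →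
          (∀ m ∈ M, m w ≤ 0) →
          IsPolytope0 (slice (joinCone W E M)) → (∀ q ∈ joinCone W E M, q ≠ 0 → 0 < q.2) →
          (∀ m ∈ insert u' M, ∀ i, m (W i) = 0) ∧ (∀ m ∈ insert u' M, m w ≤ 0) ∧
          IsPolytope0 (slice (joinCone W E (insert u' M))) ∧
          (∀ q ∈ joinCone W E (insert u' M), q ≠ 0 → 0 < q.2) := by
        intro u' h1 h2 h3 M hMW hwM hpol hpos
        rw [joinCone_insert W E M u' h1]
        refine ⟨?_, ?_, ?_, fun q hq => hpos q hq.1⟩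
        · intro m hm
          rcases Finset.mem_insert.1 hm with rfl | hm
          exacts [h1, hMW m hm]
        · intro m hm
          rcases Finset.mem_insert.1 hm with rfl | hm
          exacts [h2.le, hwM m hm]
        · rw [slice_inter_le _ _ h3]
          exact hpol.inter_halfSpace _
      have drop : ∀ (c d : Euc n × ℝ →ₗ[ℝ] ℝ), c ∈ J → d ∈ J → c ≠ d →
          ∀ M' : Finset (Euc n × ℝ →ₗ[ℝ] ℝ), M ⊆ M' → (∀ m ∈ M', m w < 0 → m ∈ M) →
          (∀ m ∈ M', ∀ i, m (W i) = 0) → (∀ m ∈ M', m w ≤ 0) →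
          IsPolytope0 (slice (joinCone W E M')) →
          (∀ q ∈ joinCone W E M', q ≠ 0 → 0 < q.2) →
          (∀ y ∈ E, (∀ m ∈ M', m y ≤ 0) → c y / c w ≤ d y / d w) →
          ψ (slice (joinCone W E M')) = 0 := by
        intro c d hc hd hcd M' hMM' hM'w h1 h2 h3 h4 h5
        refine ihr M' h1 h2 h3 h4 (J.erase d) ((Finset.erase_subset _ _).trans (hJM.trans hMM'))
          (by rw [Finset.card_erase_of_mem hd]; omega)
          (fun m hm => hJw m (Finset.mem_of_mem_erase hm)) ?_
        intro m hm hmw y hy hyM'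
        obtain ⟨m', hm', h⟩ := hmin m (hM'w m hm hmw) hmw y hy fun m hm => hyM' m (hMM' hm)
        by_cases hmd : m' = d
        · subst hmd
          exact ⟨c, Finset.mem_erase.2 ⟨hcd, hc⟩, (h5 y hy hyM').trans h⟩
        · exact ⟨m', Finset.mem_erase.2 ⟨hmd, hm'⟩, h⟩
      have hnW : ∀ i, (-u) (W i) = 0 := fun i => by simp [huW i]
      have hnw : (-u) w = 0 := by simp [huw]
      have hn0 : (-u) (0, 1) = 0 := by simp [hu0]
      obtain ⟨A1, A2, A3, A4⟩ := step u huW huw hu0 M hMW hwM hpol hpos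
      obtain ⟨B1, B2, B3, B4⟩ := step (-u) hnW hnw hn0 M hMW hwM hpol hpos
      obtain ⟨C1, C2, C3, C4⟩ := step (-u) hnW hnw hn0 (insert u M) A1 A2 A3 A4
      have hA := drop a b ha hb hab (insert u M) (Finset.subset_insert _ _) (by
          intro m hm hmw
          rcases Finset.mem_insert.1 hm with rfl | hm
          · exact absurd huw hmw.ne
          · exact hm) A1 A2 A3 A4 (fun y _ hy => by
            have := hy u (Finset.mem_insert_self _ _)
            rw [huy] at this
            linarith)
      have hB := drop b a hb ha hab.symm (insert (-u) M) (Finset.subset_insert _ _) (by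
          intro m hm hmw
          rcases Finset.mem_insert.1 hm with rfl | hm
          · exact absurd hnw hmw.ne
          · exact hm) B1 B2 B3 B4 (fun y _ hy => by
            have := hy (-u) (Finset.mem_insert_self _ _)
            rw [LinearMap.neg_apply, huy] at this
            linarith)
      have hC := drop a b ha hb hab (insert (-u) (insert u M))
        ((Finset.subset_insert _ _).trans (Finset.subset_insert _ _)) (by
          intro m hm hmw
          rcases Finset.mem_insert.1 hm with rfl | hm
          · exact absurd hnw hmw.ne
          · rcases Finset.mem_insert.1 hm with rfl | hm
            · exact absurd huw hmw.ne
            · exact hm) C1 C2 C3 C4 (fun y _ hy => by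
            have := hy u (Finset.mem_insert_of_mem (Finset.mem_insert_self _ _))
            rw [huy] at this
            linarith)
      have hcut := hψ _ hpol (u.comp (LinearMap.inl ℝ _ _))
      rw [joinCone_insert W E _ _ hnW, slice_inter_le _ _ hn0, joinCone_insert W E _ _ huW,
        slice_inter_le _ _ hu0] at hC
      rw [joinCone_insert W E _ _ hnW, slice_inter_le _ _ hn0] at hB
      rw [joinCone_insert W E _ _ huW, slice_inter_le _ _ hu0] at hA
      rw [LinearMap.neg_comp] at hC hB
      linarith

/-- A cut-additive function vanishing on all simplices with a vertex at the origin vanishes on all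
polytopes containing the origin. -/
theorem CutAdditive.eq_zero {ψ : Set (Euc n) → ℝ} (hψ : CutAdditive ψ)
    (hs : ∀ (ι : Type) [Fintype ι] (v : ι → Euc n), LinearIndependent ℝ v → ψ (oSimplex v) = 0)
    {P : Set (Euc n)} (hP : IsPolytope0 P) : ψ P = 0 := by
  classical
  obtain ⟨⟨N, hN⟩, hb, h0⟩ := isPolytope0_iff.1 hP
  let ho : (Euc n →ₗ[ℝ] ℝ) × ℝ → (Euc n × ℝ →ₗ[ℝ] ℝ) := fun m =>
    m.1.comp (LinearMap.fst ℝ _ _) - m.2 • LinearMap.snd ℝ _ _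
  let M : Finset (Euc n × ℝ →ₗ[ℝ] ℝ) := insert (- LinearMap.snd ℝ _ _) (N.image ho)
  have hD : ∀ q : Euc n × ℝ, q ∈ joinCone (Fin.elim0 : Fin 0 → Euc n × ℝ) ⊤ M ↔
      (0 ≤ q.2 ∧ ∀ m ∈ N, m.1 q.1 ≤ m.2 * q.2) := by
    intro q
    have : q ∈ joinCone (Fin.elim0 : Fin 0 → Euc n × ℝ) ⊤ M ↔ ∀ m ∈ M, m q ≤ 0 := by
      constructor
      · rintro ⟨c, -, y, -, hy, rfl⟩
        simpa using hy
      · exact fun h => mem_joinCone_of_mem _ Submodule.mem_top h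
    rw [this]
    simp only [M, Finset.mem_insert, Finset.mem_image, forall_eq_or_imp, forall_exists_index,
      and_imp, forall_apply_eq_imp_iff₂]
    simp [ho]
  have hsl : slice (joinCone (Fin.elim0 : Fin 0 → Euc n × ℝ) ⊤ M) = P := by
    ext y
    change (y, (1 : ℝ)) ∈ joinCone _ ⊤ M ↔ _
    rw [hD, hN]
    simp [hSet]
  rw [← hsl]
  refine hψ.slice_joinCone_eq_zero hs _ ⊤ rfl M 0 _ linearIndependent_empty_type (by simp)
    (fun _ _ i => i.elim0) (Or.inr ⟨rfl, Submodule.mem_top, ?_⟩) (hsl.symm ▸ hP) ?_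
  · have h := (hD (0, 1)).2 ⟨by simp, fun m hm => by
      have := (hN ▸ h0 : (0 : Euc n) ∈ hSet N) m hm
      simpa using this⟩
    obtain ⟨c, -, y, -, hy, he⟩ := h
    simp at he
    rw [he]
    exact hy
  · intro q hq hq0
    rw [hD] at hq
    refine lt_of_le_of_ne hq.1 fun h => ?_
    have hq1 : q.1 ≠ 0 := fun h1 => hq0 (Prod.ext h1 h.symm)
    obtain ⟨R, hR⟩ := hb.exists_norm_le
    have hmem : (((|R| + 1) / ‖q.1‖) • q.1) ∈ P := by
      rw [hN] at h0 ⊢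
      intro m hm
      have h1 := hq.2 m hm
      have h2 := h0 m hm
      rw [← h, mul_zero] at h1
      rw [map_zero] at h2
      rw [map_smul, smul_eq_mul]
      have : 0 ≤ (|R| + 1) / ‖q.1‖ := by positivity
      nlinarith
    have := hR _ hmem
    rw [norm_smul, Real.norm_eq_abs, abs_of_nonneg (by positivity),
      div_mul_cancel₀ _ (norm_ne_zero_iff.2 hq1)] at this
    linarith [le_abs_self R]

end Dissection

section SupportFunctions

variable {n : ℕ}

theorem bddAbove_inner_image {K : Set (Euc n)} (hK : IsCompact K) (x : Euc n) :
    BddAbove ((fun y => ⟪x, y⟫) '' K) :=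
  (hK.image (by fun_prop)).bddAbove

theorem inner_le_supp {K : Set (Euc n)} (hK : IsCompact K) (x : Euc n) {y : Euc n} (hy : y ∈ K) :
    ⟪x, y⟫ ≤ supp K x :=
  le_csSup (bddAbove_inner_image hK x) ⟨y, hy, rfl⟩

theorem supp_le {K : Set (Euc n)} (hK : K.Nonempty) (x : Euc n) {a : ℝ}
    (h : ∀ y ∈ K, ⟪x, y⟫ ≤ a) : supp K x ≤ a := by
  refine csSup_le (hK.image _) ?_
  rintro _ ⟨y, hy, rfl⟩
  exact h y hy

theorem supp_nonneg {K : Set (Euc n)} (hK : IsCompact K) (h0 : (0 : Euc n) ∈ K) (x : Euc n) :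
    0 ≤ supp K x := by
  simpa using inner_le_supp hK x h0

theorem exists_inner_eq_supp {K : Set (Euc n)} (hK : IsCompact K) (hne : K.Nonempty) (x : Euc n) :
    ∃ y ∈ K, ⟪x, y⟫ = supp K x := by
  have := (hK.image (f := fun y => ⟪x, y⟫) (by fun_prop)).sSup_mem (hne.image _)
  obtain ⟨y, hy, h⟩ := this
  exact ⟨y, hy, h⟩

theorem continuous_supp {K : Set (Euc n)} (hK : IsCompact K) : Continuous (supp K) := by
  unfold supp
  exact hK.continuous_sSup (f := fun (x y : Euc n) => ⟪x, y⟫) (by fun_prop)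

theorem supp_smul {K : Set (Euc n)} (c : ℝ) (hc : 0 ≤ c) (x : Euc n) :
    supp K (c • x) = c * supp K x := by
  unfold supp
  rw [← smul_eq_mul, ← Real.sSup_smul_of_nonneg hc]
  congr 1
  ext t
  simp [Set.mem_smul_set, inner_smul_left]

theorem supp_image (g : Euc n →ₗ[ℝ] Euc n) (K : Set (Euc n)) (x : Euc n) :
    supp (g '' K) x = supp K (LinearMap.adjoint g x) := by
  unfold supp
  rw [Set.image_image]
  simp only [LinearMap.adjoint_inner_left]

theorem supp_zero (x : Euc n) : supp ({0} : Set (Euc n)) x = 0 := by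
  simp [supp]

theorem exists_mem_segment_mem_inter {K L : Set (Euc n)} (hK : IsClosed K) (hL : IsClosed L)
    (h : Convex ℝ (K ∪ L)) {a b : Euc n} (ha : a ∈ K) (hb : b ∈ L) :
    ∃ c ∈ segment ℝ a b, c ∈ K ∩ L := by
  have hpre := (convex_segment (𝕜 := ℝ) a b).isPreconnected
  rw [isPreconnected_closed_iff] at hpre
  exact hpre K L hK hL (h.segment_subset (Or.inl ha) (Or.inr hb))
    ⟨a, left_mem_segment ℝ a b, ha⟩ ⟨b, right_mem_segment ℝ a b, hb⟩

theorem supp_rpow_union_add_inter (p : ℝ) {K L : Set (Euc n)} (hK : IsCompact K) (hL : IsCompact L)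
    (h : Convex ℝ (K ∪ L)) (hK0 : (0 : Euc n) ∈ K) (hL0 : (0 : Euc n) ∈ L) (x : Euc n) :
    supp (K ∪ L) x ^ p + supp (K ∩ L) x ^ p = supp K x ^ p + supp L x ^ p := by
  wlog hle : supp K x ≤ supp L x generalizing K L with H
  · have := H hL hK (by rwa [Set.union_comm]) hL0 hK0 (not_le.1 hle).le
    rw [Set.union_comm, Set.inter_comm, this, add_comm]
  have h1 : supp (K ∪ L) x = supp L x := by
    apply le_antisymm
    · refine supp_le ⟨0, Or.inl hK0⟩ x ?_
      rintro y (hy | hy)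
      · exact (inner_le_supp hK x hy).trans hle
      · exact inner_le_supp hL x hy
    · exact supp_le ⟨0, hL0⟩ x fun y hy => inner_le_supp (hK.union hL) x (Or.inr hy)
  have h2 : supp (K ∩ L) x = supp K x := by
    apply le_antisymm
    · exact supp_le (K := K ∩ L) ⟨0, hK0, hL0⟩ x fun y hy => inner_le_supp hK x hy.1
    · obtain ⟨a, ha, hax⟩ := exists_inner_eq_supp hK ⟨0, hK0⟩ x
      obtain ⟨b, hb, hbx⟩ := exists_inner_eq_supp hL ⟨0, hL0⟩ x
      obtain ⟨c, hc, hcKL⟩ := exists_mem_segment_mem_inter hK.isClosed hL.isClosed h ha hb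
      refine le_trans ?_ (inner_le_supp (hK.inter hL) x hcKL)
      obtain ⟨s, t, hs, ht, hst, rfl⟩ := hc
      rw [inner_add_right, inner_smul_right, inner_smul_right, hax, hbx]
      obtain rfl : s = 1 - t := by linarith
      linarith [mul_le_mul_of_nonneg_left hle ht]
  rw [h1, h2, add_comm]

end SupportFunctions

section MomentBodies

variable {n : ℕ}

theorem IsPolytope0.isCompact {P : Set (Euc n)} (hP : IsPolytope0 P) : IsCompact P := by
  obtain ⟨⟨S, rfl⟩, -⟩ := hP
  exact S.finite_toSet.isCompact_convexHull (𝕜 := ℝ)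

theorem IsPolytope0.convex {P : Set (Euc n)} (hP : IsPolytope0 P) : Convex ℝ P := by
  obtain ⟨⟨S, rfl⟩, -⟩ := hP
  exact convex_convexHull ℝ _

theorem mPlus_rpow {p : ℝ} (hp : 1 ≤ p) (K : Set (Euc n)) (x : Euc n) :
    mPlus p K x ^ p = ∫ y in K, max ⟪x, y⟫ 0 ^ p := by
  rw [mPlus, ← Real.rpow_mul, one_div_mul_cancel (by linarith), Real.rpow_one]
  exact integral_nonneg fun y => Real.rpow_nonneg (le_max_right _ _) _

theorem mMinus_eq (p : ℝ) (K : Set (Euc n)) (x : Euc n) : mMinus p K x = mPlus p K (-x) := by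
  simp [mMinus, mPlus, inner_neg_left]

theorem continuous_max_inner_rpow {p : ℝ} (hp : 1 ≤ p) :
    Continuous fun q : Euc n × Euc n => max ⟪q.1, q.2⟫ 0 ^ p :=
  Continuous.rpow_const (by fun_prop) fun _ => Or.inr (by linarith)

theorem integrableOn_max_inner_rpow {p : ℝ} (hp : 1 ≤ p) {K : Set (Euc n)} (hK : IsCompact K)
    (x : Euc n) : IntegrableOn (fun y => max ⟪x, y⟫ 0 ^ p) K :=
  ((continuous_max_inner_rpow hp).comp (Continuous.prodMk_right x)).continuousOn.integrableOn_compact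
    hK

theorem mPlus_rpow_union_add_inter {p : ℝ} (hp : 1 ≤ p) {K L : Set (Euc n)} (hK : IsCompact K)
    (hL : IsCompact L) (x : Euc n) :
    mPlus p (K ∪ L) x ^ p + mPlus p (K ∩ L) x ^ p = mPlus p K x ^ p + mPlus p L x ^ p := by
  simp only [mPlus_rpow hp]
  have h1 := integral_inter_add_sdiff hL.measurableSet (integrableOn_max_inner_rpow hp hK x)
  have h2 := setIntegral_union (disjoint_sdiff_self_right (x := L) (y := K))
    (hK.measurableSet.diff hL.measurableSet) (integrableOn_max_inner_rpow hp hL x)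
    ((integrableOn_max_inner_rpow hp hK x).mono_set Set.sdiff_subset)
  rw [Set.union_sdiff_self, Set.union_comm] at h2
  linarith

theorem mPlus_rpow_smul {p : ℝ} (hp : 1 ≤ p) (K : Set (Euc n)) {c : ℝ} (hc : 0 ≤ c) (x : Euc n) :
    mPlus p K (c • x) ^ p = c ^ p * mPlus p K x ^ p := by
  simp only [mPlus_rpow hp]
  rw [← integral_const_mul]
  congr 1
  ext y
  rw [inner_smul_left, ← Real.mul_rpow hc (le_max_right _ _)]
  congr 1
  simp [mul_max_of_nonneg _ _ hc]

theorem continuous_mPlus_rpow {p : ℝ} (hp : 1 ≤ p) {K : Set (Euc n)} (hK : IsCompact K) :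
    Continuous fun x => mPlus p K x ^ p := by
  simp only [mPlus_rpow hp]
  exact continuous_parametric_integral_of_continuous (continuous_max_inner_rpow hp) hK

theorem mPlus_rpow_image {p : ℝ} (hp : 1 ≤ p) (g : Euc n →ₗ[ℝ] Euc n)
    (hg : LinearMap.det g ≠ 0) {K : Set (Euc n)} (hK : IsCompact K) (x : Euc n) :
    mPlus p (g '' K) x ^ p = |LinearMap.det g| * mPlus p K (LinearMap.adjoint g x) ^ p := by
  simp only [mPlus_rpow hp]
  have hinj : Function.Injective g := (LinearMap.equivOfDetNeZero g hg).injective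
  have := integral_image_eq_integral_abs_det_fderiv_smul volume (s := K) hK.measurableSet
    (f := LinearMap.toContinuousLinearMap g) (f' := fun _ => LinearMap.toContinuousLinearMap g)
    (fun y _ => (LinearMap.toContinuousLinearMap g).hasFDerivWithinAt)
    (hinj.injOn) (fun y => max ⟪x, y⟫ 0 ^ p)
  simp only [LinearMap.coe_toContinuousLinearMap', LinearMap.det_toContinuousLinearMap] at this
  rw [this, ← integral_const_mul]
  simp only [smul_eq_mul, LinearMap.adjoint_inner_left]

end MomentBodies

section SignPatterns

variable {n : ℕ}

/-- The sign pattern of the functional `⟪l, ·⟫` on the finite set `V`, extended by zero. -/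
def signPattern (V : Finset (Euc n)) (l : Euc n) : Euc n → SignType :=
  open Classical in fun v => if v ∈ V then SignType.sign ⟪l, v⟫ else 0

theorem signPattern_of_mem {V : Finset (Euc n)} {v : Euc n} (hv : v ∈ V) (l : Euc n) :
    signPattern V l v = SignType.sign ⟪l, v⟫ := if_pos hv

theorem signPattern_of_notMem {V : Finset (Euc n)} {v : Euc n} (hv : v ∉ V) (l : Euc n) :
    signPattern V l v = 0 := if_neg hv

theorem signPattern_eq_iff {V : Finset (Euc n)} {l l' : Euc n} :
    signPattern V l = signPattern V l' ↔
      ∀ v ∈ V, SignType.sign ⟪l, v⟫ = SignType.sign ⟪l', v⟫ := by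
  refine ⟨fun h v hv => ?_, fun h => funext fun v => ?_⟩
  · rw [← signPattern_of_mem hv, h, signPattern_of_mem hv]
  · by_cases hv : v ∈ V
    · rw [signPattern_of_mem hv, signPattern_of_mem hv, h v hv]
    · rw [signPattern_of_notMem hv, signPattern_of_notMem hv]

open Classical in
theorem signPattern_insert {V : Finset (Euc n)} {v : Euc n} (hv : v ∉ V) (l : Euc n) :
    signPattern (insert v V) l = Function.update (signPattern V l) v (SignType.sign ⟪l, v⟫) := by
  funext z
  rcases eq_or_ne z v with rfl | hz
  · simp [signPattern]
  · simp [signPattern, hz]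

theorem finite_range_signPattern (V : Finset (Euc n)) : (Set.range (signPattern V)).Finite := by
  classical
  refine (Set.finite_range
    fun f : V → SignType => fun v : Euc n => if h : v ∈ V then f ⟨v, h⟩ else 0).subset ?_
  rintro _ ⟨l, rfl⟩
  refine ⟨fun v => SignType.sign ⟪l, (v : Euc n)⟫, funext fun v => ?_⟩
  by_cases h : v ∈ V <;> simp [signPattern, h]

/-- The rank of the zero set of a sign pattern. -/
def patternRank (V : Finset (Euc n)) (σ : Euc n → SignType) : ℕ :=
  Module.finrank ℝ (Submodule.span ℝ {z | z ∈ V ∧ σ z = 0})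

/-- The combinatorial Euler integral of `g` with respect to the hyperplane arrangement given
by `V`. -/
def patternSum (V : Finset (Euc n)) (g : Euc n → ℝ) : ℝ :=
  ∑ σ ∈ (finite_range_signPattern V).toFinset,
    (-1) ^ patternRank V σ * g (Function.invFun (signPattern V) σ)

theorem signPattern_invFun {V : Finset (Euc n)} {σ : Euc n → SignType}
    (h : σ ∈ Set.range (signPattern V)) :
    signPattern V (Function.invFun (signPattern V) σ) = σ :=
  Function.invFun_eq h

open Classical in
theorem patternRank_update_of_ne {V : Finset (Euc n)} {v : Euc n} (hv : v ∉ V)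
    (σ : Euc n → SignType) {s : SignType} (hs : s ≠ 0) :
    patternRank (insert v V) (Function.update σ v s) = patternRank V σ := by
  unfold patternRank
  have : {z | z ∈ insert v V ∧ Function.update σ v s z = 0} = {z | z ∈ V ∧ σ z = 0} := by
    ext z
    rcases eq_or_ne z v with rfl | hz
    · simp [hs, hv]
    · simp [hz]
  rw [this]

open Classical in
theorem zeroSet_update_zero {V : Finset (Euc n)} {v : Euc n} (σ : Euc n → SignType) :
    {z | z ∈ insert v V ∧ Function.update σ v 0 z = 0} = insert v {z | z ∈ V ∧ σ z = 0} := by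
  ext z
  rcases eq_or_ne z v with rfl | hz
  · simp
  · simp [hz]

theorem eventually_sign_eq (a b : ℝ) (h : a ≠ 0 ∨ b = 0) :
    ∀ᶠ ε in nhds (0 : ℝ), SignType.sign (a + ε * b) = SignType.sign a := by
  rcases h with h | rfl
  · have hc : ContinuousAt (fun ε : ℝ => a + ε * b) 0 := by fun_prop
    rcases lt_or_gt_of_ne h with h | h
    · filter_upwards [hc.eventually_lt continuousAt_const (by simpa using h)] with ε hε
      rw [sign_neg hε, sign_neg h]
    · filter_upwards [(continuousAt_const (y := (0 : ℝ))).eventually_lt hc (by simpa using h)]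
        with ε hε
      rw [sign_pos hε, sign_pos h]
  · simp

theorem eventually_signPattern_eq (V : Finset (Euc n)) (l d : Euc n)
    (h : ∀ z ∈ V, SignType.sign ⟪l, z⟫ = 0 → ⟪d, z⟫ = 0) :
    ∀ᶠ ε in nhds (0 : ℝ), signPattern V (l + ε • d) = signPattern V l := by
  have : ∀ᶠ ε in nhds (0 : ℝ), ∀ z ∈ V,
      SignType.sign (⟪l, z⟫ + ε * ⟪d, z⟫) = SignType.sign ⟪l, z⟫ := by
    rw [Filter.eventually_all_finset]
    intro z hz
    refine eventually_sign_eq _ _ ?_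
    by_cases h0 : ⟪l, z⟫ = 0
    · exact Or.inr (h z hz (by rw [h0, sign_zero]))
    · exact Or.inl h0
  filter_upwards [this] with ε hε
  rw [signPattern_eq_iff]
  intro z hz
  rw [inner_add_left, inner_smul_left]
  exact hε z hz

theorem sign_combo {a b s t : ℝ} (h : SignType.sign a = SignType.sign b) (hs : 0 < s) (ht : 0 < t) :
    SignType.sign (s * a + t * b) = SignType.sign a := by
  rcases lt_trichotomy a 0 with ha | rfl | ha
  · have hb : b < 0 := by rwa [sign_neg ha, eq_comm, sign_eq_neg_one_iff] at h
    rw [sign_neg ha, sign_neg (by nlinarith)]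
  · have hb : b = 0 := by rwa [sign_zero, eq_comm, sign_eq_zero_iff] at h
    simp [hb]
  · have hb : 0 < b := by rwa [sign_pos ha, eq_comm, sign_eq_one_iff] at h
    rw [sign_pos ha, sign_pos (by positivity)]

theorem exists_inner_eq_zero_of_notMem_span {Z : Set (Euc n)} {v : Euc n}
    (hv : v ∉ Submodule.span ℝ Z) : ∃ d : Euc n, (∀ z ∈ Z, ⟪d, z⟫ = 0) ∧ 0 < ⟪d, v⟫ := by
  set U := Submodule.span ℝ Z
  refine ⟨v - U.starProjection v, fun z hz => ?_, ?_⟩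
  · exact U.starProjection_inner_eq_zero v z (Submodule.subset_span hz)
  · have h1 : ⟪v - U.starProjection v, U.starProjection v⟫ = 0 :=
      U.starProjection_inner_eq_zero v _ (U.starProjection_apply_mem v)
    have h2 : ⟪v - U.starProjection v, v⟫
        = ⟪v - U.starProjection v, v - U.starProjection v⟫ := by
      rw [inner_sub_right _ v, h1, sub_zero]
    rw [h2, real_inner_self_pos, sub_ne_zero]
    intro h
    exact hv (h ▸ U.starProjection_apply_mem v)

open Classical in
theorem sum_fiber_pattern {V : Finset (Euc n)} {v : Euc n} (hv : v ∉ V) (l₀ : Euc n) :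
    ∑ s : SignType, (if Function.update (signPattern V l₀) v s ∈
        Set.range (signPattern (insert v V))
      then (-1 : ℝ) ^ patternRank (insert v V) (Function.update (signPattern V l₀) v s) else 0)
      = (-1) ^ patternRank V (signPattern V l₀) := by
  set σ := signPattern V l₀ with hσ
  have hmem : ∀ s, Function.update σ v s ∈ Set.range (signPattern (insert v V)) ↔
      ∃ l, signPattern V l = σ ∧ SignType.sign ⟪l, v⟫ = s := by
    intro s
    constructor
    · rintro ⟨l, hl⟩
      rw [signPattern_insert hv] at hl
      refine ⟨l, ?_, by simpa using congrFun hl v⟩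
      funext z
      rcases eq_or_ne z v with rfl | hz
      · rw [hσ, signPattern_of_notMem hv, signPattern_of_notMem hv]
      · simpa [hz] using congrFun hl z
    · rintro ⟨l, hl, rfl⟩
      exact ⟨l, by rw [signPattern_insert hv, hl]⟩
  have hsum : ∀ f : SignType → ℝ, ∑ s, f s = f 0 + (f (-1) + f 1) := by
    intro f
    rw [SignType.univ_eq, Finset.sum_insert (by decide), Finset.sum_insert (by decide),
      Finset.sum_singleton]
  rw [hsum, patternRank_update_of_ne hv σ (s := -1) (by decide),
    patternRank_update_of_ne hv σ (s := 1) (by decide)]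
  simp only [hmem]
  have hZ : ∀ l, signPattern V l = σ → ∀ z ∈ {z | z ∈ V ∧ σ z = 0}, ⟪l, z⟫ = 0 := by
    rintro l hl z ⟨hz, hz0⟩
    rw [← hl, signPattern_of_mem hz] at hz0
    exact sign_eq_zero_iff.1 hz0
  by_cases hvZ : v ∈ Submodule.span ℝ {z | z ∈ V ∧ σ z = 0}
  · have hl0 : ∀ l, signPattern V l = σ → ⟪l, v⟫ = 0 := by
      intro l hl
      have : Submodule.span ℝ {z | z ∈ V ∧ σ z = 0} ≤ LinearMap.ker (innerₗ (Euc n) l) :=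
        Submodule.span_le.2 fun z hz => hZ l hl z hz
      exact this hvZ
    rw [if_pos ⟨l₀, rfl, by rw [hl0 l₀ rfl, sign_zero]⟩, if_neg, if_neg, add_zero, add_zero]
    · congr 1
      unfold patternRank
      rw [zeroSet_update_zero, Submodule.span_insert_eq_span hvZ]
    · rintro ⟨l, hl, h⟩
      rw [hl0 l hl, sign_zero] at h
      exact absurd h (by decide)
    · rintro ⟨l, hl, h⟩
      rw [hl0 l hl, sign_zero] at h
      exact absurd h (by decide)
  · obtain ⟨d, hd, hdv⟩ := exists_inner_eq_zero_of_notMem_span hvZ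
    by_cases h0 : ∃ l, signPattern V l = σ ∧ SignType.sign ⟪l, v⟫ = 0
    · obtain ⟨l, hl, hlv⟩ := h0
      have hlv' : ⟪l, v⟫ = 0 := sign_eq_zero_iff.1 hlv
      have hev := eventually_signPattern_eq V l d (by
        intro z hz h
        rw [← signPattern_of_mem hz, hl] at h
        exact hd z ⟨hz, h⟩)
      have hpos : ∃ ε : ℝ, signPattern V (l + ε • d) = signPattern V l ∧ 0 < ε :=
        ((hev.filter_mono nhdsWithin_le_nhds).and
          (eventually_mem_nhdsWithin (a := (0 : ℝ)) (s := Set.Ioi 0))).exists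
      have hneg : ∃ ε : ℝ, signPattern V (l + ε • d) = signPattern V l ∧ ε < 0 :=
        ((hev.filter_mono nhdsWithin_le_nhds).and
          (eventually_mem_nhdsWithin (a := (0 : ℝ)) (s := Set.Iio 0))).exists
      obtain ⟨ε, hε, hε0⟩ := hpos
      obtain ⟨δ, hδ, hδ0⟩ := hneg
      rw [if_pos ⟨l, hl, hlv⟩, if_pos, if_pos]
      · have hr : patternRank (insert v V) (Function.update σ v 0) = patternRank V σ + 1 := by
          unfold patternRank
          rw [zeroSet_update_zero, Submodule.span_insert, sup_comm, Submodule.finrank_sup_span_singleton hvZ]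
        rw [hr]
        ring
      · refine ⟨l + ε • d, hε.trans hl, ?_⟩
        rw [inner_add_left, inner_smul_left, hlv']
        simpa using sign_pos (mul_pos hε0 hdv)
      · refine ⟨l + δ • d, hδ.trans hl, ?_⟩
        rw [inner_add_left, inner_smul_left, hlv']
        simpa using sign_neg (mul_neg_of_neg_of_pos hδ0 hdv)
    · rw [if_neg h0, zero_add]
      have hnot : ¬ ((∃ l, signPattern V l = σ ∧ SignType.sign ⟪l, v⟫ = -1) ∧
          ∃ l, signPattern V l = σ ∧ SignType.sign ⟪l, v⟫ = 1) := by
        rintro ⟨⟨l, hl, hlv⟩, ⟨m, hm, hmv⟩⟩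
        rw [sign_eq_neg_one_iff] at hlv
        rw [sign_eq_one_iff] at hmv
        refine h0 ⟨⟪m, v⟫ • l + (-⟪l, v⟫) • m, ?_, ?_⟩
        · rw [← hl, signPattern_eq_iff]
          intro z hz
          rw [inner_add_left, inner_smul_left, inner_smul_left]
          refine sign_combo ?_ hmv (neg_pos.2 hlv)
          rw [← signPattern_of_mem hz, hl, ← hm, signPattern_of_mem hz]
        · rw [inner_add_left, inner_smul_left, inner_smul_left, sign_eq_zero_iff]
          simp
          ring
      rcases lt_trichotomy ⟪l₀, v⟫ 0 with h | h | h
      · have h1 : ∃ l, signPattern V l = σ ∧ SignType.sign ⟪l, v⟫ = -1 := ⟨l₀, rfl, sign_neg h⟩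
        rw [if_pos h1, if_neg fun h2 => hnot ⟨h1, h2⟩, add_zero]
      · exact absurd ⟨l₀, rfl, by rw [h, sign_zero]⟩ h0
      · have h1 : ∃ l, signPattern V l = σ ∧ SignType.sign ⟪l, v⟫ = 1 := ⟨l₀, rfl, sign_pos h⟩
        rw [if_pos h1, if_neg fun h2 => hnot ⟨h2, h1⟩, zero_add]

open Classical in
theorem patternSum_insert {V : Finset (Euc n)} {v : Euc n} (hv : v ∉ V) {g : Euc n → ℝ}
    (hg : ∀ l l', signPattern V l = signPattern V l' → g l = g l') :
    patternSum (insert v V) g = patternSum V g := by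
  unfold patternSum
  have hres : ∀ l, Function.update (signPattern (insert v V) l) v 0 = signPattern V l := by
    intro l
    rw [signPattern_insert hv, Function.update_idem, ← signPattern_of_notMem hv l,
      Function.update_eq_self]
  rw [← Finset.sum_fiberwise_of_maps_to (t := (finite_range_signPattern V).toFinset)
    (g := fun τ => Function.update τ v 0)]
  · refine Finset.sum_congr rfl fun σ hσ => ?_
    rw [Set.Finite.mem_toFinset] at hσ
    have hval : ∀ τ ∈ (finite_range_signPattern (insert v V)).toFinset.filter
        (fun τ => Function.update τ v 0 = σ),
        (-1) ^ patternRank (insert v V) τ * g (Function.invFun (signPattern (insert v V)) τ)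
          = (-1) ^ patternRank (insert v V) τ * g (Function.invFun (signPattern V) σ) := by
      intro τ hτ
      rw [Finset.mem_filter, Set.Finite.mem_toFinset] at hτ
      congr 1
      apply hg
      rw [signPattern_invFun hσ, ← hτ.2, ← hres, signPattern_invFun hτ.1]
    rw [Finset.sum_congr rfl hval, ← Finset.sum_mul]
    congr 1
    obtain ⟨l₀, rfl⟩ := hσ
    rw [← sum_fiber_pattern hv l₀, ← Finset.sum_filter]
    refine Finset.sum_nbij' (fun τ => τ v) (fun s => Function.update (signPattern V l₀) v s)
      ?_ ?_ ?_ ?_ ?_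
    · intro τ hτ
      rw [Finset.mem_filter, Set.Finite.mem_toFinset] at hτ
      rw [Finset.mem_filter, ← hτ.2, Function.update_idem, Function.update_eq_self]
      exact ⟨Finset.mem_univ _, hτ.1⟩
    · intro s hs
      rw [Finset.mem_filter] at hs
      rw [Finset.mem_filter, Set.Finite.mem_toFinset, Function.update_idem,
        ← signPattern_of_notMem hv l₀, Function.update_eq_self]
      exact ⟨hs.2, rfl⟩
    · intro τ hτ
      rw [Finset.mem_filter] at hτ
      rw [← hτ.2, Function.update_idem, Function.update_eq_self]
    · intro s _
      simp
    · intro τ hτ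
      rw [Finset.mem_filter] at hτ
      rw [← hτ.2, Function.update_idem, Function.update_eq_self]
  · intro τ hτ
    rw [Set.Finite.mem_toFinset] at hτ ⊢
    obtain ⟨l, rfl⟩ := hτ
    exact ⟨l, (hres l).symm⟩

theorem signPattern_eq_of_subset {V W : Finset (Euc n)} (h : V ⊆ W) {l l' : Euc n}
    (hl : signPattern W l = signPattern W l') : signPattern V l = signPattern V l' := by
  rw [signPattern_eq_iff] at hl ⊢
  exact fun v hv => hl v (h hv)

theorem patternSum_of_subset {V W : Finset (Euc n)} (h : V ⊆ W) {g : Euc n → ℝ}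
    (hg : ∀ l l', signPattern V l = signPattern V l' → g l = g l') :
    patternSum W g = patternSum V g := by
  classical
  suffices H : ∀ U : Finset (Euc n), patternSum (U ∪ V) g = patternSum V g by
    rw [← H W, Finset.union_eq_left.2 h]
  intro U
  induction U using Finset.induction_on with
  | empty => rw [Finset.empty_union]
  | insert v U _ ih =>
    rw [Finset.insert_union]
    by_cases hv : v ∈ U ∪ V
    · rw [Finset.insert_eq_of_mem hv, ih]
    · rw [patternSum_insert hv fun l l' hl =>
        hg l l' (signPattern_eq_of_subset Finset.subset_union_right hl), ih]

theorem patternSum_add (V : Finset (Euc n)) (g g' : Euc n → ℝ) :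
    patternSum V (fun l => g l + g' l) = patternSum V g + patternSum V g' := by
  simp only [patternSum, mul_add, Finset.sum_add_distrib]

end SignPatterns

section Faces

variable {n : ℕ}

/-- The part of `P` orthogonal to `l`. -/
def orthFace (P : Set (Euc n)) (l : Euc n) : Set (Euc n) := {y | y ∈ P ∧ ⟪l, y⟫ = 0}

/-- The exposed faces of `P` which contain the origin. -/
def facesAtZero (P : Set (Euc n)) : Set (Set (Euc n)) := {F | IsExposed ℝ P F ∧ (0 : Euc n) ∈ F}

/-- The alternating sum of the powers of the support functions of the faces at the origin. -/
def faceSum (p : ℝ) (P : Set (Euc n)) (x : Euc n) : ℝ :=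
  ∑ᶠ F ∈ facesAtZero P, (-1) ^ sdim F * supp F x ^ p

/-- The contribution of the functional `l` to `faceSum`. -/
def faceWeight (p : ℝ) (P : Set (Euc n)) (x l : Euc n) : ℝ :=
  open Classical in if ∀ y ∈ P, ⟪l, y⟫ ≤ 0 then supp (orthFace P l) x ^ p else 0

theorem isCompact_orthFace {P : Set (Euc n)} (hP : IsCompact P) (l : Euc n) :
    IsCompact (orthFace P l) :=
  hP.inter_right (isClosed_eq (f := fun y => ⟪l, y⟫) (g := fun _ => 0) (by fun_prop) (by fun_prop))

theorem zero_mem_orthFace {P : Set (Euc n)} (hP : (0 : Euc n) ∈ P) (l : Euc n) :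
    (0 : Euc n) ∈ orthFace P l := ⟨hP, inner_zero_right l⟩

theorem convex_orthFace {P : Set (Euc n)} (hP : Convex ℝ P) (l : Euc n) :
    Convex ℝ (orthFace P l) :=
  hP.inter (convex_hyperplane (innerₗ (Euc n) l).isLinear 0)

theorem mem_facesAtZero {P F : Set (Euc n)} (h0 : (0 : Euc n) ∈ P) :
    F ∈ facesAtZero P ↔ ∃ l : Euc n, (∀ y ∈ P, ⟪l, y⟫ ≤ 0) ∧ F = orthFace P l := by
  constructor
  · rintro ⟨hF, hF0⟩
    obtain ⟨f, rfl⟩ := hF ⟨0, hF0⟩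
    obtain ⟨-, hf⟩ := hF0
    have hl : ∀ y, ⟪(InnerProductSpace.toDual ℝ (Euc n)).symm f, y⟫ = f y :=
      fun y => InnerProductSpace.toDual_symm_apply
    refine ⟨(InnerProductSpace.toDual ℝ (Euc n)).symm f, fun y hy => ?_, ?_⟩
    · rw [hl]
      simpa using hf y hy
    · ext y
      simp only [orthFace, Set.mem_ofPred_eq, hl]
      refine and_congr_right fun hy => ⟨fun h => ?_, fun h z hz => ?_⟩
      · exact le_antisymm (by simpa using hf y hy) (by simpa using h 0 h0)
      · rw [h]
        simpa using hf z hz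
  · rintro ⟨l, hl, rfl⟩
    refine ⟨fun _ => ⟨InnerProductSpace.toDual ℝ (Euc n) l, ?_⟩, zero_mem_orthFace h0 l⟩
    ext y
    simp only [orthFace, Set.mem_ofPred_eq, InnerProductSpace.toDual_apply_apply]
    refine and_congr_right fun hy => ⟨fun h z hz => ?_, fun h => ?_⟩
    · rw [h]
      exact hl z hz
    · exact le_antisymm (hl y hy) (by simpa using h 0 h0)

theorem sdim_eq_finrank_span {F : Set (Euc n)} (h0 : (0 : Euc n) ∈ F) :
    sdim F = Module.finrank ℝ (Submodule.span ℝ F) := by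
  have h : (fun x : Euc n => x -ᵥ (0 : Euc n)) '' F = F := by simp
  rw [sdim, direction_affineSpan, vectorSpan_eq_span_vsub_set_right ℝ h0, h]

theorem forall_mem_convexHull_inner_nonpos {V : Finset (Euc n)} {l : Euc n} :
    (∀ y ∈ convexHull ℝ (V : Set (Euc n)), ⟪l, y⟫ ≤ 0) ↔ ∀ v ∈ V, ⟪l, v⟫ ≤ 0 := by
  refine ⟨fun h v hv => h v (subset_convexHull ℝ _ hv), fun h y hy => ?_⟩
  have : convexHull ℝ (V : Set (Euc n)) ⊆ {y | innerₗ (Euc n) l y ≤ 0} :=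
    convexHull_min h (convex_halfSpace_le (innerₗ (Euc n) l).isLinear 0)
  exact this hy

theorem orthFace_convexHull {V : Finset (Euc n)} {l : Euc n} (hl : ∀ v ∈ V, ⟪l, v⟫ ≤ 0) :
    orthFace (convexHull ℝ (V : Set (Euc n))) l = convexHull ℝ {v | v ∈ V ∧ ⟪l, v⟫ = 0} := by
  apply Set.Subset.antisymm
  · rintro y ⟨hy, hly⟩
    rw [Finset.mem_convexHull'] at hy
    obtain ⟨w, hw0, hw1, rfl⟩ := hy
    rw [inner_sum] at hly
    have hz := (Finset.sum_eq_zero_iff_of_nonpos fun v hv => by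
      rw [inner_smul_right]
      exact mul_nonpos_of_nonneg_of_nonpos (hw0 v hv) (hl v hv)).1 hly
    have hsub : ∀ v ∈ V, ⟪l, v⟫ ≠ 0 → w v = 0 := by
      intro v hv h
      have := hz v hv
      rw [inner_smul_right] at this
      exact (mul_eq_zero.1 this).resolve_right h
    classical
    have hset : {v | v ∈ V ∧ ⟪l, v⟫ = 0} = ((V.filter fun v => ⟪l, v⟫ = 0 : Finset (Euc n)) :
        Set (Euc n)) := by
      ext v
      simp
    rw [hset, Finset.mem_convexHull']
    refine ⟨w, fun v hv => hw0 v (Finset.mem_filter.1 hv).1, ?_, ?_⟩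
    · rw [Finset.sum_filter_of_ne, hw1]
      intro v hv h
      by_contra h'
      exact h (hsub v hv h')
    · rw [Finset.sum_filter_of_ne]
      intro v hv h
      by_contra h'
      exact h (by rw [hsub v hv h', zero_smul])
  · refine convexHull_min ?_ (convex_orthFace (convex_convexHull ℝ _) l)
    rintro v ⟨hv, hlv⟩
    exact ⟨subset_convexHull ℝ _ hv, hlv⟩

theorem span_convexHull (s : Set (Euc n)) :
    Submodule.span ℝ (convexHull ℝ s) = Submodule.span ℝ s := by
  refine le_antisymm (Submodule.span_le.2 ?_) (Submodule.span_mono (subset_convexHull ℝ s))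
  exact convexHull_min Submodule.subset_span (Submodule.convex _)

theorem faceWeight_eq_of_signPattern_eq (p : ℝ) (V : Finset (Euc n)) (x : Euc n) {l l' : Euc n}
    (h : signPattern V l = signPattern V l') :
    faceWeight p (convexHull ℝ (V : Set (Euc n))) x l
      = faceWeight p (convexHull ℝ (V : Set (Euc n))) x l' := by
  rw [signPattern_eq_iff] at h
  have h1 : (∀ v ∈ V, ⟪l, v⟫ ≤ 0) ↔ ∀ v ∈ V, ⟪l', v⟫ ≤ 0 := by
    refine forall₂_congr fun v hv => ?_
    rw [← sign_nonpos_iff, h v hv, sign_nonpos_iff]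
  unfold faceWeight
  simp only [forall_mem_convexHull_inner_nonpos]
  by_cases hl : ∀ v ∈ V, ⟪l, v⟫ ≤ 0
  · rw [if_pos hl, if_pos (h1.1 hl), orthFace_convexHull hl, orthFace_convexHull (h1.1 hl)]
    congr 3
    ext v
    refine and_congr_right fun hv => ?_
    rw [← sign_eq_zero_iff, h v hv, sign_eq_zero_iff]
  · rw [if_neg hl, if_neg (h1.not.1 hl)]

theorem bijOn_orthFace {V : Finset (Euc n)} (h0 : (0 : Euc n) ∈ convexHull ℝ (V : Set (Euc n))) :
    Set.BijOn (fun σ => orthFace (convexHull ℝ (V : Set (Euc n)))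
        (Function.invFun (signPattern V) σ))
      {σ | σ ∈ Set.range (signPattern V) ∧ ∀ y ∈ convexHull ℝ (V : Set (Euc n)),
        ⟪Function.invFun (signPattern V) σ, y⟫ ≤ 0}
      (facesAtZero (convexHull ℝ (V : Set (Euc n)))) := by
  refine ⟨?_, ?_, ?_⟩
  · rintro σ ⟨-, hσ⟩
    exact (mem_facesAtZero h0).2 ⟨_, hσ, rfl⟩
  · rintro σ ⟨hσ, hσ'⟩ τ ⟨hτ, hτ'⟩ h
    rw [forall_mem_convexHull_inner_nonpos] at hσ' hτ'
    rw [← signPattern_invFun hσ, ← signPattern_invFun hτ, signPattern_eq_iff]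
    set l := Function.invFun (signPattern V) σ
    set m := Function.invFun (signPattern V) τ
    intro v hv
    have hiff : ⟪l, v⟫ = 0 ↔ ⟪m, v⟫ = 0 := by
      have hv' := subset_convexHull ℝ (V : Set (Euc n)) hv
      have := congrArg (fun s : Set (Euc n) => v ∈ s) h
      simpa [orthFace, hv'] using this
    rcases (hσ' v hv).lt_or_eq with hlt | heq
    · have : ⟪m, v⟫ < 0 := lt_of_le_of_ne (hτ' v hv) fun h => hlt.ne (hiff.2 h)
      rw [sign_neg hlt, sign_neg this]
    · rw [heq, hiff.1 heq]
  · intro F hF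
    obtain ⟨l, hl, rfl⟩ := (mem_facesAtZero h0).1 hF
    have hpat := signPattern_eq_iff.1
      (signPattern_invFun (V := V) (σ := signPattern V l) ⟨l, rfl⟩)
    rw [forall_mem_convexHull_inner_nonpos] at hl
    have hl' : ∀ v ∈ V, ⟪Function.invFun (signPattern V) (signPattern V l), v⟫ ≤ 0 := by
      intro v hv
      rw [← sign_nonpos_iff, hpat v hv, sign_nonpos_iff]
      exact hl v hv
    refine ⟨signPattern V l, ⟨⟨l, rfl⟩, forall_mem_convexHull_inner_nonpos.2 hl'⟩, ?_⟩
    simp only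
    rw [orthFace_convexHull hl, orthFace_convexHull hl']
    congr 1
    ext v
    refine and_congr_right fun hv => ?_
    rw [← sign_eq_zero_iff, hpat v hv, sign_eq_zero_iff]

theorem finite_facesAtZero {P : Set (Euc n)} (hP : IsPolytope0 P) : (facesAtZero P).Finite := by
  obtain ⟨⟨V, rfl⟩, h0⟩ := hP
  rw [← (bijOn_orthFace h0).image_eq]
  exact ((finite_range_signPattern V).subset fun σ h => h.1).image _

theorem patternSum_faceWeight (p : ℝ) {V : Finset (Euc n)}
    (h0 : (0 : Euc n) ∈ convexHull ℝ (V : Set (Euc n))) (x : Euc n) :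
    patternSum V (faceWeight p (convexHull ℝ (V : Set (Euc n))) x)
      = faceSum p (convexHull ℝ (V : Set (Euc n))) x := by
  classical
  unfold patternSum faceWeight faceSum
  simp only [mul_ite, mul_zero]
  rw [← Finset.sum_filter, ← finsum_mem_coe_finset]
  refine finsum_mem_eq_of_bijOn (fun σ => orthFace (convexHull ℝ (V : Set (Euc n)))
        (Function.invFun (signPattern V) σ)) ?_ ?_
  · convert bijOn_orthFace h0 using 1
    ext σ
    simp
  · intro σ hσ
    rw [Finset.coe_filter, Set.mem_ofPred_eq, Set.Finite.mem_toFinset] at hσ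
    obtain ⟨hσ, hl⟩ := hσ
    congr 2
    rw [sdim_eq_finrank_span (zero_mem_orthFace h0 _),
      orthFace_convexHull (forall_mem_convexHull_inner_nonpos.1 hl), span_convexHull, patternRank]
    have hset : {z | z ∈ V ∧ σ z = 0}
        = {v | v ∈ V ∧ ⟪Function.invFun (signPattern V) σ, v⟫ = 0} := by
      ext v
      refine and_congr_right fun hv => ?_
      rw [← sign_eq_zero_iff (a := ⟪_, v⟫), ← signPattern_of_mem hv, signPattern_invFun hσ]
    rw [hset]

theorem faceWeight_union_add_inter (p : ℝ) {K L : Set (Euc n)} (hK : IsCompact K)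
    (hL : IsCompact L) (h : Convex ℝ (K ∪ L)) (hK0 : (0 : Euc n) ∈ K) (hL0 : (0 : Euc n) ∈ L)
    (x l : Euc n) :
    faceWeight p (K ∪ L) x l + faceWeight p (K ∩ L) x l
      = faceWeight p K x l + faceWeight p L x l := by
  wlog hwlog : (∀ y ∈ L, ⟪l, y⟫ ≤ 0) → ∀ y ∈ K, ⟪l, y⟫ ≤ 0 generalizing K L with H
  · have := H hL hK (by rwa [Set.union_comm]) hL0 hK0 (by tauto)
    rw [Set.union_comm, Set.inter_comm, this, add_comm]
  unfold faceWeight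
  by_cases hNK : ∀ y ∈ K, ⟪l, y⟫ ≤ 0
  · have hNI : ∀ y ∈ K ∩ L, ⟪l, y⟫ ≤ 0 := fun y hy => hNK y hy.1
    by_cases hNL : ∀ y ∈ L, ⟪l, y⟫ ≤ 0
    · have hNU : ∀ y ∈ K ∪ L, ⟪l, y⟫ ≤ 0 := by
        rintro y (hy | hy)
        exacts [hNK y hy, hNL y hy]
      have hU : orthFace (K ∪ L) l = orthFace K l ∪ orthFace L l := by
        ext y
        simp only [orthFace, Set.mem_ofPred_eq, Set.mem_union]
        tauto
      have hI : orthFace (K ∩ L) l = orthFace K l ∩ orthFace L l := by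
        ext y
        simp only [orthFace, Set.mem_ofPred_eq, Set.mem_inter_iff]
        tauto
      rw [if_pos hNU, if_pos hNI, if_pos hNK, if_pos hNL, hU, hI]
      exact supp_rpow_union_add_inter p (isCompact_orthFace hK l) (isCompact_orthFace hL l)
        (hU ▸ convex_orthFace h l) (zero_mem_orthFace hK0 l) (zero_mem_orthFace hL0 l) x
    · have hNU : ¬ ∀ y ∈ K ∪ L, ⟪l, y⟫ ≤ 0 := fun hU => hNL fun y hy => hU y (Or.inr hy)
      rw [if_neg hNU, if_pos hNI, if_pos hNK, if_neg hNL, zero_add, add_zero]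
      push Not at hNL
      obtain ⟨b, hb, hlb⟩ := hNL
      congr 2
      ext y
      refine ⟨fun hy => ⟨hy.1.1, hy.2⟩, fun hy => ⟨⟨hy.1, ?_⟩, hy.2⟩⟩
      obtain ⟨c, hc, hcK, hcL⟩ := exists_mem_segment_mem_inter hK.isClosed hL.isClosed h hy.1 hb
      obtain ⟨s, t, hs, ht, hst, rfl⟩ := hc
      have hle := hNK _ hcK
      rw [inner_add_right, inner_smul_right, inner_smul_right, hy.2, mul_zero, zero_add] at hle
      obtain rfl : t = 0 := le_antisymm (by
        by_contra hneg
        push Not at hneg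
        exact absurd hle (not_le.2 (mul_pos hneg hlb))) ht
      obtain rfl : s = 1 := by linarith
      simpa using hcL
  · have hNL : ¬ ∀ y ∈ L, ⟪l, y⟫ ≤ 0 := fun hL => hNK (hwlog hL)
    have hNU : ¬ ∀ y ∈ K ∪ L, ⟪l, y⟫ ≤ 0 := fun hU => hNL fun y hy => hU y (Or.inr hy)
    have hNI : ¬ ∀ y ∈ K ∩ L, ⟪l, y⟫ ≤ 0 := by
      push Not at hNK hNL ⊢
      obtain ⟨a, ha, hla⟩ := hNK
      obtain ⟨b, hb, hlb⟩ := hNL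
      obtain ⟨c, hc, hcKL⟩ := exists_mem_segment_mem_inter hK.isClosed hL.isClosed h ha hb
      refine ⟨c, hcKL, ?_⟩
      have : segment ℝ a b ⊆ {y | 0 < innerₗ (Euc n) l y} :=
        (convex_halfSpace_gt (innerₗ (Euc n) l).isLinear 0).segment_subset hla hlb
      exact this hc
    rw [if_neg hNU, if_neg hNI, if_neg hNK, if_neg hNL]

theorem patternSum_faceWeight_of_subset (p : ℝ) {V W : Finset (Euc n)} (hVW : V ⊆ W)
    (h0 : (0 : Euc n) ∈ convexHull ℝ (V : Set (Euc n))) (x : Euc n) :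
    patternSum W (faceWeight p (convexHull ℝ (V : Set (Euc n))) x)
      = faceSum p (convexHull ℝ (V : Set (Euc n))) x := by
  rw [patternSum_of_subset hVW fun l l' h => faceWeight_eq_of_signPattern_eq p V x h,
    patternSum_faceWeight p h0]

theorem faceSum_union_add_inter (p : ℝ) {K L : Set (Euc n)} (hK : IsPolytope0 K)
    (hL : IsPolytope0 L) (hU : IsPolytope0 (K ∪ L)) (hI : IsPolytope0 (K ∩ L)) (x : Euc n) :
    faceSum p (K ∪ L) x + faceSum p (K ∩ L) x = faceSum p K x + faceSum p L x := by
  classical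
  have key : ∀ {P : Set (Euc n)}, IsPolytope0 P → ∃ V : Finset (Euc n), ∀ W, V ⊆ W →
      patternSum W (faceWeight p P x) = faceSum p P x := by
    rintro P ⟨⟨V, rfl⟩, h0⟩
    exact ⟨V, fun W hW => patternSum_faceWeight_of_subset p hW h0 x⟩
  obtain ⟨V₁, h₁⟩ := key hK
  obtain ⟨V₂, h₂⟩ := key hL
  obtain ⟨V₃, h₃⟩ := key hU
  obtain ⟨V₄, h₄⟩ := key hI
  set W := V₁ ∪ V₂ ∪ (V₃ ∪ V₄)
  rw [← h₁ W fun v hv => by simp [W, hv], ← h₂ W fun v hv => by simp [W, hv],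
    ← h₃ W fun v hv => by simp [W, hv], ← h₄ W fun v hv => by simp [W, hv],
    ← patternSum_add, ← patternSum_add]
  congr 1
  funext l
  exact faceWeight_union_add_inter p hK.isCompact hL.isCompact hU.convex hK.2 hL.2 x l

end Faces

section PhiProperties

variable {n : ℕ}

theorem facesO_eq (j : ℕ) (P : Set (Euc n)) : facesO j P = {F | F ∈ facesAtZero P ∧ sdim F = j} := by
  ext F
  simp only [facesO, facesAtZero, Set.mem_ofPred_eq]
  tauto

theorem sdim_le_of_mem_facesAtZero {P F : Set (Euc n)} (h0 : (0 : Euc n) ∈ P)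
    (hF : F ∈ facesAtZero P) : sdim F ≤ sdim P := by
  rw [sdim_eq_finrank_span h0, sdim_eq_finrank_span hF.2]
  exact Submodule.finrank_mono (Submodule.span_mono hF.1.subset)

theorem self_mem_facesAtZero {P : Set (Euc n)} (h0 : (0 : Euc n) ∈ P) : P ∈ facesAtZero P :=
  ⟨IsExposed.refl P, h0⟩

theorem eq_of_mem_facesAtZero_of_sdim_eq {P F : Set (Euc n)} (h0 : (0 : Euc n) ∈ P)
    (hF : F ∈ facesAtZero P) (h : sdim F = sdim P) : F = P := by
  obtain ⟨l, hl, hFl⟩ := (mem_facesAtZero h0).1 hF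
  refine Set.Subset.antisymm hF.1.subset fun y hy => ?_
  rw [sdim_eq_finrank_span h0, sdim_eq_finrank_span hF.2] at h
  have hs := Submodule.eq_of_le_of_finrank_eq (Submodule.span_mono hF.1.subset) h
  have hle : Submodule.span ℝ F ≤ LinearMap.ker (innerₗ (Euc n) l) :=
    Submodule.span_le.2 fun z hz => by
      rw [hFl] at hz
      exact hz.2
  rw [hFl]
  exact ⟨hy, hle (hs ▸ Submodule.subset_span hy)⟩

theorem eq_singleton_of_sdim_eq_zero {F : Set (Euc n)} (h0 : (0 : Euc n) ∈ F) (h : sdim F = 0) :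
    F = {0} := by
  rw [sdim_eq_finrank_span h0, Submodule.finrank_eq_zero, Submodule.span_eq_bot] at h
  exact Set.Subset.antisymm (fun y hy => h y hy) (by simpa using h0)

theorem PhiP_eq {p : ℝ} (hp : 1 ≤ p) (a₁ a₂ : ℝ) {P : Set (Euc n)} (hP : IsPolytope0 P)
    (x : Euc n) :
    PhiP p a₁ a₂ P x = a₂ * supp P x ^ p + (a₂ - a₁) * faceSum p P x := by
  classical
  have hp0 : p ≠ 0 := by linarith
  set T := (finite_facesAtZero hP).toFinset with hT
  have hmemT : ∀ F, F ∈ T ↔ F ∈ facesAtZero P := fun F => by rw [hT, Set.Finite.mem_toFinset]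
  set S : ℕ → ℝ := fun j => (-1 : ℝ) ^ j * ∑ᶠ F ∈ facesO j P, supp F x ^ p with hS
  have hSj : ∀ j, S j = ∑ F ∈ T.filter (fun F => sdim F = j), (-1 : ℝ) ^ sdim F * supp F x ^ p := by
    intro j
    have : facesO j P = ((T.filter fun F => sdim F = j : Finset (Set (Euc n))) :
        Set (Set (Euc n))) := by
      ext F
      rw [facesO_eq, Finset.coe_filter, Set.mem_ofPred_eq, Set.mem_ofPred_eq, hmemT]
    rw [hS]
    simp only
    rw [this, finsum_mem_coe_finset, Finset.mul_sum]
    refine Finset.sum_congr rfl fun F hF => ?_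
    rw [(Finset.mem_filter.1 hF).2]
  have hsum : faceSum p P x = ∑ j ∈ Finset.range (sdim P + 1), S j := by
    rw [faceSum, finsum_mem_eq_finite_toFinset_sum _ (finite_facesAtZero hP),
      ← Finset.sum_fiberwise_of_maps_to (t := Finset.range (sdim P + 1)) (g := sdim)]
    · exact Finset.sum_congr rfl fun j _ => (hSj j).symm
    · intro F hF
      rw [Finset.mem_range, Nat.lt_succ_iff]
      exact sdim_le_of_mem_facesAtZero hP.2 ((hmemT F).1 hF)
  have hS0 : S 0 = 0 := by
    rw [hSj]
    refine Finset.sum_eq_zero fun F hF => ?_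
    obtain ⟨hF, hF0⟩ := Finset.mem_filter.1 hF
    rw [eq_singleton_of_sdim_eq_zero ((hmemT F).1 hF).2 hF0, supp_zero, Real.zero_rpow hp0, mul_zero]
  have hSd : S (sdim P) = (-1) ^ sdim P * supp P x ^ p := by
    have : T.filter (fun F => sdim F = sdim P) = {P} := by
      ext F
      rw [Finset.mem_filter, Finset.mem_singleton, hmemT]
      constructor
      · rintro ⟨hF, h⟩
        exact eq_of_mem_facesAtZero_of_sdim_eq hP.2 hF h
      · rintro rfl
        exact ⟨self_mem_facesAtZero hP.2, rfl⟩
    rw [hSj, this, Finset.sum_singleton]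
  have hPhi : PhiP p a₁ a₂ P x = (if Odd (sdim P) then a₁ else 2 * a₂ - a₁) * supp P x ^ p
      + (a₂ - a₁) * ∑ j ∈ Finset.Icc 1 (sdim P - 1), S j := rfl
  rw [hPhi, hsum]
  rcases h : sdim P with _ | m
  · have hP0 := eq_singleton_of_sdim_eq_zero hP.2 h
    rw [hP0, supp_zero, Real.zero_rpow hp0]
    simp [hS0]
  · rw [Finset.sum_range_succ, Finset.sum_range_succ', hS0, ← h, hSd]
    have hIcc : ∑ j ∈ Finset.Icc 1 (sdim P - 1), S j = ∑ i ∈ Finset.range m, S (i + 1) := by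
      have : Finset.Icc 1 (sdim P - 1) = Finset.Ico 1 (m + 1) := by
        ext j
        simp only [Finset.mem_Icc, Finset.mem_Ico]
        omega
      rw [this, Finset.sum_Ico_eq_sum_range]
      simp [add_comm]
    rw [hIcc]
    rcases Nat.even_or_odd (sdim P) with hd | hd
    · rw [if_neg (Nat.not_odd_iff_even.2 hd), hd.neg_one_pow]
      ring
    · rw [if_pos hd, hd.neg_one_pow]
      ring

theorem faceSum_smul (p : ℝ) {P : Set (Euc n)} (hP : IsPolytope0 P) {c : ℝ} (hc : 0 ≤ c)
    (x : Euc n) : faceSum p P (c • x) = c ^ p * faceSum p P x := by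
  unfold faceSum
  rw [finsum_mem_eq_finite_toFinset_sum _ (finite_facesAtZero hP),
    finsum_mem_eq_finite_toFinset_sum _ (finite_facesAtZero hP), Finset.mul_sum]
  refine Finset.sum_congr rfl fun F hF => ?_
  rw [Set.Finite.mem_toFinset] at hF
  obtain ⟨l, -, rfl⟩ := (mem_facesAtZero hP.2).1 hF
  rw [supp_smul c hc, Real.mul_rpow hc (supp_nonneg (isCompact_orthFace hP.isCompact l) hF.2 x)]
  ring

theorem continuous_faceSum {p : ℝ} (hp : 1 ≤ p) {P : Set (Euc n)} (hP : IsPolytope0 P) :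
    Continuous (faceSum p P) := by
  have : faceSum p P = fun x => ∑ F ∈ (finite_facesAtZero hP).toFinset,
      (-1) ^ sdim F * supp F x ^ p := by
    funext x
    exact finsum_mem_eq_finite_toFinset_sum _ _
  rw [this]
  refine continuous_finsetSum _ fun F hF => ?_
  rw [Set.Finite.mem_toFinset] at hF
  obtain ⟨l, -, rfl⟩ := (mem_facesAtZero hP.2).1 hF
  exact continuous_const.mul
    ((continuous_supp (isCompact_orthFace hP.isCompact l)).rpow_const
      fun _ => Or.inr (by linarith))

theorem sdim_image (g : Euc n →ₗ[ℝ] Euc n) (hg : Function.Injective g) {F : Set (Euc n)}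
    (h0 : (0 : Euc n) ∈ F) : sdim (g '' F) = sdim F := by
  have h0' : (0 : Euc n) ∈ g '' F := ⟨0, h0, map_zero g⟩
  rw [sdim_eq_finrank_span h0, sdim_eq_finrank_span h0', Submodule.span_image]
  exact (Submodule.equivMapOfInjective g hg _).finrank_eq.symm

theorem faceSum_image (p : ℝ) (g : Euc n →ₗ[ℝ] Euc n) (hg : Function.Injective g)
    {P : Set (Euc n)} (h0 : (0 : Euc n) ∈ P) (x : Euc n) :
    faceSum p (g '' P) x = faceSum p P (LinearMap.adjoint g x) := by
  have h0' : (0 : Euc n) ∈ g '' P := ⟨0, h0, map_zero g⟩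
  have horth : ∀ l, g '' orthFace P (LinearMap.adjoint g l) = orthFace (g '' P) l := by
    intro l
    ext y
    constructor
    · rintro ⟨z, ⟨hz, hlz⟩, rfl⟩
      exact ⟨⟨z, hz, rfl⟩, by rwa [← LinearMap.adjoint_inner_left]⟩
    · rintro ⟨⟨z, hz, rfl⟩, hlz⟩
      exact ⟨z, ⟨hz, by rwa [LinearMap.adjoint_inner_left]⟩, rfl⟩
  have hsurj : Function.Surjective (LinearMap.adjoint g) := by
    have hg' : Function.Surjective g := LinearMap.surjective_of_injective hg
    refine LinearMap.surjective_of_injective ((injective_iff_map_eq_zero _).2 fun z hz => ?_)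
    obtain ⟨w, rfl⟩ := hg' z
    rw [← inner_self_eq_zero (𝕜 := ℝ), ← LinearMap.adjoint_inner_left, hz, inner_zero_left]
  symm
  refine finsum_mem_eq_of_bijOn (fun F => g '' F) ⟨?_, ?_, ?_⟩ ?_
  · intro F hF
    obtain ⟨l, hl, rfl⟩ := (mem_facesAtZero h0).1 hF
    obtain ⟨m, rfl⟩ := hsurj l
    refine (mem_facesAtZero h0').2 ⟨m, ?_, horth m⟩
    rintro _ ⟨y, hy, rfl⟩
    rw [← LinearMap.adjoint_inner_left]
    exact hl y hy
  · exact (Set.image_injective.2 hg).injOn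
  · intro F hF
    obtain ⟨l, hl, rfl⟩ := (mem_facesAtZero h0').1 hF
    refine ⟨orthFace P (LinearMap.adjoint g l), (mem_facesAtZero h0).2 ⟨_, ?_, rfl⟩, horth l⟩
    intro y hy
    rw [LinearMap.adjoint_inner_left]
    exact hl _ ⟨y, hy, rfl⟩
  · intro F hF
    rw [sdim_image g hg hF.2, supp_image]

theorem IsPolytope0.image {P : Set (Euc n)} (hP : IsPolytope0 P) (g : Euc n →ₗ[ℝ] Euc n) :
    IsPolytope0 (g '' P) := by
  classical
  obtain ⟨⟨S, rfl⟩, h0⟩ := hP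
  refine ⟨⟨S.image g, ?_⟩, ⟨0, h0, map_zero g⟩⟩
  rw [LinearMap.image_convexHull, Finset.coe_image]

theorem image_neg_id (P : Set (Euc n)) : (-LinearMap.id : Euc n →ₗ[ℝ] Euc n) '' P = -P := by
  rw [← Set.image_neg_eq_neg]
  rfl

theorem adjoint_neg_id (x : Euc n) :
    LinearMap.adjoint (-LinearMap.id : Euc n →ₗ[ℝ] Euc n) x = -x := by
  simp

/-- The general form of the valuations in the classification. -/
def modelValuation (p a₁ a₂ b₁ b₂ c₁ c₂ : ℝ) (P : Set (Euc n)) (x : Euc n) : ℝ :=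
  c₁ * mPlus p P x ^ p + c₂ * mMinus p P x ^ p + PhiP p a₁ a₂ P x + PhiP p b₁ b₂ (-P) x

theorem PhiP_image {p : ℝ} (hp : 1 ≤ p) (a₁ a₂ : ℝ) (g : Euc n →ₗ[ℝ] Euc n)
    (hg : Function.Injective g) {P : Set (Euc n)} (hP : IsPolytope0 P) (x : Euc n) :
    PhiP p a₁ a₂ (g '' P) x = PhiP p a₁ a₂ P (LinearMap.adjoint g x) := by
  rw [PhiP_eq hp _ _ (hP.image g), PhiP_eq hp _ _ hP, supp_image, faceSum_image p g hg hP.2]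

theorem PhiP_neg {p : ℝ} (hp : 1 ≤ p) (a₁ a₂ : ℝ) {P : Set (Euc n)} (hP : IsPolytope0 P)
    (x : Euc n) : PhiP p a₁ a₂ (-P) x = PhiP p a₁ a₂ P (-x) := by
  rw [← image_neg_id, PhiP_image hp _ _ _ (fun y z h => by simpa using h) hP, adjoint_neg_id]

theorem modelValuation_eq {p : ℝ} (hp : 1 ≤ p) (a₁ a₂ b₁ b₂ c₁ c₂ : ℝ) {P : Set (Euc n)}
    (hP : IsPolytope0 P) (x : Euc n) :
    modelValuation p a₁ a₂ b₁ b₂ c₁ c₂ P x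
      = c₁ * mPlus p P x ^ p + c₂ * mPlus p P (-x) ^ p
        + (a₂ * supp P x ^ p + (a₂ - a₁) * faceSum p P x)
        + (b₂ * supp P (-x) ^ p + (b₂ - b₁) * faceSum p P (-x)) := by
  rw [modelValuation, mMinus_eq, PhiP_neg hp _ _ hP, PhiP_eq hp _ _ hP, PhiP_eq hp _ _ hP]

theorem modelValuation_union_add_inter {p : ℝ} (hp : 1 ≤ p) (a₁ a₂ b₁ b₂ c₁ c₂ : ℝ)
    {K L : Set (Euc n)} (hK : IsPolytope0 K) (hL : IsPolytope0 L) (hU : IsPolytope0 (K ∪ L))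
    (hI : IsPolytope0 (K ∩ L)) (x : Euc n) :
    modelValuation p a₁ a₂ b₁ b₂ c₁ c₂ (K ∪ L) x + modelValuation p a₁ a₂ b₁ b₂ c₁ c₂ (K ∩ L) x
      = modelValuation p a₁ a₂ b₁ b₂ c₁ c₂ K x + modelValuation p a₁ a₂ b₁ b₂ c₁ c₂ L x := by
  rw [modelValuation_eq hp _ _ _ _ _ _ hK, modelValuation_eq hp _ _ _ _ _ _ hL,
    modelValuation_eq hp _ _ _ _ _ _ hU, modelValuation_eq hp _ _ _ _ _ _ hI]
  linear_combination c₁ * mPlus_rpow_union_add_inter hp hK.isCompact hL.isCompact x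
    + c₂ * mPlus_rpow_union_add_inter hp hK.isCompact hL.isCompact (-x)
    + a₂ * supp_rpow_union_add_inter p hK.isCompact hL.isCompact hU.convex hK.2 hL.2 x
    + b₂ * supp_rpow_union_add_inter p hK.isCompact hL.isCompact hU.convex hK.2 hL.2 (-x)
    + (a₂ - a₁) * faceSum_union_add_inter p hK hL hU hI x
    + (b₂ - b₁) * faceSum_union_add_inter p hK hL hU hI (-x)

theorem modelValuation_image {p : ℝ} (hp : 1 ≤ p) (a₁ a₂ b₁ b₂ c₁ c₂ : ℝ)
    (g : Euc n →ₗ[ℝ] Euc n) (hg : LinearMap.det g = 1) {P : Set (Euc n)} (hP : IsPolytope0 P)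
    (x : Euc n) :
    modelValuation p a₁ a₂ b₁ b₂ c₁ c₂ (g '' P) x
      = modelValuation p a₁ a₂ b₁ b₂ c₁ c₂ P (LinearMap.adjoint g x) := by
  have hg0 : LinearMap.det g ≠ 0 := by rw [hg]; exact one_ne_zero
  have hinj : Function.Injective g := (LinearMap.equivOfDetNeZero g hg0).injective
  rw [modelValuation_eq hp _ _ _ _ _ _ hP, modelValuation_eq hp _ _ _ _ _ _ (hP.image g),
    mPlus_rpow_image hp g hg0 hP.isCompact, mPlus_rpow_image hp g hg0 hP.isCompact, hg, supp_image,
    supp_image, faceSum_image p g hinj hP.2, faceSum_image p g hinj hP.2, map_neg, abs_one]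
  ring

theorem modelValuation_smul {p : ℝ} (hp : 1 ≤ p) (a₁ a₂ b₁ b₂ c₁ c₂ : ℝ) {P : Set (Euc n)}
    (hP : IsPolytope0 P) {c : ℝ} (hc : 0 ≤ c) (x : Euc n) :
    modelValuation p a₁ a₂ b₁ b₂ c₁ c₂ P (c • x)
      = c ^ p * modelValuation p a₁ a₂ b₁ b₂ c₁ c₂ P x := by
  rw [modelValuation_eq hp _ _ _ _ _ _ hP, modelValuation_eq hp _ _ _ _ _ _ hP, ← smul_neg,
    mPlus_rpow_smul hp _ hc, mPlus_rpow_smul hp _ hc, supp_smul c hc, supp_smul c hc,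
    faceSum_smul p hP hc, faceSum_smul p hP hc,
    Real.mul_rpow hc (supp_nonneg hP.isCompact hP.2 _),
    Real.mul_rpow hc (supp_nonneg hP.isCompact hP.2 _)]
  ring

theorem continuous_modelValuation {p : ℝ} (hp : 1 ≤ p) (a₁ a₂ b₁ b₂ c₁ c₂ : ℝ) {P : Set (Euc n)}
    (hP : IsPolytope0 P) : Continuous (modelValuation p a₁ a₂ b₁ b₂ c₁ c₂ P) := by
  have : modelValuation p a₁ a₂ b₁ b₂ c₁ c₂ P = fun x =>
      c₁ * mPlus p P x ^ p + c₂ * mPlus p P (-x) ^ p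
        + (a₂ * supp P x ^ p + (a₂ - a₁) * faceSum p P x)
        + (b₂ * supp P (-x) ^ p + (b₂ - b₁) * faceSum p P (-x)) :=
    funext (modelValuation_eq hp _ _ _ _ _ _ hP)
  rw [this]
  have h1 := continuous_mPlus_rpow hp hP.isCompact
  have h2 : Continuous fun x => supp P x ^ p :=
    (continuous_supp hP.isCompact).rpow_const fun _ => Or.inr (by linarith)
  have h3 := continuous_faceSum hp hP
  have h1' := h1.comp (continuous_neg (G := Euc n))
  have h2' := h2.comp (continuous_neg (G := Euc n))
  have h3' := h3.comp (continuous_neg (G := Euc n))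
  exact (((continuous_const.mul h1).add (continuous_const.mul h1')).add
    ((continuous_const.mul h2).add (continuous_const.mul h3))).add
    ((continuous_const.mul h2').add (continuous_const.mul h3'))

end PhiProperties

section SimplexGeometry

variable {n : ℕ}

theorem det_adjoint (g : Euc n →ₗ[ℝ] Euc n) :
    LinearMap.det (LinearMap.adjoint g) = LinearMap.det g := by
  set b := EuclideanSpace.basisFun (Fin n) ℝ
  rw [← LinearMap.det_toMatrix b.toBasis, LinearMap.toMatrix_adjoint, Matrix.det_conjTranspose,
    LinearMap.det_toMatrix]
  simp

theorem exists_linearMap_det_eq_one {ι : Type*} [Fintype ι] {v v' : ι → Euc n}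
    (hv : LinearIndependent ℝ v) (hv' : LinearIndependent ℝ v') (hι : Fintype.card ι < n) :
    ∃ g : Euc n →ₗ[ℝ] Euc n, LinearMap.det g = 1 ∧ ∀ i, g (v i) = v' i := by
  obtain ⟨e, he⟩ := Submodule.exists_linearEquiv_restrict_eq
    ((Module.Basis.span hv).equiv (Module.Basis.span hv') (Equiv.refl ι))
  have hev : ∀ i, e (v i) = v' i := by
    intro i
    have := he ((Module.Basis.span hv) i)
    rw [Module.Basis.equiv_apply] at this
    simpa [Module.Basis.span_apply] using this.symm
  have hne : ∃ w, w ∉ Submodule.span ℝ (Set.range v') := by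
    by_contra! h
    have htop : Submodule.span ℝ (Set.range v') = ⊤ := Submodule.eq_top_iff'.2 h
    have := finrank_span_eq_card hv'
    rw [htop, finrank_top, finrank_euclideanSpace_fin] at this
    omega
  obtain ⟨w, hw⟩ := hne
  obtain ⟨d, hd, hdw⟩ := exists_inner_eq_zero_of_notMem_span hw
  set δ := LinearMap.det (e : Euc n →ₗ[ℝ] Euc n) with hδ
  have hδ0 : δ ≠ 0 := (LinearEquiv.isUnit_det' e).ne_zero
  refine ⟨LinearMap.transvection (innerₗ (Euc n) d) (((δ⁻¹ - 1) / ⟪d, w⟫) • w) ∘ₗ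
    (e : Euc n →ₗ[ℝ] Euc n), ?_, fun i => ?_⟩
  · rw [LinearMap.det_comp, LinearMap.transvection.det, ← hδ, innerₗ_apply_apply, inner_smul_right,
      div_mul_cancel₀ _ hdw.ne']
    field_simp
    ring
  · rw [LinearMap.comp_apply, LinearMap.transvection.apply, LinearEquiv.coe_coe, hev,
      innerₗ_apply_apply, hd _ ⟨i, rfl⟩, zero_smul, add_zero]

theorem adjoint_transvection (d u x : Euc n) :
    LinearMap.adjoint (LinearMap.transvection (innerₗ (Euc n) d) u) x = x + ⟪x, u⟫ • d := by
  refine ext_inner_right ℝ fun y => ?_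
  rw [LinearMap.adjoint_inner_left, LinearMap.transvection.apply, innerₗ_apply_apply,
    inner_add_right, inner_add_left, inner_smul_right, inner_smul_left]
  simp [mul_comm]

theorem image_oSimplex {ι : Type*} (g : Euc n →ₗ[ℝ] Euc n) (v : ι → Euc n) :
    g '' oSimplex v = oSimplex (g ∘ v) := by
  rw [oSimplex, LinearMap.image_convexHull, Set.image_insert_eq, map_zero, ← Set.range_comp,
    oSimplex]

theorem oSimplex_comp_equiv {ι κ : Type*} (e : κ ≃ ι) (v : ι → Euc n) :
    oSimplex (v ∘ e) = oSimplex v := by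
  rw [oSimplex, e.surjective.range_comp, oSimplex]

theorem oSimplex_of_isEmpty {ι : Type*} [IsEmpty ι] (v : ι → Euc n) : oSimplex v = {0} := by
  simp [oSimplex, Set.range_eq_empty]

theorem sum_add_ite_smul {ι : Type*} [Fintype ι] [DecidableEq ι] (v : ι → Euc n) (b : ι → ℝ)
    (i j : ι) (r s : ℝ) :
    ∑ k, (b k + (if k = i then r else 0) + (if k = j then s else 0)) • v k
      = ∑ k, b k • v k + r • v i + s • v j := by
  simp only [add_smul, Finset.sum_add_distrib, ite_smul, zero_smul, Finset.sum_ite_eq',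
    Finset.mem_univ, if_true]

theorem sum_add_ite {ι : Type*} [Fintype ι] [DecidableEq ι] (b : ι → ℝ) (i j : ι) (r s : ℝ) :
    ∑ k, (b k + (if k = i then r else 0) + (if k = j then s else 0)) = ∑ k, b k + r + s := by
  simp only [Finset.sum_add_distrib, Finset.sum_ite_eq', Finset.mem_univ, if_true]

theorem sum_smul_update {ι : Type*} [Fintype ι] [DecidableEq ι] (v : ι → Euc n) (b : ι → ℝ)
    (i : ι) (w : Euc n) :
    ∑ k, b k • Function.update v i w k = ∑ k, b k • v k + b i • (w - v i) := by
  have : ∀ k, b k • Function.update v i w k = b k • v k + if k = i then b i • (w - v i) else 0 := by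
    intro k
    rcases eq_or_ne k i with rfl | h
    · simp [smul_sub]
    · simp [h]
  simp only [this, Finset.sum_add_distrib, Finset.sum_ite_eq', Finset.mem_univ, if_true]

theorem mem_oSimplex_update {ι : Type*} [Fintype ι] [DecidableEq ι] (v : ι → Euc n) {i j : ι}
    (hij : i ≠ j) {s t : ℝ} (hs : 0 < s) (ht : 0 < t) (hst : s + t = 1) (y : Euc n) :
    y ∈ oSimplex (Function.update v i (s • v i + t • v j)) ↔
      ∃ b : ι → ℝ, (∀ k, 0 ≤ b k) ∧ ∑ k, b k ≤ 1 ∧ ∑ k, b k • v k = y ∧ t * b i ≤ s * b j := by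
  obtain rfl : t = 1 - s := by linarith
  rw [mem_oSimplex]
  constructor
  · rintro ⟨b, hb0, hb1, rfl⟩
    refine ⟨fun k => b k + (if k = i then -((1 - s) * b i) else 0)
      + (if k = j then (1 - s) * b i else 0), fun k => ?_, ?_, ?_, ?_⟩
    · have h1 := hb0 k
      have h2 := hb0 i
      rcases eq_or_ne k i with rfl | hki
      · simp only [if_true, if_neg hij]
        nlinarith
      · simp only [if_neg hki, add_zero]
        split_ifs <;> nlinarith
    · rw [sum_add_ite]
      linarith
    · rw [sum_add_ite_smul, sum_smul_update]
      module
    · simp only [if_true, if_neg hij, if_neg hij.symm]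
      nlinarith [mul_nonneg hs.le (hb0 j)]
  · rintro ⟨b, hb0, hb1, rfl, hb⟩
    have hs0 : s ≠ 0 := hs.ne'
    refine ⟨fun k => b k + (if k = i then (1 - s) / s * b i else 0)
      + (if k = j then -((1 - s) / s * b i) else 0), fun k => ?_, ?_, ?_⟩
    · have h1 := hb0 k
      have h2 := hb0 i
      have h3 : 0 ≤ (1 - s) / s * b i := mul_nonneg (div_nonneg ht.le hs.le) h2
      have h4 : (1 - s) / s * b i ≤ b j := by
        rw [div_mul_eq_mul_div, div_le_iff₀ hs]
        linarith
      rcases eq_or_ne k j with rfl | hkj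
      · simp only [if_true, if_neg hij.symm]
        linarith
      · simp only [if_neg hkj, add_zero]
        split_ifs <;> linarith
    · rw [sum_add_ite]
      linarith
    · rw [sum_smul_update, sum_add_ite_smul]
      simp only [if_true, if_neg hij]
      match_scalars <;> field_simp <;> ring

theorem mem_oSimplex_update_update {ι : Type*} [Fintype ι] [DecidableEq ι] (v : ι → Euc n)
    {i j : ι} (hij : i ≠ j) {s t : ℝ} (hs : 0 < s) (ht : 0 < t) (hst : s + t = 1) (y : Euc n) :
    y ∈ oSimplex (Function.update (Function.update v j (s • v i + t • v j)) i
        (s • v i + t • v j)) ↔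
      ∃ b : ι → ℝ, (∀ k, 0 ≤ b k) ∧ ∑ k, b k ≤ 1 ∧ ∑ k, b k • v k = y ∧ t * b i = s * b j := by
  obtain rfl : t = 1 - s := by linarith
  rw [mem_oSimplex]
  constructor
  · rintro ⟨b, hb0, hb1, rfl⟩
    refine ⟨fun k => b k + (if k = i then s * (b i + b j) - b i else 0)
      + (if k = j then (1 - s) * (b i + b j) - b j else 0), fun k => ?_, ?_, ?_, ?_⟩
    · have h1 := hb0 k
      have h2 := hb0 i
      have h3 := hb0 j
      have h4 := mul_nonneg hs.le (add_nonneg h2 h3)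
      have h5 := mul_nonneg ht.le (add_nonneg h2 h3)
      rcases eq_or_ne k i with rfl | hki
      · simp only [if_true, if_neg hij]
        linarith
      · simp only [if_neg hki, add_zero]
        split_ifs with hkj
        · subst hkj
          linarith
        · linarith
    · rw [sum_add_ite]
      linarith
    · rw [sum_add_ite_smul, sum_smul_update, sum_smul_update, Function.update_of_ne hij]
      module
    · simp only [if_true, if_neg hij, if_neg hij.symm]
      ring
  · rintro ⟨b, hb0, hb1, rfl, hb⟩
    refine ⟨b, hb0, hb1, ?_⟩
    rw [sum_smul_update, sum_smul_update, Function.update_of_ne hij]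
    have h1 : b i = s * (b i + b j) := by linarith
    have h2 : b j = (1 - s) * (b i + b j) := by linarith
    have h3 : b j • (s • v i + (1 - s) • v j - v j) + b i • (s • v i + (1 - s) • v j - v i)
        = (s * (b i + b j) - b i) • v i + ((1 - s) * (b i + b j) - b j) • v j := by module
    rw [add_assoc, h3, ← h1, ← h2]
    simp

theorem oSimplex_update_union {ι : Type*} [Fintype ι] [DecidableEq ι] (v : ι → Euc n) {i j : ι}
    (hij : i ≠ j) {s t : ℝ} (hs : 0 < s) (ht : 0 < t) (hst : s + t = 1) :
    oSimplex (Function.update v i (s • v i + t • v j)) ∪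
      oSimplex (Function.update v j (s • v i + t • v j)) = oSimplex v := by
  ext y
  have h := mem_oSimplex_update v hij.symm ht hs (by linarith) y
  rw [add_comm (t • v j)] at h
  rw [Set.mem_union, mem_oSimplex_update v hij hs ht hst, h, mem_oSimplex]
  constructor
  · rintro (⟨b, hb0, hb1, hb, -⟩ | ⟨b, hb0, hb1, hb, -⟩) <;> exact ⟨b, hb0, hb1, hb⟩
  · rintro ⟨b, hb0, hb1, hb⟩
    rcases le_total (t * b i) (s * b j) with hle | hle
    · exact Or.inl ⟨b, hb0, hb1, hb, hle⟩
    · exact Or.inr ⟨b, hb0, hb1, hb, hle⟩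

theorem oSimplex_update_inter {ι : Type*} [Fintype ι] [DecidableEq ι] {v : ι → Euc n}
    (hv : LinearIndependent ℝ v) {i j : ι}
    (hij : i ≠ j) {s t : ℝ} (hs : 0 < s) (ht : 0 < t) (hst : s + t = 1) :
    oSimplex (Function.update v i (s • v i + t • v j)) ∩
      oSimplex (Function.update v j (s • v i + t • v j))
      = oSimplex fun k : {k // k ≠ i} => Function.update v j (s • v i + t • v j) k := by
  have hrange : oSimplex (fun k : {k // k ≠ i} => Function.update v j (s • v i + t • v j) k)
      = oSimplex (Function.update (Function.update v j (s • v i + t • v j)) i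
        (s • v i + t • v j)) := by
    unfold oSimplex
    congr 2
    ext z
    constructor
    · rintro ⟨k, rfl⟩
      exact ⟨k, Function.update_of_ne k.2 _ _⟩
    · rintro ⟨k, rfl⟩
      rcases eq_or_ne k i with rfl | hki
      · exact ⟨⟨j, hij.symm⟩, by simp⟩
      · exact ⟨⟨k, hki⟩, (Function.update_of_ne hki _ _).symm⟩
  rw [hrange]
  ext y
  have h := mem_oSimplex_update v hij.symm ht hs (by linarith) y
  rw [add_comm (t • v j)] at h
  rw [Set.mem_inter_iff, mem_oSimplex_update v hij hs ht hst, h,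
    mem_oSimplex_update_update v hij hs ht hst]
  constructor
  · rintro ⟨⟨b, hb0, hb1, hb, hle⟩, ⟨c, hc0, hc1, hc, hle'⟩⟩
    have hbc : b = c := by
      funext k
      have : ∑ k, (b k - c k) • v k = 0 := by
        simp only [sub_smul, Finset.sum_sub_distrib]
        rw [hb, hc, sub_self]
      exact sub_eq_zero.1 (Fintype.linearIndependent_iff.1 hv _ this k)
    subst hbc
    exact ⟨b, hb0, hb1, hb, le_antisymm hle hle'⟩
  · rintro ⟨b, hb0, hb1, hb, heq⟩
    exact ⟨⟨b, hb0, hb1, hb, heq.le⟩, ⟨b, hb0, hb1, hb, heq.ge⟩⟩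

theorem linearIndependent_update_combo {ι : Type*} [Fintype ι] [DecidableEq ι] {v : ι → Euc n}
    (hv : LinearIndependent ℝ v) {i j : ι} (hij : i ≠ j) {s : ℝ} (hs : s ≠ 0) (t : ℝ) :
    LinearIndependent ℝ (Function.update v i (s • v i + t • v j)) := by
  rw [Fintype.linearIndependent_iff] at hv ⊢
  intro b hb
  rw [sum_smul_update] at hb
  have h := hv (fun k => b k + (if k = i then (s - 1) * b i else 0)
    + (if k = j then t * b i else 0)) (by
      rw [sum_add_ite_smul, ← hb]
      module)
  have hi : b i = 0 := by
    have := h i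
    simp only [if_true, if_neg hij, add_zero] at this
    have h2 : s * b i = 0 := by linarith
    exact (mul_eq_zero.1 h2).resolve_left hs
  intro k
  have := h k
  rw [hi] at this
  simpa using this

end SimplexGeometry

/-- Among at least three real numbers two are equal, or a third one lies strictly between two. -/
theorem exists_eq_or_exists_between {ι : Type*} [Fintype ι] (hι : 3 ≤ Fintype.card ι) (t : ι → ℝ) :
    (∃ i j, i ≠ j ∧ t i = t j) ∨ ∃ i j k, i ≠ j ∧ k ≠ i ∧ k ≠ j ∧
      ∃ s, 0 < s ∧ s < 1 ∧ s * t i + (1 - s) * t j = t k := by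
  by_cases hinj : Function.Injective t
  · right
    obtain ⟨a, b, c, hab, hbc⟩ : ∃ a b c, t a < t b ∧ t b < t c := by
      obtain ⟨x, y, z, hxy, hxz, hyz⟩ := Fintype.two_lt_card_iff.1 hι
      have h1 := hinj.ne hxy
      have h2 := hinj.ne hxz
      have h3 := hinj.ne hyz
      rcases lt_or_gt_of_ne h1 with h1 | h1 <;> rcases lt_or_gt_of_ne h2 with h2 | h2 <;>
        rcases lt_or_gt_of_ne h3 with h3 | h3
      · exact ⟨x, y, z, h1, h3⟩
      · exact ⟨x, z, y, h2, h3⟩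
      · linarith
      · exact ⟨z, x, y, h2, h1⟩
      · exact ⟨y, x, z, h1, h2⟩
      · linarith
      · exact ⟨y, z, x, h3, h2⟩
      · exact ⟨z, y, x, h3, h1⟩
    have hca : 0 < t c - t a := by linarith
    refine ⟨a, c, b, ?_, ?_, ?_, (t c - t b) / (t c - t a), div_pos (by linarith) hca, ?_, ?_⟩
    · rintro rfl
      linarith
    · rintro rfl
      linarith
    · rintro rfl
      linarith
    · rw [div_lt_one hca]
      linarith
    · field_simp
      ring
  · left
    simp only [Function.Injective] at hinj
    push Not at hinj
    obtain ⟨i, j, h, hij⟩ := hinj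
    exact ⟨i, j, hij, h⟩

section CutEquation

variable {ι : Type*} [Fintype ι] [DecidableEq ι]

theorem card_support_update_zero_lt {t : ι → ℝ} {i : ι} (hi : t i ≠ 0) :
    (Finset.univ.filter fun k => Function.update t i 0 k ≠ 0).card
      < (Finset.univ.filter fun k => t k ≠ 0).card := by
  refine Finset.card_lt_card (Finset.ssubset_iff_subset_ne.2 ⟨fun k hk => ?_, fun h => ?_⟩)
  · rw [Finset.mem_filter] at hk ⊢
    refine ⟨hk.1, ?_⟩
    rcases eq_or_ne k i with rfl | hki
    · exact hi
    · simpa [Function.update_of_ne hki] using hk.2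
  · have : i ∈ Finset.univ.filter fun k => t k ≠ 0 := by simpa using hi
    rw [← h] at this
    simp at this

/-- A continuous function of finitely many real variables that satisfies the functional equation
coming from cutting a simplex vanishes as soon as it vanishes on the coordinate axes. -/
theorem eq_zero_of_cut_equation [Nonempty ι] {G : (ι → ℝ) → ℝ} (hG : Continuous G)
    (hcut : ∀ (t : ι → ℝ) (i j : ι), i ≠ j → ∀ s, 0 < s → s < 1 → ∃ α β : ℝ, 0 < α ∧
      G t = α * G (Function.update t i (s * t i + (1 - s) * t j))
        + β * G (Function.update t j (s * t i + (1 - s) * t j)))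
    (h0 : ∀ i τ, G (Pi.single i τ) = 0) (t : ι → ℝ) : G t = 0 := by
  induction hN : (Finset.univ.filter fun k => t k ≠ 0).card using Nat.strong_induction_on
    generalizing t with
  | _ N ih =>
  have IH : ∀ t' : ι → ℝ, (Finset.univ.filter fun k => t' k ≠ 0).card < N → G t' = 0 :=
    fun t' ht' => ih _ ht' t' rfl
  clear ih
  have key : ∀ t : ι → ℝ, (Finset.univ.filter fun k => t k ≠ 0).card = N → ∀ i j, i ≠ j →
      t i ≠ 0 → t j ≠ 0 → 0 < t i / t j → t i / t j < 1 → G t = 0 := by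
    intro t ht i j hij hi hj hlo hhi
    obtain ⟨α, β, hα, h⟩ := hcut (Function.update t i 0) i j hij (1 - t i / t j)
      (by linarith) (by linarith)
    have hz : (1 - t i / t j) * Function.update t i 0 i
        + (1 - (1 - t i / t j)) * Function.update t i 0 j = t i := by
      rw [Function.update_self, Function.update_of_ne hij.symm]
      field_simp
      ring
    rw [hz, Function.update_idem, Function.update_eq_self, IH _ (ht ▸ card_support_update_zero_lt hi),
      IH (Function.update (Function.update t i 0) j (t i)), mul_zero, add_zero] at h
    · exact (mul_eq_zero.1 h.symm).resolve_left hα.ne'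
    · refine ht ▸ lt_of_eq_of_lt ?_ (card_support_update_zero_lt hi)
      congr 1
      ext k
      rcases eq_or_ne k j with rfl | hkj
      · simp [hi, hj, Function.update_of_ne hij.symm]
      · simp [Function.update_of_ne hkj]
  by_cases hex : ∃ i j, i ≠ j ∧ t i ≠ 0 ∧ t j ≠ 0
  · obtain ⟨i, j, hij, hi, hj⟩ := hex
    rcases lt_or_gt_of_ne (div_ne_zero hi hj) with hneg | hpos
    · have hne : t j - t i ≠ 0 := by
        intro h
        rw [← sub_eq_zero.1 h, div_self hj] at hneg
        linarith
      have h1 : 0 < 1 - t i / t j := by linarith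
      obtain ⟨α, β, -, h⟩ := hcut t i j hij (1 / (1 - t i / t j)) (by positivity)
        (by rw [div_lt_one h1]; linarith)
      have hz : 1 / (1 - t i / t j) * t i + (1 - 1 / (1 - t i / t j)) * t j = 0 := by
        have := h1.ne'
        field_simp
        ring
      rw [hz, IH _ ((card_support_update_zero_lt hi).trans_eq hN),
        IH _ ((card_support_update_zero_lt hj).trans_eq hN)] at h
      simpa using h
    · rcases lt_trichotomy (t i / t j) 1 with hlt | heq | hgt
      · exact key t hN i j hij hi hj hpos hlt
      · have hcont : Continuous fun r : ℝ => G (Function.update t i (r * t i)) :=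
          hG.comp (continuous_const.update i (by fun_prop))
        have hzero : ∀ r ∈ Set.Ioo (0 : ℝ) 1, G (Function.update t i (r * t i)) = 0 := by
          intro r hr
          have hr0 := hr.1.ne'
          refine key _ ?_ i j hij ?_ ?_ ?_ ?_
          · rw [← hN]
            congr 1
            ext k
            rcases eq_or_ne k i with rfl | hki
            · simp [hi, hr0]
            · simp [Function.update_of_ne hki]
          · simp [hi, hr0]
          · simpa [Function.update_of_ne hij.symm] using hj
          · rw [Function.update_self, Function.update_of_ne hij.symm, mul_div_assoc, heq, mul_one]
            exact hr.1
          · rw [Function.update_self, Function.update_of_ne hij.symm, mul_div_assoc, heq, mul_one]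
            exact hr.2
        have hmem : (1 : ℝ) ∈ closure (Set.Ioo (0 : ℝ) 1) := by
          rw [closure_Ioo zero_ne_one]
          exact ⟨zero_le_one, le_rfl⟩
        have := closure_minimal (t := {r : ℝ | G (Function.update t i (r * t i)) = 0}) hzero
          (isClosed_eq hcont continuous_const) hmem
        simpa using this
      · refine key t hN j i hij.symm hj hi ?_ ?_
        · rw [← inv_div]
          exact inv_pos.2 hpos
        · rw [← inv_div]
          exact inv_lt_one_of_one_lt₀ hgt
  · push Not at hex
    by_cases hz : ∃ i, t i ≠ 0
    · obtain ⟨i, hi⟩ := hz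
      have : t = Pi.single i (t i) := by
        funext k
        rcases eq_or_ne k i with rfl | hki
        · simp
        · rw [Pi.single_eq_of_ne hki]
          exact hex i k hki.symm hi
      rw [this]
      exact h0 _ _
    · push Not at hz
      have : t = Pi.single (Classical.arbitrary ι) 0 := by
        funext k
        simp [hz k]
      rw [this]
      exact h0 _ _

end CutEquation

section LowDimension

variable {n : ℕ} {p : ℝ} {Ψ : Set (Euc n) → Euc n → ℝ}

/-- An `SL(n)` covariant valuation on polytopes containing the origin, with values in the continuous
`p`-homogeneous functions. -/
structure CovariantValuation (p : ℝ) (Ψ : Set (Euc n) → Euc n → ℝ) : Prop where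
  union_add_inter : ∀ K L : Set (Euc n), IsPolytope0 K → IsPolytope0 L → IsPolytope0 (K ∪ L) →
    IsPolytope0 (K ∩ L) → ∀ x, Ψ (K ∪ L) x + Ψ (K ∩ L) x = Ψ K x + Ψ L x
  image : ∀ g : Euc n →ₗ[ℝ] Euc n, LinearMap.det g = 1 → ∀ P, IsPolytope0 P → ∀ x,
    Ψ (g '' P) x = Ψ P (LinearMap.adjoint g x)
  continuous : ∀ P, IsPolytope0 P → Continuous (Ψ P)
  smul : ∀ P, IsPolytope0 P → ∀ c : ℝ, 0 ≤ c → ∀ x, Ψ P (c • x) = c ^ p * Ψ P x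

namespace CovariantValuation

theorem cutAdditive (hΨ : CovariantValuation p Ψ) (x : Euc n) : CutAdditive fun P => Ψ P x := by
  intro P hP u
  have hU : P ∩ {y | u y ≤ 0} ∪ P ∩ {y | (-u) y ≤ 0} = P := by
    rw [← Set.inter_union_distrib_left, Set.inter_eq_left]
    intro y _
    rcases le_total (u y) 0 with h | h
    · exact Or.inl h
    · exact Or.inr (by simpa using h)
  have hI : P ∩ {y | u y ≤ 0} ∩ (P ∩ {y | (-u) y ≤ 0})
      = P ∩ {y | u y ≤ 0} ∩ {y | (-u) y ≤ 0} := by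
    ext y
    simp only [Set.mem_inter_iff]
    tauto
  have h1 := hP.inter_halfSpace u
  have := hΨ.union_add_inter _ _ h1 (hP.inter_halfSpace (-u)) (hU.symm ▸ hP)
    (hI.symm ▸ h1.inter_halfSpace (-u)) x
  rwa [hU, hI] at this

theorem apply_zero (hΨ : CovariantValuation p Ψ) (hp : 1 ≤ p) {P : Set (Euc n)}
    (hP : IsPolytope0 P) : Ψ P 0 = 0 := by
  have := hΨ.smul P hP 0 le_rfl 0
  rwa [Real.zero_rpow (by linarith), zero_mul, smul_zero] at this

theorem apply_singleton (hΨ : CovariantValuation p Ψ) (hp : 1 ≤ p) (hn : 2 ≤ n) (x : Euc n) :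
    Ψ {0} x = 0 := by
  have h0 : IsPolytope0 ({0} : Set (Euc n)) := by
    rw [← oSimplex_of_isEmpty (fun i : Empty => i.elim)]
    exact isPolytope0_oSimplex _
  rcases eq_or_ne x 0 with rfl | hx
  · exact hΨ.apply_zero hp h0
  have hli : LinearIndependent ℝ fun _ : Unit => x := LinearIndependent.of_subsingleton () hx
  have hli2 : LinearIndependent ℝ fun _ : Unit => (2 : ℝ) • x :=
    LinearIndependent.of_subsingleton () (smul_ne_zero two_ne_zero hx)
  obtain ⟨g, hg, hgx⟩ := exists_linearMap_det_eq_one hli hli2 (by rw [Fintype.card_unit]; omega)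
  have h := hΨ.image (LinearMap.adjoint g) (by rw [det_adjoint, hg]) _ h0 x
  rw [Set.image_singleton, map_zero, LinearMap.adjoint_adjoint, hgx (), hΨ.smul _ h0 _ zero_le_two]
    at h
  have h2 : (1 : ℝ) < 2 ^ p := Real.one_lt_rpow one_lt_two (by linarith)
  have h3 : ((2 : ℝ) ^ p - 1) * Ψ {0} x = 0 := by linarith
  exact (mul_eq_zero.1 h3).resolve_left (by linarith)

theorem oSimplex_apply_congr (hΨ : CovariantValuation p Ψ) (hp : 1 ≤ p) (hn : 2 ≤ n)
    {ι : Type*} [Fintype ι] {v : ι → Euc n} (hv : LinearIndependent ℝ v) {x x' : Euc n}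
    (h : ∀ i, ⟪x, v i⟫ = ⟪x', v i⟫) : Ψ (oSimplex v) x = Ψ (oSimplex v) x' := by
  have key : ∀ x x' : Euc n, (∀ i, ⟪x, v i⟫ = ⟪x', v i⟫) → (∃ i, ⟪x, v i⟫ ≠ 0) →
      Ψ (oSimplex v) x = Ψ (oSimplex v) x' := by
    rintro x x' h ⟨i, hi⟩
    set u := (⟪x, v i⟫)⁻¹ • v i with hu
    have hxu : ⟪x, u⟫ = 1 := by
      rw [hu, inner_smul_right, inv_mul_cancel₀ hi]
    have hdv : ∀ k, ⟪x' - x, v k⟫ = 0 := fun k => by rw [inner_sub_left, h, sub_self]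
    have hdu : ⟪x' - x, u⟫ = 0 := by
      rw [hu, inner_smul_right, hdv, mul_zero]
    have hg := hΨ.image (LinearMap.transvection (innerₗ (Euc n) (x' - x)) u)
      (by rw [LinearMap.transvection.det, innerₗ_apply_apply, hdu, add_zero])
      _ (isPolytope0_oSimplex v) x
    rw [adjoint_transvection, hxu, one_smul, add_sub_cancel, image_oSimplex] at hg
    rw [← hg]
    congr 2
    funext k
    rw [Function.comp_apply, LinearMap.transvection.apply, innerₗ_apply_apply, hdv, zero_smul,
      add_zero]
  rcases isEmpty_or_nonempty ι with hι | ⟨⟨i⟩⟩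
  · rw [oSimplex_of_isEmpty, hΨ.apply_singleton hp hn, hΨ.apply_singleton hp hn]
  by_cases hex : ∃ i, ⟪x, v i⟫ ≠ 0
  · exact key x x' h hex
  · push Not at hex
    have hc := hΨ.continuous _ (isPolytope0_oSimplex v)
    have h1 : Continuous fun ε : ℝ => Ψ (oSimplex v) (x + ε • v i) := hc.comp (by fun_prop)
    have h2 : Continuous fun ε : ℝ => Ψ (oSimplex v) (x' + ε • v i) := hc.comp (by fun_prop)
    have := Continuous.ext_on (dense_compl_singleton (0 : ℝ)) h1 h2 (by
      intro ε hε
      refine key _ _ (fun k => by rw [inner_add_left, inner_add_left, h]) ⟨i, ?_⟩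
      rw [inner_add_left, hex, zero_add, inner_smul_left]
      exact mul_ne_zero hε (inner_self_ne_zero.2 (hv.ne_zero i)))
    simpa using congrFun this 0

theorem oSimplex_apply_eq (hΨ : CovariantValuation p Ψ) (hp : 1 ≤ p) (hn : 2 ≤ n)
    {ι : Type*} [Fintype ι] (hι : Fintype.card ι < n) {v v' : ι → Euc n}
    (hv : LinearIndependent ℝ v) (hv' : LinearIndependent ℝ v') {x x' : Euc n}
    (h : ∀ i, ⟪x, v i⟫ = ⟪x', v' i⟫) : Ψ (oSimplex v) x = Ψ (oSimplex v') x' := by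
  obtain ⟨g, hg, hgv⟩ := exists_linearMap_det_eq_one hv hv' hι
  have := hΨ.image g hg _ (isPolytope0_oSimplex v) x'
  rw [image_oSimplex, show g ∘ v = v' from funext hgv] at this
  rw [this]
  refine hΨ.oSimplex_apply_congr hp hn hv fun i => ?_
  rw [LinearMap.adjoint_inner_left, hgv, h]

theorem oSimplex_add (hΨ : CovariantValuation p Ψ) {ι : Type*} [Fintype ι] [DecidableEq ι]
    {v : ι → Euc n} (hv : LinearIndependent ℝ v) {i j : ι} (hij : i ≠ j) {s t : ℝ} (hs : 0 < s)
    (ht : 0 < t) (hst : s + t = 1) (x : Euc n) :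
    Ψ (oSimplex v) x
      + Ψ (oSimplex fun k : {k // k ≠ i} => Function.update v j (s • v i + t • v j) k) x
      = Ψ (oSimplex (Function.update v i (s • v i + t • v j))) x
        + Ψ (oSimplex (Function.update v j (s • v i + t • v j))) x := by
  have hU := oSimplex_update_union v hij hs ht hst
  have hI := oSimplex_update_inter hv hij hs ht hst
  have := hΨ.union_add_inter _ _ (isPolytope0_oSimplex _) (isPolytope0_oSimplex _)
    (hU.symm ▸ isPolytope0_oSimplex v) (hI.symm ▸ isPolytope0_oSimplex _) x
  rwa [hU, hI] at this

end CovariantValuation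

end LowDimension

section StandardSimplex

variable {n : ℕ}

/-- The first `d` standard basis vectors. -/
def stdFamily {d : ℕ} (hd : d ≤ n) (i : Fin d) : Euc n := bvec (Fin.castLE hd i)

theorem Td_eq_oSimplex {d : ℕ} (hd : d ≤ n) : Td n d = oSimplex (stdFamily hd) := by
  unfold Td oSimplex
  congr 2
  ext z
  constructor
  · rintro ⟨i, hi, rfl⟩
    exact ⟨⟨i, hi⟩, rfl⟩
  · rintro ⟨i, rfl⟩
    exact ⟨_, i.2, rfl⟩

theorem orthonormal_stdFamily {d : ℕ} (hd : d ≤ n) : Orthonormal ℝ (stdFamily hd) := by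
  have h := (EuclideanSpace.basisFun (Fin n) ℝ).orthonormal.comp (Fin.castLE hd)
    (Fin.castLE_injective hd)
  have he : stdFamily hd = EuclideanSpace.basisFun (Fin n) ℝ ∘ Fin.castLE hd := by
    funext i
    simp [stdFamily, bvec]
  rwa [he]

theorem linearIndependent_stdFamily {d : ℕ} (hd : d ≤ n) : LinearIndependent ℝ (stdFamily hd) :=
  (orthonormal_stdFamily hd).linearIndependent

/-- The vector with the given first coordinates and vanishing remaining coordinates. -/
def coordVec {d : ℕ} (hd : d ≤ n) (t : Fin d → ℝ) : Euc n := ∑ i, t i • stdFamily hd i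

theorem inner_coordVec {d : ℕ} (hd : d ≤ n) (t : Fin d → ℝ) (i : Fin d) :
    ⟪coordVec hd t, stdFamily hd i⟫ = t i := by
  rw [coordVec, (orthonormal_stdFamily hd).inner_left_fintype t i]
  simp

theorem continuous_coordVec {d : ℕ} (hd : d ≤ n) : Continuous (coordVec hd) := by
  unfold coordVec
  fun_prop

theorem coordVec_single {d : ℕ} (hd : d ≤ n) (i : Fin d) (τ : ℝ) :
    coordVec hd (Pi.single i τ) = τ • stdFamily hd i := by
  simp [coordVec, Pi.single_apply, ite_smul]

theorem coordVec_smul {d : ℕ} (hd : d ≤ n) (c : ℝ) (t : Fin d → ℝ) :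
    coordVec hd (c • t) = c • coordVec hd t := by
  simp [coordVec, Finset.smul_sum, mul_smul]

theorem linearIndependent_update_combo_right {ι : Type*} [Fintype ι] [DecidableEq ι]
    {v : ι → Euc n} (hv : LinearIndependent ℝ v) {i j : ι} (hij : i ≠ j) (s : ℝ) {t : ℝ}
    (ht : t ≠ 0) : LinearIndependent ℝ (Function.update v j (s • v i + t • v j)) := by
  rw [add_comm (s • v i)]
  exact linearIndependent_update_combo hv hij.symm ht s

theorem inner_update {ι : Type*} [DecidableEq ι] (x : Euc n) (v : ι → Euc n) (i : ι) (w : Euc n) :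
    (fun k => ⟪x, Function.update v i w k⟫) = Function.update (fun k => ⟪x, v k⟫) i ⟪x, w⟫ := by
  funext k
  rcases eq_or_ne k i with rfl | h
  · simp
  · simp [h]

namespace CovariantValuation

variable {p : ℝ} {Ψ : Set (Euc n) → Euc n → ℝ}

theorem oSimplex_apply_eq_coordVec (hΨ : CovariantValuation p Ψ) (hp : 1 ≤ p) (hn : 2 ≤ n) {d : ℕ}
    (hd : d < n) {v : Fin d → Euc n} (hv : LinearIndependent ℝ v) (x : Euc n) :
    Ψ (oSimplex v) x = Ψ (oSimplex (stdFamily hd.le)) (coordVec hd.le fun i => ⟪x, v i⟫) :=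
  hΨ.oSimplex_apply_eq hp hn (by simpa using hd) hv (linearIndependent_stdFamily _)
    fun i => by rw [inner_coordVec]

theorem oSimplex_add_of_forall_eq_zero (hΨ : CovariantValuation p Ψ) {d e : ℕ}
    (h0 : ∀ (w : Fin d → Euc n) x, LinearIndependent ℝ w → Ψ (oSimplex w) x = 0) (he : d + 1 = e)
    {v : Fin e → Euc n} (hv : LinearIndependent ℝ v) {i j : Fin e} (hij : i ≠ j)
    {s : ℝ} (hs : 0 < s) (hs1 : s < 1) (x : Euc n) :
    Ψ (oSimplex v) x = Ψ (oSimplex (Function.update v i (s • v i + (1 - s) • v j))) x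
      + Ψ (oSimplex (Function.update v j (s • v i + (1 - s) • v j))) x := by
  subst he
  rw [← hΨ.oSimplex_add hv hij hs (by linarith) (by ring) x, eq_comm, add_eq_left]
  have hli : LinearIndependent ℝ (Function.update v j (s • v i + (1 - s) • v j)) :=
    linearIndependent_update_combo_right hv hij s (by linarith)
  have hcard : Fintype.card {k // k ≠ i} = d := by simp
  have hli2 := hli.comp (fun k : {k // k ≠ i} => (k : Fin (d + 1))) Subtype.val_injective
  have := h0 _ x (hli2.comp (Fintype.equivFinOfCardEq hcard).symm (Equiv.injective _))
  rwa [oSimplex_comp_equiv] at this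

/-- A covariant valuation vanishes on all lower dimensional simplices if it does so on a segment
and on a triangle at one pair of opposite vectors. -/
theorem oSimplex_apply_eq_zero_of_lt (hΨ : CovariantValuation p Ψ) (hp : 1 ≤ p) (hn : 3 ≤ n)
    (h1 : ∀ τ : ℝ, Ψ (Td n 1) (τ • bvec ⟨0, by omega⟩) = 0)
    (h2 : ∀ τ : ℝ, Ψ (Td n 2) (τ • bvec ⟨0, by omega⟩) = 0) (d : ℕ) (hd : d < n)
    (v : Fin d → Euc n) (x : Euc n) (hv : LinearIndependent ℝ v) : Ψ (oSimplex v) x = 0 := by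
  have hn2 : 2 ≤ n := by omega
  induction d generalizing x with
  | zero => rw [oSimplex_of_isEmpty, hΨ.apply_singleton hp hn2]
  | succ d ih =>
  have IH := fun w x => ih (by omega) w x
  clear ih
  set F : (Fin (d + 1) → ℝ) → ℝ := fun t =>
    Ψ (oSimplex (stdFamily hd.le)) (coordVec hd.le t) with hF
  have hFv : ∀ (v : Fin (d + 1) → Euc n), LinearIndependent ℝ v → ∀ x,
      Ψ (oSimplex v) x = F fun i => ⟪x, v i⟫ :=
    fun v hv x => hΨ.oSimplex_apply_eq_coordVec hp hn2 hd hv x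
  rw [hFv v hv]
  have hFc : Continuous F :=
    (hΨ.continuous _ (isPolytope0_oSimplex _)).comp (continuous_coordVec _)
  have hcut : ∀ (t : Fin (d + 1) → ℝ) (i j : Fin (d + 1)), i ≠ j → ∀ s, 0 < s → s < 1 →
      F t = F (Function.update t i (s * t i + (1 - s) * t j))
        + F (Function.update t j (s * t i + (1 - s) * t j)) := by
    intro t i j hij s hs hs1
    have hli := linearIndependent_stdFamily hd.le
    have := hΨ.oSimplex_add_of_forall_eq_zero IH rfl hli hij hs hs1 (coordVec hd.le t)
    rw [hFv _ (linearIndependent_update_combo hli hij hs.ne' _), hFv (Function.update _ j _),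
      inner_update, inner_update] at this
    · simpa only [inner_add_right, inner_smul_right, inner_coordVec] using this
    · exact linearIndependent_update_combo_right hli hij s (by linarith)
  have hperm : ∀ (t : Fin (d + 1) → ℝ) (e : Equiv.Perm (Fin (d + 1))), F (t ∘ e) = F t := by
    intro t e
    have := hFv (stdFamily hd.le ∘ e) ((linearIndependent_stdFamily hd.le).comp e e.injective)
      (coordVec hd.le t)
    rw [oSimplex_comp_equiv] at this
    simp only [Function.comp_apply, inner_coordVec] at this
    exact this.symm
  have haxis : ∀ τ, F (Pi.single 0 τ) = 0 → ∀ i, F (Pi.single i τ) = 0 := by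
    intro τ h i
    rw [← hperm _ (Equiv.swap i 0), ← h]
    congr 1
    funext k
    simp only [Function.comp_apply, Pi.single_apply, Equiv.swap_apply_eq_iff, Equiv.swap_apply_left]
  rcases Nat.lt_or_ge 1 d with hd2 | hd2
  · have heq : ∀ t i j, i ≠ j → t i = t j → F t = 0 := by
      intro t i j hij h
      have := hcut t i j hij (1 / 2) (by norm_num) (by norm_num)
      rw [h, ← add_mul, add_sub_cancel, one_mul, Function.update_eq_self, ← h,
        Function.update_eq_self] at this
      linarith
    set t := fun i => ⟪x, v i⟫
    obtain ⟨i, j, hij, h⟩ | ⟨i, j, k, hij, hki, hkj, s, hs, hs1, h⟩ :=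
      exists_eq_or_exists_between (by rw [Fintype.card_fin]; omega) t
    · exact heq t i j hij h
    · rw [hcut t i j hij s hs hs1, h,
        heq _ i k hki.symm (by simp [Function.update_of_ne hki]),
        heq _ j k hkj.symm (by simp [Function.update_of_ne hkj]), add_zero]
  · refine eq_zero_of_cut_equation hFc (fun t i j hij s hs hs1 => ⟨1, 1, one_pos, ?_⟩)
      (fun i τ => haxis τ ?_ i) _
    · rw [one_mul, one_mul]
      exact hcut t i j hij s hs hs1
    · simp only [hF, coordVec_single, ← Td_eq_oSimplex]
      obtain rfl | rfl : d = 0 ∨ d = 1 := by omega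
      · exact h1 τ
      · exact h2 τ

end CovariantValuation

end StandardSimplex

section Cauchy

/-- An additive function on the positive reals that is bounded below on some open interval is
linear. -/
theorem eq_mul_of_add_of_bddBelow {h : ℝ → ℝ} (hadd : ∀ a b, 0 < a → 0 < b → h (a + b) = h a + h b)
    {c d m : ℝ} (hc : 0 < c) (hcd : c < d) (hm : ∀ V, c < V → V < d → m ≤ h V) {V : ℝ}
    (hV : 0 < V) : h V = V * h 1 := by
  have hnat : ∀ (k : ℕ) (a : ℝ), 0 < a → h ((k + 1 : ℕ) * a) = (k + 1 : ℕ) * h a := by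
    intro k a ha
    induction k with
    | zero => simp
    | succ k ih =>
      have : ((k + 1 + 1 : ℕ) : ℝ) * a = (k + 1 : ℕ) * a + a := by
        push_cast
        ring
      rw [this, hadd _ _ (by positivity) ha, ih]
      push_cast
      ring
  have hnat' : ∀ (k : ℕ) (a : ℝ), 0 < k → 0 < a → h (k * a) = k * h a := by
    intro k a hk ha
    obtain ⟨k, rfl⟩ := Nat.exists_eq_succ_of_ne_zero hk.ne'
    exact hnat k a ha
  have hrat : ∀ r : ℚ, 0 < r → h r = r * h 1 := by
    intro r hr
    have hnum : 0 < r.num := Rat.num_pos.2 hr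
    have hcast : ((r.num.toNat : ℕ) : ℝ) = r.num := by
      exact_mod_cast congrArg (Int.cast : ℤ → ℝ) (Int.toNat_of_nonneg hnum.le)
    have hden : (0 : ℝ) < r.den := by exact_mod_cast r.den_pos
    have hr0 : (r : ℝ) = r.num / r.den := Rat.cast_def r
    have h1 := hnat' r.den r r.den_pos (by exact_mod_cast hr)
    have h2 := hnat' r.num.toNat 1 (by omega) one_pos
    rw [hcast, mul_one] at h2
    have h3 : (r.den : ℝ) * r = r.num := by
      rw [hr0]
      field_simp
    rw [h3, h2, ← h3, mul_assoc] at h1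
    exact mul_left_cancel₀ hden.ne' h1.symm
  set q : ℝ → ℝ := fun V => h V - V * h 1 with hq
  have qadd : ∀ a b, 0 < a → 0 < b → q (a + b) = q a + q b := by
    intro a b ha hb
    simp only [hq, hadd a b ha hb]
    ring
  have qrat : ∀ r : ℚ, 0 < r → q r = 0 := fun r hr => by simp only [hq, hrat r hr, sub_self]
  have qbdd : ∀ V, 0 < V → m - d * |h 1| ≤ q V := by
    have hI : ∀ V, c < V → V < d → m - d * |h 1| ≤ q V := by
      intro V hV1 hV2
      have h1 := hm V hV1 hV2
      have h2 : V * h 1 ≤ V * |h 1| :=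
        mul_le_mul_of_nonneg_left (le_abs_self _) (hc.trans hV1).le
      have h3 : V * |h 1| ≤ d * |h 1| := mul_le_mul_of_nonneg_right hV2.le (abs_nonneg _)
      simp only [hq]
      linarith
    intro V hV
    obtain ⟨r, hr1, hr2⟩ := exists_rat_btwn (show V - d < V - c by linarith)
    have hb := hI (V - r) (by linarith) (by linarith)
    rcases lt_trichotomy r 0 with hr | rfl | hr
    · have h1 := qadd V ((-r : ℚ) : ℝ) hV (by exact_mod_cast neg_pos.2 hr)
      rw [qrat (-r) (neg_pos.2 hr), Rat.cast_neg, ← sub_eq_add_neg] at h1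
      linarith
    · simpa using hb
    · have h1 := qadd (V - r) r (by linarith) (by exact_mod_cast hr)
      rw [qrat r hr, sub_add_cancel] at h1
      linarith
  have qnonneg : ∀ V, 0 < V → 0 ≤ q V := by
    intro V hV
    by_contra! hneg
    obtain ⟨k, hk⟩ := exists_nat_gt ((m - d * |h 1|) / q V)
    have hk1 : (m - d * |h 1|) / q V < (k + 1 : ℕ) := hk.trans (by push_cast; linarith)
    rw [div_lt_iff_of_neg hneg] at hk1
    have h1 := qbdd ((k + 1 : ℕ) * V) (by positivity)
    have h2 : q ((k + 1 : ℕ) * V) = (k + 1 : ℕ) * q V := by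
      simp only [hq, hnat k V hV]
      ring
    linarith
  obtain ⟨N, hN⟩ := exists_nat_gt V
  have h1 := qadd V (N - V) hV (by linarith)
  have h2 := qrat N (by exact_mod_cast hV.trans hN)
  rw [add_sub_cancel] at h1
  rw [Rat.cast_natCast] at h2
  have h3 := qnonneg V hV
  have h4 := qnonneg (N - V) (by linarith)
  have h5 : q V = 0 := by linarith
  exact sub_eq_zero.1 h5

end Cauchy

section FullDimension

variable {n : ℕ}

/-- The determinant of a family of `n` vectors in `ℝ^n`. -/
def detFamily (v : Fin n → Euc n) : ℝ := (EuclideanSpace.basisFun (Fin n) ℝ).toBasis.det v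

theorem detFamily_comp (g : Euc n →ₗ[ℝ] Euc n) (v : Fin n → Euc n) :
    detFamily (g ∘ v) = LinearMap.det g * detFamily v :=
  Module.Basis.det_comp _ g v

theorem span_eq_top_of_linearIndependent {v : Fin n → Euc n} (hv : LinearIndependent ℝ v) :
    Submodule.span ℝ (Set.range v) = ⊤ :=
  hv.span_eq_top_of_card_eq_finrank' (by simp)

theorem detFamily_ne_zero {v : Fin n → Euc n} (hv : LinearIndependent ℝ v) : detFamily v ≠ 0 :=
  ((Module.Basis.is_basis_iff_det _).1 ⟨hv, span_eq_top_of_linearIndependent hv⟩).ne_zero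

theorem detFamily_comp_perm (v : Fin n → Euc n) (e : Equiv.Perm (Fin n)) :
    detFamily (v ∘ e) = Equiv.Perm.sign e * detFamily v := by
  rw [detFamily, AlternatingMap.map_perm, detFamily, Units.smul_def, zsmul_eq_mul]

theorem detFamily_update_left (v : Fin n → Euc n) {i j : Fin n} (hij : i ≠ j) (s t : ℝ) :
    detFamily (Function.update v i (s • v i + t • v j)) = s * detFamily v := by
  rw [detFamily, AlternatingMap.map_update_add, AlternatingMap.map_update_smul,
    AlternatingMap.map_update_smul, Function.update_eq_self, (Module.Basis.det _).map_update_self v hij,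
    smul_zero, add_zero, smul_eq_mul, detFamily]

theorem detFamily_update_right (v : Fin n → Euc n) {i j : Fin n} (hij : i ≠ j) (s t : ℝ) :
    detFamily (Function.update v j (s • v i + t • v j)) = t * detFamily v := by
  rw [add_comm, detFamily_update_left v hij.symm]

theorem detFamily_smul (r : ℝ) (v : Fin n → Euc n) :
    detFamily (fun i => r • v i) = r ^ n * detFamily v := by
  have := detFamily_comp (r • LinearMap.id) v
  rw [LinearMap.det_smul, LinearMap.det_id, finrank_euclideanSpace_fin, mul_one] at this
  exact this

theorem detFamily_stdFamily : detFamily (stdFamily (le_refl n)) = 1 := by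
  have : stdFamily (le_refl n) = (EuclideanSpace.basisFun (Fin n) ℝ).toBasis := by
    funext i
    simp [stdFamily, bvec]
  rw [this, detFamily, Module.Basis.det_self]

/-- The standard simplex scaled to have determinant `V`. -/
def scaledFamily (V : ℝ) (i : Fin n) : Euc n := V ^ (n : ℝ)⁻¹ • stdFamily (le_refl n) i

theorem detFamily_scaledFamily (hn : n ≠ 0) {V : ℝ} (hV : 0 ≤ V) :
    detFamily (scaledFamily (n := n) V) = V := by
  unfold scaledFamily
  rw [detFamily_smul, detFamily_stdFamily, mul_one, Real.rpow_inv_natCast_pow hV hn]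

theorem linearIndependent_scaledFamily {V : ℝ} (hV : 0 < V) :
    LinearIndependent ℝ (scaledFamily (n := n) V) :=
  (linearIndependent_stdFamily (le_refl n)).units_smul
    fun _ => Units.mk0 (V ^ (n : ℝ)⁻¹) (Real.rpow_pos_of_pos hV _).ne'

theorem smul_Td (s : ℝ) : s • Td n n = oSimplex fun i => s • stdFamily (le_refl n) i := by
  rw [Td_eq_oSimplex (le_refl n)]
  exact image_oSimplex (s • LinearMap.id) _

/-- A vector whose inner products with the vectors of `scaledFamily V` are prescribed. -/
def dualVec (V : ℝ) (t : Fin n → ℝ) : Euc n := (V ^ (n : ℝ)⁻¹)⁻¹ • coordVec (le_refl n) t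

theorem inner_dualVec {V : ℝ} (hV : 0 < V) (t : Fin n → ℝ) (i : Fin n) :
    ⟪dualVec V t, scaledFamily V i⟫ = t i := by
  have : V ^ (n : ℝ)⁻¹ ≠ 0 := (Real.rpow_pos_of_pos hV _).ne'
  rw [dualVec, scaledFamily, inner_smul_left, inner_smul_right, inner_coordVec]
  simp [this]

namespace CovariantValuation

variable {p : ℝ} {Ψ : Set (Euc n) → Euc n → ℝ}

theorem oSimplex_apply_eq_of_detFamily_eq (hΨ : CovariantValuation p Ψ) (hp : 1 ≤ p) (hn : 2 ≤ n)
    {v v' : Fin n → Euc n} (hv : LinearIndependent ℝ v)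
    (hdet : detFamily v = detFamily v') {x x' : Euc n}
    (h : ∀ i, ⟪x, v i⟫ = ⟪x', v' i⟫) : Ψ (oSimplex v) x = Ψ (oSimplex v') x' := by
  set b := Module.Basis.mk hv (span_eq_top_of_linearIndependent hv).ge with hb
  set g : Euc n →ₗ[ℝ] Euc n := b.constr ℝ v' with hg
  have hgv : ∀ i, g (v i) = v' i := by
    intro i
    have := b.constr_basis ℝ v' i
    rwa [hb, Module.Basis.mk_apply] at this
  have hgv' : g ∘ v = v' := funext hgv
  have hdetg : LinearMap.det g = 1 := by
    have := detFamily_comp g v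
    rw [hgv', ← hdet] at this
    exact (mul_eq_right₀ (detFamily_ne_zero hv)).1 this.symm
  have := hΨ.image g hdetg _ (isPolytope0_oSimplex v) x'
  rw [image_oSimplex, hgv'] at this
  rw [this]
  refine hΨ.oSimplex_apply_congr hp hn hv fun i => ?_
  rw [LinearMap.adjoint_inner_left, hgv, h]

/-- A covariant valuation that vanishes on lower dimensional simplices and is bounded below along
dilates of the standard simplex vanishes on all full dimensional simplices if it does so on the
standard simplex at a pair of opposite vectors. -/
theorem oSimplex_apply_eq_zero_of_full (hΨ : CovariantValuation p Ψ) (hp : 1 ≤ p) (hn : 3 ≤ n)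
    (hlow : ∀ d < n, ∀ (w : Fin d → Euc n) x, LinearIndependent ℝ w → Ψ (oSimplex w) x = 0)
    (hbd : ∀ y : Euc n, ∃ c d : ℝ, 0 < c ∧ c < d ∧ ∃ m : ℝ,
      ∀ s : ℝ, c < s → s < d → m ≤ Ψ (s • Td n n) y)
    (h1 : ∀ τ : ℝ, Ψ (Td n n) (τ • bvec ⟨0, by omega⟩) = 0)
    (v : Fin n → Euc n) (x : Euc n) (hv : LinearIndependent ℝ v) : Ψ (oSimplex v) x = 0 := by
  have hn2 : 2 ≤ n := by omega
  have hn0 : n ≠ 0 := by omega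
  set D : ℝ → (Fin n → ℝ) → ℝ := fun V t => Ψ (oSimplex (scaledFamily V)) (dualVec V t) with hD
  have hDv : ∀ v : Fin n → Euc n, LinearIndependent ℝ v → 0 < detFamily v → ∀ x,
      Ψ (oSimplex v) x = D (detFamily v) fun i => ⟪x, v i⟫ := fun v hv hpos x =>
    hΨ.oSimplex_apply_eq_of_detFamily_eq hp hn2 hv
      (detFamily_scaledFamily hn0 hpos.le).symm fun i => by rw [inner_dualVec hpos]
  have hcut : ∀ V, 0 < V → ∀ (t : Fin n → ℝ) (i j : Fin n), i ≠ j → ∀ s, 0 < s → s < 1 →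
      D V t = D (s * V) (Function.update t i (s * t i + (1 - s) * t j))
        + D ((1 - s) * V) (Function.update t j (s * t i + (1 - s) * t j)) := by
    intro V hV t i j hij s hs hs1
    have hli := linearIndependent_scaledFamily (n := n) hV
    have hs1' : 0 < 1 - s := by linarith
    have hdet := detFamily_scaledFamily hn0 hV.le
    have hdet1 := detFamily_update_left (scaledFamily V) hij s (1 - s)
    have hdet2 := detFamily_update_right (scaledFamily V) hij s (1 - s)
    rw [hdet] at hdet1 hdet2
    have := hΨ.oSimplex_add_of_forall_eq_zero (hlow (n - 1) (by omega)) (by omega) hli hij hs hs1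
      (dualVec V t)
    rw [hDv _ (linearIndependent_update_combo hli hij hs.ne' _) (by rw [hdet1]; positivity),
      hDv (Function.update _ j _) (linearIndependent_update_combo_right hli hij s hs1'.ne')
        (by rw [hdet2]; positivity),
      inner_update, inner_update, hdet1, hdet2] at this
    simpa only [inner_add_right, inner_smul_right, inner_dualVec hV] using this
  have hsmul : ∀ V c, 0 ≤ c → ∀ t, D V (c • t) = c ^ p * D V t := by
    intro V c hc t
    simp only [hD]
    rw [← hΨ.smul _ (isPolytope0_oSimplex _) _ hc, dualVec, dualVec, coordVec_smul, smul_comm]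
  have heq : ∀ V, 0 < V → ∀ t i j, i ≠ j → t i = t j → D V t = V * D 1 t := by
    intro V hV t i j hij htij
    have hadd : ∀ a b, 0 < a → 0 < b → D (a + b) t = D a t + D b t := by
      intro a b ha hb
      have hab : 0 < a + b := by linarith
      have := hcut (a + b) hab t i j hij (a / (a + b)) (by positivity)
        (by rw [div_lt_one hab]; linarith)
      rw [htij, ← add_mul, add_sub_cancel, one_mul, Function.update_eq_self, ← htij,
        Function.update_eq_self, div_mul_cancel₀ _ hab.ne', sub_mul, one_mul,
        div_mul_cancel₀ _ hab.ne', add_sub_cancel_left] at this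
      exact this
    obtain ⟨c, d, hc, hcd, m, hm⟩ := hbd (coordVec (le_refl n) t)
    refine eq_mul_of_add_of_bddBelow (h := fun V => D V t) hadd (c := c ^ n) (d := d ^ n)
      (m := -(|m| * (c ^ p)⁻¹)) (by positivity) (pow_lt_pow_left₀ hcd hc.le hn0) ?_ hV
    intro V hV1 hV2
    have hV0 : 0 < V := (pow_pos hc n).trans hV1
    set s := V ^ (n : ℝ)⁻¹ with hs
    have hs0 : 0 < s := Real.rpow_pos_of_pos hV0 _
    have hsV : s ^ n = V := Real.rpow_inv_natCast_pow hV0.le hn0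
    rw [← hsV] at hV1 hV2
    have hcs : c < s := lt_of_pow_lt_pow_left₀ n hs0.le hV1
    have hsd : s < d := lt_of_pow_lt_pow_left₀ n (hc.trans hcd).le hV2
    have hmle := hm s hcs hsd
    have hT : Ψ (s • Td n n) (coordVec (le_refl n) t) = s ^ p * D V t := by
      rw [← hsmul V s hs0.le, hD, smul_Td]
      simp only [dualVec, coordVec_smul, ← hs]
      rw [inv_smul_smul₀ hs0.ne']
      rfl
    rw [hT] at hmle
    have hcp : 0 < c ^ p := Real.rpow_pos_of_pos hc p
    have hsp : 0 < s ^ p := Real.rpow_pos_of_pos hs0 p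
    have hcsp : c ^ p ≤ s ^ p := Real.rpow_le_rpow hc.le hcs.le (by linarith)
    have h3 : |m| * 1 ≤ |m| * ((c ^ p)⁻¹ * s ^ p) := by
      refine mul_le_mul_of_nonneg_left ?_ (abs_nonneg m)
      rw [inv_mul_eq_div, one_le_div hcp]
      exact hcsp
    refine le_of_mul_le_mul_left ?_ hsp
    have := neg_abs_le m
    linarith
  have hlin : ∀ V, 0 < V → ∀ t, D V t = V * D 1 t := by
    intro V hV t
    obtain ⟨i, j, hij, h⟩ | ⟨i, j, k, hij, hki, hkj, s, hs, hs1, h⟩ :=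
      exists_eq_or_exists_between (by simpa using hn) t
    · exact heq V hV t i j hij h
    · have hs1' : 0 < 1 - s := by linarith
      have e1 := fun W hW => heq W hW (Function.update t i (t k)) i k hki.symm
        (by simp [Function.update_of_ne hki])
      have e2 := fun W hW => heq W hW (Function.update t j (t k)) j k hkj.symm
        (by simp [Function.update_of_ne hkj])
      rw [hcut V hV t i j hij s hs hs1, hcut 1 one_pos t i j hij s hs hs1, h,
        e1 _ (by positivity), e1 (s * 1) (by positivity), e2 _ (by positivity),
        e2 ((1 - s) * 1) (by positivity)]
      ring
  have hperm : ∀ (t : Fin n → ℝ) (e : Equiv.Perm (Fin n)), Equiv.Perm.sign e = 1 →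
      D 1 (t ∘ e) = D 1 t := by
    intro t e he
    have hli := (linearIndependent_scaledFamily (n := n) one_pos).comp e e.injective
    have hdet : detFamily (scaledFamily 1 ∘ e) = 1 := by
      rw [detFamily_comp_perm, he, detFamily_scaledFamily hn0 zero_le_one]
      simp
    have := hDv _ hli (by rw [hdet]; exact one_pos) (dualVec 1 t)
    rw [oSimplex_comp_equiv, hdet] at this
    simp only [Function.comp_apply, inner_dualVec one_pos] at this
    exact this.symm
  obtain ⟨m, rfl⟩ : ∃ m, n = m + 1 := ⟨n - 1, by omega⟩
  have hfirst : ∀ τ, D 1 (Pi.single 0 τ) = 0 := by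
    intro τ
    have h2 : scaledFamily (n := m + 1) 1 = stdFamily (le_refl (m + 1)) := by
      funext i
      simp [scaledFamily]
    simp only [hD, dualVec, h2, coordVec_single, ← Td_eq_oSimplex, Real.one_rpow, inv_one, one_smul]
    exact h1 τ
  have haxis : ∀ i τ, D 1 (Pi.single i τ) = 0 := by
    intro i τ
    rcases eq_or_ne i 0 with rfl | hi
    · exact hfirst τ
    · obtain ⟨k, hk⟩ : ∃ k, k ∉ ({0, i} : Finset (Fin (m + 1))) := by
        by_contra! h
        have := Finset.card_le_card (fun k _ => h k : Finset.univ ⊆ ({0, i} : Finset (Fin (m + 1))))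
        have h2 := Finset.card_le_two (a := (0 : Fin (m + 1))) (b := i)
        rw [Finset.card_univ, Fintype.card_fin] at this
        omega
      simp only [Finset.mem_insert, Finset.mem_singleton, not_or] at hk
      rw [← hperm _ (Equiv.swap 0 i * Equiv.swap i k), ← hfirst τ]
      · congr 1
        funext l
        have hl : Equiv.swap 0 i (Equiv.swap i k l) = i ↔ l = 0 := by
          rw [Equiv.swap_apply_eq_iff, Equiv.swap_apply_right, Equiv.swap_apply_eq_iff,
            Equiv.swap_apply_of_ne_of_ne hi.symm (Ne.symm hk.1)]
        simp only [Function.comp_apply, Pi.single_apply, Equiv.Perm.mul_apply, hl]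
      · rw [Equiv.Perm.sign_mul, Equiv.Perm.sign_swap hi.symm, Equiv.Perm.sign_swap (Ne.symm hk.2)]
        norm_num
  have hzero : ∀ t, D 1 t = 0 := by
    refine eq_zero_of_cut_equation ?_ (fun t i j hij s hs hs1 => ⟨s, 1 - s, hs, ?_⟩) haxis
    · refine (hΨ.continuous _ (isPolytope0_oSimplex _)).comp ?_
      unfold dualVec
      exact (continuous_coordVec (le_refl (m + 1))).const_smul ((1 : ℝ) ^ ((m + 1 : ℕ) : ℝ)⁻¹)⁻¹
    · rw [hcut 1 one_pos t i j hij s hs hs1, hlin _ (by linarith), hlin ((1 - s) * 1) (by linarith),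
        mul_one, mul_one]
  have hpos : ∀ v : Fin (m + 1) → Euc (m + 1), LinearIndependent ℝ v → 0 < detFamily v →
      Ψ (oSimplex v) x = 0 := by
    intro v hv hdet
    rw [hDv v hv hdet, hlin _ hdet, hzero, mul_zero]
  rcases lt_or_gt_of_ne (detFamily_ne_zero hv) with hneg | hdet
  · have h01 : (0 : Fin (m + 1)) ≠ Fin.last m := by
      rw [Ne, Fin.ext_iff]
      simp
      omega
    have := hpos (v ∘ Equiv.swap 0 (Fin.last m)) (hv.comp _ (Equiv.injective _)) (by
      rw [detFamily_comp_perm, Equiv.Perm.sign_swap h01]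
      simpa using hneg)
    rwa [oSimplex_comp_equiv] at this
  · exact hpos v hv hdet

end CovariantValuation

end FullDimension

section Vanishing

variable {n : ℕ} {p : ℝ} {Ψ : Set (Euc n) → Euc n → ℝ}

theorem CovariantValuation.apply_smul_eq_zero (hΨ : CovariantValuation p Ψ) {P : Set (Euc n)}
    (hP : IsPolytope0 P) {x : Euc n} (h1 : Ψ P x = 0) (h2 : Ψ P (-x) = 0) (τ : ℝ) :
    Ψ P (τ • x) = 0 := by
  rcases le_total 0 τ with hτ | hτ
  · rw [hΨ.smul P hP τ hτ, h1, mul_zero]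
  · have := hΨ.smul P hP (-τ) (by linarith) (-x)
    rwa [h2, mul_zero, smul_neg, neg_smul, neg_neg] at this

/-- A covariant valuation that is bounded below along dilates of the standard simplex vanishes if
it vanishes on the simplices `T^1`, `T^2` and `T^n` at `e_1` and `-e_1`. -/
theorem CovariantValuation.eq_zero (hΨ : CovariantValuation p Ψ) (hp : 1 ≤ p) (hn : 3 ≤ n)
    (hbd : ∀ y : Euc n, ∃ c d : ℝ, 0 < c ∧ c < d ∧ ∃ m : ℝ,
      ∀ s : ℝ, c < s → s < d → m ≤ Ψ (s • Td n n) y)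
    (h0 : ∀ d, d = 1 ∨ d = 2 ∨ d = n → Ψ (Td n d) (bvec ⟨0, by omega⟩) = 0 ∧
      Ψ (Td n d) (-bvec ⟨0, by omega⟩) = 0)
    {P : Set (Euc n)} (hP : IsPolytope0 P) (x : Euc n) : Ψ P x = 0 := by
  have h : ∀ d, d = 1 ∨ d = 2 ∨ d = n → ∀ τ : ℝ, Ψ (Td n d) (τ • bvec ⟨0, by omega⟩) = 0 := by
    intro d hd τ
    refine hΨ.apply_smul_eq_zero ?_ (h0 d hd).1 (h0 d hd).2 τ
    rw [Td_eq_oSimplex (by omega : d ≤ n)]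
    exact isPolytope0_oSimplex _
  have hlow := hΨ.oSimplex_apply_eq_zero_of_lt hp hn (h 1 (by simp)) (h 2 (by simp))
  refine (hΨ.cutAdditive x).eq_zero (fun ι _ v hv => ?_) hP
  have hcard : Fintype.card ι ≤ n := by
    simpa using hv.fintype_card_le_finrank
  have hv' := hv.comp _ (Fintype.equivFin ι).symm.injective
  rw [← oSimplex_comp_equiv (Fintype.equivFin ι).symm]
  rcases hcard.lt_or_eq with hlt | heq
  · exact hlow _ hlt _ x hv'
  · have key : ∀ d, d = n → ∀ w : Fin d → Euc n, LinearIndependent ℝ w → Ψ (oSimplex w) x = 0 := by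
      rintro d rfl w hw
      exact hΨ.oSimplex_apply_eq_zero_of_full hp hn hlow hbd (h d (by simp)) w x hw
    exact key _ heq _ hv'

end Vanishing

section StandardSimplexValues

variable {n : ℕ} {p : ℝ}

/-- The face of the standard simplex spanned by the origin and the basis vectors indexed by `s`. -/
def stdFace {d : ℕ} (hd : d ≤ n) (s : Finset (Fin d)) : Set (Euc n) :=
  oSimplex fun k => if k ∈ s then stdFamily hd k else 0

theorem stdFace_univ {d : ℕ} (hd : d ≤ n) : stdFace hd Finset.univ = Td n d := by
  simp [stdFace, Td_eq_oSimplex hd]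

theorem mem_stdFace {d : ℕ} (hd : d ≤ n) (s : Finset (Fin d)) (y : Euc n) :
    y ∈ stdFace hd s ↔ ∃ b : Fin d → ℝ, (∀ i, 0 ≤ b i) ∧ ∑ i, b i ≤ 1 ∧
      coordVec hd (fun k => if k ∈ s then b k else 0) = y := by
  have : ∀ b : Fin d → ℝ, ∑ k, b k • (if k ∈ s then stdFamily hd k else 0)
      = coordVec hd (fun k => if k ∈ s then b k else 0) := by
    intro b
    simp only [coordVec, smul_ite, smul_zero, ite_smul, zero_smul]
  rw [stdFace, mem_oSimplex]
  simp only [this]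

theorem isPolytope0_stdFace {d : ℕ} (hd : d ≤ n) (s : Finset (Fin d)) :
    IsPolytope0 (stdFace hd s) :=
  isPolytope0_oSimplex _

theorem isPolytope0_Td {d : ℕ} (hd : d ≤ n) : IsPolytope0 (Td n d) :=
  stdFace_univ hd ▸ isPolytope0_stdFace hd _

theorem supp_stdFace {d : ℕ} (hd : d ≤ n) (s : Finset (Fin d)) (i : Fin d) :
    supp (stdFace hd s) (stdFamily hd i) = if i ∈ s then 1 else 0 := by
  have hP := isPolytope0_stdFace hd s
  refine le_antisymm (supp_le ⟨0, hP.2⟩ _ fun y hy => ?_) ?_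
  · obtain ⟨b, hb0, hb1, rfl⟩ := (mem_stdFace hd s y).1 hy
    rw [real_inner_comm, inner_coordVec]
    split_ifs
    · exact (Finset.single_le_sum (fun k _ => hb0 k) (Finset.mem_univ i)).trans hb1
    · exact le_rfl
  · split_ifs with h
    · have hmem : stdFamily hd i ∈ stdFace hd s := by
        refine (mem_stdFace hd s _).2 ⟨Pi.single i 1, fun k => ?_, by simp, ?_⟩
        · rcases eq_or_ne k i with rfl | hk
          · simp
          · simp [hk]
        · rw [← one_smul ℝ (stdFamily hd i), ← coordVec_single]
          congr 1
          funext k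
          rcases eq_or_ne k i with rfl | hk
          · simp [h]
          · simp [hk]
      have := inner_le_supp hP.isCompact (stdFamily hd i) hmem
      rwa [real_inner_self_eq_norm_sq, (orthonormal_stdFamily hd).1, one_pow] at this
    · exact supp_nonneg hP.isCompact hP.2 _

theorem supp_stdFace_neg {d : ℕ} (hd : d ≤ n) (s : Finset (Fin d)) (i : Fin d) :
    supp (stdFace hd s) (-stdFamily hd i) = 0 := by
  have hP := isPolytope0_stdFace hd s
  refine le_antisymm (supp_le ⟨0, hP.2⟩ _ fun y hy => ?_) (supp_nonneg hP.isCompact hP.2 _)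
  obtain ⟨b, hb0, hb1, rfl⟩ := (mem_stdFace hd s y).1 hy
  rw [inner_neg_left, real_inner_comm, inner_coordVec, neg_nonpos]
  split_ifs
  · exact hb0 i
  · exact le_rfl

theorem stdFace_injective {d : ℕ} (hd : d ≤ n) : Function.Injective (stdFace hd) := by
  intro s t hst
  ext i
  have h1 := supp_stdFace hd s i
  rw [hst, supp_stdFace] at h1
  by_cases hs : i ∈ s <;> by_cases ht : i ∈ t <;> simp_all

theorem sdim_stdFace {d : ℕ} (hd : d ≤ n) (s : Finset (Fin d)) : sdim (stdFace hd s) = s.card := by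
  have hspan : Submodule.span ℝ (stdFace hd s)
      = Submodule.span ℝ (Set.range fun k : s => stdFamily hd k) := by
    apply le_antisymm
    · refine Submodule.span_le.2 (convexHull_min ?_ (Submodule.convex _))
      rintro _ (rfl | ⟨k, rfl⟩)
      · exact Submodule.zero_mem _
      · simp only
        split_ifs with hk
        · exact Submodule.subset_span ⟨⟨k, hk⟩, rfl⟩
        · exact Submodule.zero_mem _
    · refine Submodule.span_mono ?_
      rintro _ ⟨k, rfl⟩
      refine subset_convexHull ℝ _ (Or.inr ⟨k, ?_⟩)
      simp
  rw [sdim_eq_finrank_span (isPolytope0_stdFace hd s).2, hspan]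
  exact (finrank_span_eq_card ((linearIndependent_stdFamily hd).comp (fun k : s => (k : Fin d))
    Subtype.val_injective)).trans (Fintype.card_coe s)

theorem facesAtZero_Td {d : ℕ} (hd : d ≤ n) : facesAtZero (Td n d) = Set.range (stdFace hd) := by
  ext F
  have hP := isPolytope0_Td hd
  rw [mem_facesAtZero hP.2, ← stdFace_univ hd]
  have horth : ∀ l : Euc n, (∀ k, ⟪l, stdFamily hd k⟫ ≤ 0) →
      orthFace (stdFace hd Finset.univ) l
        = stdFace hd (Finset.univ.filter fun k => ⟪l, stdFamily hd k⟫ = 0) := by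
    intro l hl
    ext y
    rw [mem_stdFace]
    constructor
    · rintro ⟨hy, hly⟩
      obtain ⟨b, hb0, hb1, rfl⟩ := (mem_stdFace hd _ y).1 hy
      refine ⟨b, hb0, hb1, ?_⟩
      simp only [Finset.mem_univ, if_true, coordVec, inner_sum, inner_smul_right] at hly
      have h := (Finset.sum_eq_zero_iff_of_nonpos
        fun k _ => mul_nonpos_of_nonneg_of_nonpos (hb0 k) (hl k)).1 hly
      congr 1
      funext k
      have hk := h k (Finset.mem_univ k)
      by_cases hk0 : ⟪l, stdFamily hd k⟫ = 0
      · simp [hk0]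
      · simp [hk0, (mul_eq_zero.1 hk).resolve_right hk0]
    · rintro ⟨b, hb0, hb1, rfl⟩
      refine ⟨(mem_stdFace hd _ _).2 ⟨fun k => if k ∈ Finset.univ.filter
        (fun k => ⟪l, stdFamily hd k⟫ = 0) then b k else 0, fun k => ?_, ?_, by simp⟩, ?_⟩
      · dsimp only
        split_ifs
        · exact hb0 k
        · exact le_rfl
      · refine (Finset.sum_le_sum fun k _ => ?_).trans hb1
        split_ifs
        · exact le_rfl
        · exact hb0 k
      · simp only [coordVec, inner_sum, inner_smul_right]
        refine Finset.sum_eq_zero fun k _ => ?_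
        split_ifs with hk
        · rw [(Finset.mem_filter.1 hk).2, mul_zero]
        · rw [zero_mul]
  constructor
  · rintro ⟨l, hl, rfl⟩
    refine ⟨_, (horth l fun k => hl _ ?_).symm⟩
    exact subset_convexHull ℝ _ (Or.inr ⟨k, by simp⟩)
  · rintro ⟨s, rfl⟩
    have hin : ∀ k, ⟪coordVec hd (fun k => if k ∈ s then 0 else -1), stdFamily hd k⟫
        = if k ∈ s then 0 else -1 := fun k => inner_coordVec hd _ k
    refine ⟨coordVec hd (fun k => if k ∈ s then 0 else -1), fun y hy => ?_, ?_⟩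
    · obtain ⟨b, hb0, -, rfl⟩ := (mem_stdFace hd _ y).1 hy
      simp only [Finset.mem_univ, if_true]
      rw [coordVec.eq_def hd b, inner_sum]
      refine Finset.sum_nonpos fun k _ => ?_
      rw [inner_smul_right, hin]
      refine mul_nonpos_of_nonneg_of_nonpos (hb0 k) ?_
      split_ifs <;> norm_num
    · rw [horth _ fun k => by rw [hin]; split_ifs <;> norm_num]
      congr 1
      ext k
      simp [hin]

theorem faceSum_Td {d : ℕ} (hd : d ≤ n) (x : Euc n) :
    faceSum p (Td n d) x = ∑ s : Finset (Fin d), (-1) ^ s.card * supp (stdFace hd s) x ^ p := by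
  rw [faceSum, facesAtZero_Td hd, finsum_mem_range (stdFace_injective hd), finsum_eq_sum_of_fintype]
  simp only [sdim_stdFace]

theorem faceSum_Td_neg (hp : 1 ≤ p) {d : ℕ} (hd : d ≤ n) (i : Fin d) :
    faceSum p (Td n d) (-stdFamily hd i) = 0 := by
  rw [faceSum_Td hd]
  refine Finset.sum_eq_zero fun s _ => ?_
  rw [supp_stdFace_neg, Real.zero_rpow (by linarith), mul_zero]

theorem faceSum_Td_eq_sum_ite (hp : 1 ≤ p) {d : ℕ} (hd : d ≤ n) (i : Fin d) :
    faceSum p (Td n d) (stdFamily hd i)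
      = ∑ s : Finset (Fin d), if i ∈ s then (-1 : ℝ) ^ s.card else 0 := by
  rw [faceSum_Td hd]
  refine Finset.sum_congr rfl fun s _ => ?_
  rw [supp_stdFace]
  split_ifs
  · rw [Real.one_rpow, mul_one]
  · rw [Real.zero_rpow (by linarith), mul_zero]

theorem faceSum_Td_one (hp : 1 ≤ p) (hd : 1 ≤ n) :
    faceSum p (Td n 1) (stdFamily hd 0) = -1 := by
  rw [faceSum_Td_eq_sum_ite hp]
  have h : (∑ s : Finset (Fin 1), if (0 : Fin 1) ∈ s then (-1 : ℤ) ^ s.card else 0) = -1 := by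
    decide
  exact_mod_cast congrArg (Int.cast : ℤ → ℝ) h

theorem faceSum_Td_two (hp : 1 ≤ p) (hd : 2 ≤ n) :
    faceSum p (Td n 2) (stdFamily hd 0) = 0 := by
  rw [faceSum_Td_eq_sum_ite hp]
  have h : (∑ s : Finset (Fin 2), if (0 : Fin 2) ∈ s then (-1 : ℤ) ^ s.card else 0) = 0 := by
    decide
  exact_mod_cast congrArg (Int.cast : ℤ → ℝ) h

theorem mPlus_rpow_Td_of_lt (hp : 1 ≤ p) {d : ℕ} (hd : d < n) (x : Euc n) :
    mPlus p (Td n d) x ^ p = 0 := by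
  rw [mPlus_rpow hp]
  refine setIntegral_measure_zero _ (measure_mono_null ?_ (Measure.addHaar_submodule volume
    (Submodule.span ℝ (Set.range (stdFamily hd.le))) ?_))
  · rw [Td_eq_oSimplex hd.le]
    refine convexHull_min ?_ (Submodule.convex _)
    rintro _ (rfl | ⟨k, rfl⟩)
    · exact Submodule.zero_mem _
    · exact Submodule.subset_span ⟨k, rfl⟩
  · intro h
    have := finrank_span_eq_card (linearIndependent_stdFamily hd.le)
    rw [h, finrank_top, finrank_euclideanSpace_fin, Fintype.card_fin] at this
    omega

theorem mPlus_rpow_Td_neg (hp : 1 ≤ p) {d : ℕ} (hd : d ≤ n) (i : Fin d) :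
    mPlus p (Td n d) (-stdFamily hd i) ^ p = 0 := by
  rw [mPlus_rpow hp]
  refine setIntegral_eq_zero_of_forall_eq_zero fun y hy => ?_
  rw [← stdFace_univ hd] at hy
  have h := inner_le_supp (isPolytope0_stdFace hd _).isCompact (-stdFamily hd i) hy
  rw [supp_stdFace_neg] at h
  rw [max_eq_right h, Real.zero_rpow (by linarith)]

theorem mPlus_rpow_Td_pos (hp : 1 ≤ p) (i : Fin n) :
    0 < mPlus p (Td n n) (stdFamily le_rfl i) ^ p := by
  rw [mPlus_rpow hp, setIntegral_pos_iff_support_of_nonneg_ae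
    (ae_of_all _ fun y => Real.rpow_nonneg (le_max_right _ _) _)
    (integrableOn_max_inner_rpow hp (isPolytope0_Td le_rfl).isCompact _)]
  set U : Set (Euc n) := {y | (∀ k, 0 < ⟪y, stdFamily le_rfl k⟫) ∧
    ∑ k, ⟪y, stdFamily le_rfl k⟫ < 1} with hU
  have hopen : IsOpen U := by
    have : U = (⋂ k, {y | 0 < ⟪y, stdFamily le_rfl k⟫}) ∩
        {y | ∑ k, ⟪y, stdFamily le_rfl k⟫ < 1} := by
      ext y
      simp [hU]
    rw [this]
    exact (isOpen_iInter_of_finite fun k => isOpen_lt continuous_const (by fun_prop)).inter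
      (isOpen_lt (by fun_prop) continuous_const)
  have hne : U.Nonempty := by
    refine ⟨coordVec le_rfl fun _ => ((n : ℝ) + 1)⁻¹, fun k => ?_, ?_⟩
    · rw [inner_coordVec]
      positivity
    · simp only [inner_coordVec, Finset.sum_const, Finset.card_univ, Fintype.card_fin,
        nsmul_eq_mul]
      rw [← div_eq_mul_inv, div_lt_one (by positivity)]
      linarith
  refine (hopen.measure_pos volume hne).trans_le (measure_mono fun y hy => ⟨?_, ?_⟩)
  · have h := hy.1 i
    rw [real_inner_comm] at h
    exact (Real.rpow_pos_of_pos (lt_max_of_lt_left h) p).ne'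
  · rw [← stdFace_univ le_rfl, mem_stdFace]
    refine ⟨fun k => ⟪y, stdFamily le_rfl k⟫, fun k => (hy.1 k).le, hy.2.le, ?_⟩
    simp only [Finset.mem_univ, if_true]
    refine ext_inner_right ℝ fun z => ?_
    have hz : z ∈ Submodule.span ℝ (Set.range (stdFamily (le_refl n))) := by
      rw [span_eq_top_of_linearIndependent (linearIndependent_stdFamily le_rfl)]
      exact Submodule.mem_top
    induction hz using Submodule.span_induction with
    | mem z hz =>
      obtain ⟨k, rfl⟩ := hz
      exact inner_coordVec le_rfl _ k
    | zero => simp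
    | add a b _ _ ha hb => rw [inner_add_right, inner_add_right, ha, hb]
    | smul c a _ ha => rw [inner_smul_right, inner_smul_right, ha]

end StandardSimplexValues

section Combination

variable {n : ℕ} {p : ℝ}

theorem modelValuation_dilate (hp : 1 ≤ p) (a₁ a₂ b₁ b₂ c₁ c₂ : ℝ) {P : Set (Euc n)}
    (hP : IsPolytope0 P) {s : ℝ} (hs : 0 < s) (x : Euc n) :
    modelValuation p a₁ a₂ b₁ b₂ c₁ c₂ (s • P) x
      = s ^ n * s ^ p * (c₁ * mPlus p P x ^ p + c₂ * mPlus p P (-x) ^ p)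
        + s ^ p * ((a₂ * supp P x ^ p + (a₂ - a₁) * faceSum p P x)
          + (b₂ * supp P (-x) ^ p + (b₂ - b₁) * faceSum p P (-x))) := by
  set g : Euc n →ₗ[ℝ] Euc n := s • LinearMap.id with hg
  have hdet : LinearMap.det g = s ^ n := by
    rw [hg, LinearMap.det_smul, LinearMap.det_id, finrank_euclideanSpace_fin, mul_one]
  have hadj : ∀ y, LinearMap.adjoint g y = s • y := by
    intro y
    refine ext_inner_right ℝ fun z => ?_
    rw [LinearMap.adjoint_inner_left, inner_smul_left]
    simp [hg, inner_smul_right]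
  have hinj : Function.Injective g := smul_right_injective (Euc n) hs.ne'
  have hsn : LinearMap.det g ≠ 0 := by
    rw [hdet]
    positivity
  have himg : s • P = g '' P := rfl
  have hsp : ∀ y, supp P (s • y) ^ p = s ^ p * supp P y ^ p := fun y => by
    rw [supp_smul s hs.le, Real.mul_rpow hs.le (supp_nonneg hP.isCompact hP.2 y)]
  rw [himg, modelValuation_eq hp _ _ _ _ _ _ (hP.image g)]
  simp only [mPlus_rpow_image hp g hsn hP.isCompact, supp_image, faceSum_image p g hinj hP.2, hadj,
    hdet, mPlus_rpow_smul hp P hs.le, faceSum_smul p hP hs.le, hsp, abs_of_pos (pow_pos hs n)]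
  ring

theorem exists_modelValuation_dilate_le (hp : 1 ≤ p) (a₁ a₂ b₁ b₂ c₁ c₂ : ℝ) {P : Set (Euc n)}
    (hP : IsPolytope0 P) (d : ℝ) (x : Euc n) :
    ∃ M, ∀ s, 0 < s → s < d → modelValuation p a₁ a₂ b₁ b₂ c₁ c₂ (s • P) x ≤ M := by
  set A := c₁ * mPlus p P x ^ p + c₂ * mPlus p P (-x) ^ p with hA
  set B := (a₂ * supp P x ^ p + (a₂ - a₁) * faceSum p P x)
    + (b₂ * supp P (-x) ^ p + (b₂ - b₁) * faceSum p P (-x)) with hB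
  refine ⟨d ^ n * d ^ p * |A| + d ^ p * |B|, fun s hs hsd => ?_⟩
  rw [modelValuation_dilate hp _ _ _ _ _ _ hP hs]
  have hsp : 0 ≤ s ^ p := Real.rpow_nonneg hs.le p
  have hpow : s ^ p ≤ d ^ p := Real.rpow_le_rpow hs.le hsd.le (by linarith)
  have hpow' : s ^ n ≤ d ^ n := pow_le_pow_left₀ hs.le hsd.le n
  have hsn : s ^ n * s ^ p ≤ d ^ n * d ^ p :=
    mul_le_mul hpow' hpow hsp (pow_nonneg (hs.trans hsd).le n)
  exact add_le_add
    ((mul_le_mul_of_nonneg_left (le_abs_self A) (by positivity)).trans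
      (mul_le_mul_of_nonneg_right hsn (abs_nonneg A)))
    ((mul_le_mul_of_nonneg_left (le_abs_self B) hsp).trans
      (mul_le_mul_of_nonneg_right hpow (abs_nonneg B)))

theorem modelValuation_Td_one (hp : 1 ≤ p) (hn : 1 < n) (a₁ a₂ b₁ b₂ c₁ c₂ : ℝ) :
    modelValuation p a₁ a₂ b₁ b₂ c₁ c₂ (Td n 1) (stdFamily hn.le 0) = a₁ ∧
      modelValuation p a₁ a₂ b₁ b₂ c₁ c₂ (Td n 1) (-stdFamily hn.le 0) = b₁ := by
  have hp0 : p ≠ 0 := by linarith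
  have h1 := supp_stdFace hn.le Finset.univ 0
  have h2 := supp_stdFace_neg hn.le Finset.univ 0
  rw [stdFace_univ] at h1 h2
  simp only [modelValuation_eq hp _ _ _ _ _ _ (isPolytope0_Td hn.le), neg_neg,
    mPlus_rpow_Td_of_lt hp hn, h1, h2, faceSum_Td_one hp hn.le, faceSum_Td_neg hp hn.le,
    Finset.mem_univ, if_true, Real.one_rpow, Real.zero_rpow hp0]
  constructor <;> ring

theorem modelValuation_Td_two (hp : 1 ≤ p) (hn : 2 < n) (a₁ a₂ b₁ b₂ c₁ c₂ : ℝ) :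
    modelValuation p a₁ a₂ b₁ b₂ c₁ c₂ (Td n 2) (stdFamily hn.le 0) = a₂ ∧
      modelValuation p a₁ a₂ b₁ b₂ c₁ c₂ (Td n 2) (-stdFamily hn.le 0) = b₂ := by
  have hp0 : p ≠ 0 := by linarith
  have h1 := supp_stdFace hn.le Finset.univ 0
  have h2 := supp_stdFace_neg hn.le Finset.univ 0
  rw [stdFace_univ] at h1 h2
  simp only [modelValuation_eq hp _ _ _ _ _ _ (isPolytope0_Td hn.le), neg_neg,
    mPlus_rpow_Td_of_lt hp hn, h1, h2, faceSum_Td_two hp hn.le, faceSum_Td_neg hp hn.le,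
    Finset.mem_univ, if_true, Real.one_rpow, Real.zero_rpow hp0]
  constructor <;> ring

/-- The moment body coefficients can be chosen so as to prescribe the values of the model valuation
on the standard simplex at a basis vector and at its negative. -/
theorem exists_modelValuation_Td_eq (hp : 1 ≤ p) (i : Fin n) (a₁ a₂ b₁ b₂ r₁ r₂ : ℝ) :
    ∃ c₁ c₂, modelValuation p a₁ a₂ b₁ b₂ c₁ c₂ (Td n n) (stdFamily le_rfl i) = r₁ ∧
      modelValuation p a₁ a₂ b₁ b₂ c₁ c₂ (Td n n) (-stdFamily le_rfl i) = r₂ := by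
  have hM := (mPlus_rpow_Td_pos hp i).ne'
  set e : Euc n := stdFamily le_rfl i with he
  have h := fun c₁ c₂ x =>
    modelValuation_eq hp a₁ a₂ b₁ b₂ c₁ c₂ (isPolytope0_Td (le_refl n)) x
  set M := mPlus p (Td n n) e ^ p with hMdef
  have hneg : mPlus p (Td n n) (-e) ^ p = 0 := mPlus_rpow_Td_neg hp le_rfl i
  refine ⟨(r₁ - modelValuation p a₁ a₂ b₁ b₂ 0 0 (Td n n) e) / M,
    (r₂ - modelValuation p a₁ a₂ b₁ b₂ 0 0 (Td n n) (-e)) / M, ?_, ?_⟩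
  · rw [h, h 0 0, hneg, ← hMdef, div_mul_cancel₀ _ hM]
    ring
  · rw [h _ _ (-e), h 0 0 (-e), neg_neg, hneg, ← hMdef, div_mul_cancel₀ _ hM]
    ring

theorem det_toEuclideanLin (A : Matrix (Fin n) (Fin n) ℝ) :
    LinearMap.det (Matrix.toEuclideanLin A) = A.det := by
  rw [Matrix.toEuclideanLin, Matrix.toLpLin_eq_toLin, LinearMap.det_toLin]

theorem toEuclideanLin_transpose (A : Matrix (Fin n) (Fin n) ℝ) :
    Matrix.toEuclideanLin Aᵀ = LinearMap.adjoint (Matrix.toEuclideanLin A) := by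
  rw [← Matrix.toEuclideanLin_conjTranspose_eq_adjoint, Matrix.conjTranspose_eq_transpose_of_trivial]

theorem exists_toEuclideanLin_eq {g : Euc n →ₗ[ℝ] Euc n} (hg : LinearMap.det g = 1) :
    ∃ φ : Matrix.SpecialLinearGroup (Fin n) ℝ,
      Matrix.toEuclideanLin (φ : Matrix (Fin n) (Fin n) ℝ) = g := by
  have h : Matrix.toEuclideanLin (Matrix.toEuclideanLin.symm g) = g :=
    LinearEquiv.apply_symm_apply _ g
  exact ⟨⟨Matrix.toEuclideanLin.symm g, by rw [← det_toEuclideanLin, h, hg]⟩, h⟩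

theorem covariantValuation_sub_modelValuation (hp : 1 ≤ p) {Φ : Set (Euc n) → Euc n → ℝ}
    (hΦ : CovariantValuation p Φ) (a₁ a₂ b₁ b₂ c₁ c₂ : ℝ) :
    CovariantValuation p fun P x => Φ P x - modelValuation p a₁ a₂ b₁ b₂ c₁ c₂ P x where
  union_add_inter K L hK hL hU hI x := by
    have h1 := hΦ.union_add_inter K L hK hL hU hI x
    have h2 := modelValuation_union_add_inter hp a₁ a₂ b₁ b₂ c₁ c₂ hK hL hU hI x
    linarith
  image g hg P hP x := by
    rw [hΦ.image g hg P hP, modelValuation_image hp _ _ _ _ _ _ g hg hP]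
  continuous P hP := (hΦ.continuous P hP).sub (continuous_modelValuation hp _ _ _ _ _ _ hP)
  smul P hP c hc x := by
    rw [hΦ.smul P hP c hc, modelValuation_smul hp _ _ _ _ _ _ hP hc, mul_sub]

theorem CovariantValuation.exists_eq_modelValuation {Φ : Set (Euc n) → Euc n → ℝ}
    (hΦ : CovariantValuation p Φ) (hp : 1 ≤ p) (hn : 3 ≤ n)
    (hbd : ∀ y : Euc n, ∃ c d : ℝ, 0 < c ∧ c < d ∧ ∃ m : ℝ,
      ∀ s : ℝ, c < s → s < d → m ≤ Φ (s • Td n n) y) :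
    ∃ a₁ a₂ b₁ b₂ c₁ c₂ : ℝ, ∀ P, IsPolytope0 P → ∀ x,
      Φ P x = modelValuation p a₁ a₂ b₁ b₂ c₁ c₂ P x := by
  set e : Euc n := bvec ⟨0, by omega⟩ with he
  obtain ⟨c₁, c₂, hc₁, hc₂⟩ := exists_modelValuation_Td_eq hp (⟨0, by omega⟩ : Fin n)
    (Φ (Td n 1) e) (Φ (Td n 2) e) (Φ (Td n 1) (-e)) (Φ (Td n 2) (-e)) (Φ (Td n n) e)
    (Φ (Td n n) (-e))
  refine ⟨Φ (Td n 1) e, Φ (Td n 2) e, Φ (Td n 1) (-e), Φ (Td n 2) (-e), c₁, c₂,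
    fun P hP x => sub_eq_zero.1 ?_⟩
  refine (covariantValuation_sub_modelValuation hp hΦ _ _ _ _ _ _).eq_zero hp hn ?_ ?_ hP x
  · intro y
    obtain ⟨c, d, hc, hcd, m, hm⟩ := hbd y
    obtain ⟨M, hM⟩ := exists_modelValuation_dilate_le hp (Φ (Td n 1) e) (Φ (Td n 2) e)
      (Φ (Td n 1) (-e)) (Φ (Td n 2) (-e)) c₁ c₂ (isPolytope0_Td (le_refl n)) d y
    exact ⟨c, d, hc, hcd, m - M, fun s hs hsd =>
      sub_le_sub (hm s hs hsd) (hM s (hc.trans hs) hsd)⟩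
  · rintro d (rfl | rfl | rfl)
    · have h := modelValuation_Td_one hp (show 1 < n by omega) (Φ (Td n 1) e) (Φ (Td n 2) e)
        (Φ (Td n 1) (-e)) (Φ (Td n 2) (-e)) c₁ c₂
      exact ⟨sub_eq_zero.2 h.1.symm, sub_eq_zero.2 h.2.symm⟩
    · have h := modelValuation_Td_two hp (show 2 < n by omega) (Φ (Td n 1) e) (Φ (Td n 2) e)
        (Φ (Td n 1) (-e)) (Φ (Td n 2) (-e)) c₁ c₂
      exact ⟨sub_eq_zero.2 h.1.symm, sub_eq_zero.2 h.2.symm⟩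
    · exact ⟨sub_eq_zero.2 hc₁.symm, sub_eq_zero.2 hc₂.symm⟩

end Combination

/-- Lemma 5.4: for `n ≥ 3`, a map `Φ : P_o^n → C_p(ℝ^n)` such that for every `y` the
function `s ↦ Φ(sT^n)(y)` is bounded from below on some nonempty open interval
`⊂ (0, ∞)` is an `SL(n)` covariant valuation iff
`Φ P = c₁ h_{M_p⁺P}^p + c₂ h_{M_p⁻P}^p + Φ_{p;a₁,a₂}(P) + Φ_{p;b₁,b₂}(-P)` for some
constants `a₁, a₂, b₁, b₂, c₁, c₂ ∈ ℝ`. -/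
theorem function_valued_valuation_classification (n : ℕ) (hn : 3 ≤ n) (p : ℝ) (hp : 1 ≤ p)
    (Φ : Set (Euc n) → Euc n → ℝ)
    (hCp : ∀ P : Set (Euc n), IsPolytope0 P → Continuous (Φ P) ∧
      ∀ c : ℝ, 0 ≤ c → ∀ x : Euc n, Φ P (c • x) = c ^ p * Φ P x)
    (hbd : ∀ y : Euc n, ∃ c d : ℝ, 0 < c ∧ c < d ∧ ∃ m : ℝ,
      ∀ s : ℝ, c < s → s < d → m ≤ Φ (s • Td n n) y) :
    ((∀ K L : Set (Euc n), IsPolytope0 K → IsPolytope0 L → IsPolytope0 (K ∪ L) →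
        IsPolytope0 (K ∩ L) → ∀ x : Euc n,
        Φ (K ∪ L) x + Φ (K ∩ L) x = Φ K x + Φ L x) ∧
      (∀ (φ : Matrix.SpecialLinearGroup (Fin n) ℝ) (P : Set (Euc n)), IsPolytope0 P →
        ∀ x : Euc n, Φ (matAct (φ : Matrix (Fin n) (Fin n) ℝ) P) x
          = Φ P (matVec ((φ : Matrix (Fin n) (Fin n) ℝ))ᵀ x))) ↔
      ∃ a₁ a₂ b₁ b₂ c₁ c₂ : ℝ,
        ∀ P : Set (Euc n), IsPolytope0 P → ∀ x : Euc n,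
          Φ P x = c₁ * mPlus p P x ^ p + c₂ * mMinus p P x ^ p
            + PhiP p a₁ a₂ P x + PhiP p b₁ b₂ (-P) x := by
  constructor
  · rintro ⟨hval, hcov⟩
    have hΦ : CovariantValuation p Φ :=
      { union_add_inter := hval
        image := by
          intro g hg P hP x
          obtain ⟨φ, rfl⟩ := exists_toEuclideanLin_eq hg
          rw [← toEuclideanLin_transpose]
          exact hcov φ P hP x
        continuous := fun P hP => (hCp P hP).1
        smul := fun P hP => (hCp P hP).2 }
    exact hΦ.exists_eq_modelValuation hp hn hbd
  · rintro ⟨a₁, a₂, b₁, b₂, c₁, c₂, h⟩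
    refine ⟨fun K L hK hL hU hI x => ?_, fun φ P hP x => ?_⟩
    · rw [h _ hK, h _ hL, h _ hU, h _ hI]
      exact modelValuation_union_add_inter hp a₁ a₂ b₁ b₂ c₁ c₂ hK hL hU hI x
    · have himage := modelValuation_image hp a₁ a₂ b₁ b₂ c₁ c₂
        (Matrix.toEuclideanLin (φ : Matrix (Fin n) (Fin n) ℝ))
        (by rw [det_toEuclideanLin]; exact φ.2) hP x
      rw [← toEuclideanLin_transpose] at himage
      exact (h _ (hP.image _) x).trans (himage.trans (h P hP _).symm)
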